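/- Let Ω ⊂ ℝ be an open bounded interval, let f satisfy hypothesis (F), and let the data satisfy the smooth-data hypothesis (I∞). Then for each ε ∈ (0,1) there exist v_ε ∈ C^{4,1}(Ω̄×[0,∞)), u_ε ∈ C^{2,1}(Ω̄×[0,∞)) and Θ_ε ∈ C^{2,1}(Ω̄×[0,∞)) with Θ_ε > 0 throughout Ω̄×[0,∞) solving the regularized problem (P_ε) with data (v₀,u₀,Θ₀) in the classical pointwise sense; moreover u_{ε xxt}, u_{ε xxx}, u_{ε xxxx} and Θ_{ε xt} are continuous on Ω̄×[0,∞), and v_{ε xt} ∈ L^p_loc(Ω̄×[0,∞)) for every p ∈ (1,∞). -/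

import Mathlib

open MeasureTheory Filter Set Function

noncomputable section

/-- Integral over `Ω = (a,b)`. -/
def intOm (a b : ℝ) (g : ℝ → ℝ) : ℝ := ∫ x in Ioo a b, g x

/-- Double integral over `Ω × (0,T)`. -/
def intOmT (a b T : ℝ) (F : ℝ → ℝ → ℝ) : ℝ :=
  ∫ p in (Ioo a b) ×ˢ (Ioo 0 T), F p.1 p.2

/-- Squared `L²(Ω)` integral of `g`. -/
def sqOm (a b : ℝ) (g : ℝ → ℝ) : ℝ := ∫ x in Ioo a b, (g x) ^ 2

/-- `L²(Ω)` norm. -/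
def nrmL2 (a b : ℝ) (g : ℝ → ℝ) : ℝ := (∫ x in Ioo a b, (g x) ^ 2) ^ (1 / 2 : ℝ)

/-- `L¹(Ω)` norm. -/
def nrmL1 (a b : ℝ) (g : ℝ → ℝ) : ℝ := ∫ x in Ioo a b, |g x|

/-- Membership in `L²(Ω)`. -/
def MemL2 (a b : ℝ) (g : ℝ → ℝ) : Prop :=
  AEStronglyMeasurable g (volume.restrict (Ioo a b)) ∧
    IntegrableOn (fun x => (g x) ^ 2) (Ioo a b)

/-- Zero-trace weak derivative on `(a,b)`: `g ∈ W₀^{1,1}(a,b)` with weak derivative `g'`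
(integration by parts against all smooth test functions, with no boundary terms). -/
def WeakDerivZ (a b : ℝ) (g g' : ℝ → ℝ) : Prop :=
  ∀ ψ : ℝ → ℝ, ContDiff ℝ (⊤ : ℕ∞) ψ →
    ∫ x in Ioo a b, g x * deriv ψ x = - ∫ x in Ioo a b, g' x * ψ x

/-- Interior weak derivative on `(a,b)`: `g ∈ W^{1,1}(a,b)` with weak derivative `g'`. -/
def WeakDerivI (a b : ℝ) (g g' : ℝ → ℝ) : Prop :=
  ∀ ψ : ℝ → ℝ, ContDiff ℝ (⊤ : ℕ∞) ψ → tsupport ψ ⊆ Ioo a b →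
    ∫ x in Ioo a b, g x * deriv ψ x = - ∫ x in Ioo a b, g' x * ψ x

/-- Hypothesis (F) on the nonlinearity `f`, where `f'`, `f''` denote its first and second
derivatives on `[0,∞)`: `f ∈ C²([0,∞))`, `f(0)=0`, `f' > 0` on `[0,∞)`,
and `f' ∈ W^{1,∞}((0,∞))` (i.e. `f'` and `f''` are bounded). -/
structure HypF (f f' f'' : ℝ → ℝ) : Prop where
  hasDeriv₁ : ∀ x ∈ Ici (0 : ℝ), HasDerivWithinAt f (f' x) (Ici 0) x
  hasDeriv₂ : ∀ x ∈ Ici (0 : ℝ), HasDerivWithinAt f' (f'' x) (Ici 0) x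
  cont₂ : ContinuousOn f'' (Ici 0)
  zero : f 0 = 0
  pos : ∀ x ∈ Ici (0 : ℝ), 0 < f' x
  bdd : ∃ M : ℝ, ∀ x ∈ Ici (0 : ℝ), |f' x| ≤ M ∧ |f'' x| ≤ M

/-- Partial derivative in the first (spatial) variable. -/
def pdx (w : ℝ → ℝ → ℝ) : ℝ → ℝ → ℝ := fun x t => deriv (fun y => w y t) x

/-- Partial derivative in the second (time) variable. -/
def pdt (w : ℝ → ℝ → ℝ) : ℝ → ℝ → ℝ := fun x t => deriv (fun s => w x s) t

/-- Test functions in `C₀^∞(Ω × [0,T))`. -/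
structure TestU (a b T : ℝ) (φ : ℝ → ℝ → ℝ) : Prop where
  smooth : ContDiff ℝ (⊤ : ℕ∞) (uncurry φ)
  suppx : ∃ K : Set ℝ, IsCompact K ∧ K ⊆ Ioo a b ∧ ∀ x t, x ∉ K → φ x t = 0
  suppt : ∃ T' : ℝ, T' < T ∧ ∀ x t, T' ≤ t → φ x t = 0

/-- Test functions in `C^∞(Ω̄ × [0,T))`, compactly supported in time. -/
structure TestT (T : ℝ) (φ : ℝ → ℝ → ℝ) : Prop where
  smooth : ContDiff ℝ (⊤ : ℕ∞) (uncurry φ)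
  suppt : ∃ T' : ℝ, T' < T ∧ ∀ x t, T' ≤ t → φ x t = 0

/-- Test functions in `C₀^∞(Ω × (0,T))`. -/
structure TestInt (a b T : ℝ) (φ : ℝ → ℝ → ℝ) : Prop where
  smooth : ContDiff ℝ (⊤ : ℕ∞) (uncurry φ)
  suppx : ∃ K : Set ℝ, IsCompact K ∧ K ⊆ Ioo a b ∧ ∀ x t, x ∉ K → φ x t = 0
  supptime : ∃ K : Set ℝ, IsCompact K ∧ K ⊆ Ioo 0 T ∧ ∀ x t, t ∉ K → φ x t = 0

/-- Definition (W): weak solution of (P) on `Ω × (0,T)`.  Here `ut`, `ux`, `Θx` denote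
the weak derivatives of `u` (in time and space) and of `Θ` (in space). -/
structure IsWeakSol (a b T : ℝ) (f f' : ℝ → ℝ) (u0 u0t Θ0 : ℝ → ℝ)
    (u ut ux Θ Θx : ℝ → ℝ → ℝ) : Prop where
  u_sliceL1 : ∀ t ∈ Icc 0 T, IntegrableOn (fun x => u x t) (Ioo a b)
  u_contL1 : ∀ t₀ ∈ Icc 0 T,
    Tendsto (fun t => ∫ x in Ioo a b, |u x t - u x t₀|) (nhdsWithin t₀ (Icc 0 T)) (nhds 0)
  u_int : IntegrableOn (fun p : ℝ × ℝ => u p.1 p.2) ((Ioo a b) ×ˢ (Ioo 0 T))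
  ux_int : IntegrableOn (fun p : ℝ × ℝ => ux p.1 p.2) ((Ioo a b) ×ˢ (Ioo 0 T))
  u_W0 : ∀ᵐ t ∂volume.restrict (Ioo 0 T), WeakDerivZ a b (fun x => u x t) (fun x => ux x t)
  Θ_int : IntegrableOn (fun p : ℝ × ℝ => Θ p.1 p.2) ((Ioo a b) ×ˢ (Ioo 0 T))
  Θx_int : IntegrableOn (fun p : ℝ × ℝ => Θx p.1 p.2) ((Ioo a b) ×ˢ (Ioo 0 T))
  Θ_W : ∀ᵐ t ∂volume.restrict (Ioo 0 T), WeakDerivI a b (fun x => Θ x t) (fun x => Θx x t)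
  Θ_nonneg : ∀ᵐ p ∂volume.restrict ((Ioo a b) ×ˢ (Ioo 0 T)), 0 ≤ Θ p.1 p.2
  ut_weak : ∀ φ : ℝ → ℝ → ℝ, TestInt a b T φ →
    intOmT a b T (fun x t => u x t * pdt φ x t) = - intOmT a b T (fun x t => ut x t * φ x t)
  ut_int : IntegrableOn (fun p : ℝ × ℝ => ut p.1 p.2) ((Ioo a b) ×ˢ (Ioo 0 T))
  g1_int : IntegrableOn (fun p : ℝ × ℝ => f' (Θ p.1 p.2) * Θx p.1 p.2)
    ((Ioo a b) ×ˢ (Ioo 0 T))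
  g2_int : IntegrableOn (fun p : ℝ × ℝ => f' (Θ p.1 p.2) * Θx p.1 p.2 * ut p.1 p.2)
    ((Ioo a b) ×ˢ (Ioo 0 T))
  g3_int : IntegrableOn (fun p : ℝ × ℝ => f (Θ p.1 p.2) * ut p.1 p.2)
    ((Ioo a b) ×ˢ (Ioo 0 T))
  weak_u : ∀ φ : ℝ → ℝ → ℝ, TestU a b T φ →
    intOmT a b T (fun x t => u x t * pdt (pdt φ) x t)
        - intOm a b (fun x => u0t x * φ x 0) + intOm a b (fun x => u0 x * pdt φ x 0)
      = - intOmT a b T (fun x t => ux x t * pdx φ x t)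
        - intOmT a b T (fun x t => f' (Θ x t) * Θx x t * φ x t)
  weak_Θ : ∀ φ : ℝ → ℝ → ℝ, TestT T φ →
    - intOmT a b T (fun x t => Θ x t * pdt φ x t) - intOm a b (fun x => Θ0 x * φ x 0)
      = - intOmT a b T (fun x t => Θx x t * pdx φ x t)
        + intOmT a b T (fun x t => f' (Θ x t) * Θx x t * ut x t * φ x t)
        + intOmT a b T (fun x t => f (Θ x t) * ut x t * pdx φ x t)

/-- Continuity of `t ↦ w(·,t)` as a map `J → L²(Ω)` (with slices in `L²(Ω)`). -/
def ContL2 (a b : ℝ) (J : Set ℝ) (w : ℝ → ℝ → ℝ) : Prop :=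
  (∀ t ∈ J, MemL2 a b (fun x => w x t)) ∧
    ∀ t₀ ∈ J, Tendsto (fun t => ∫ x in Ioo a b, (w x t - w x t₀) ^ 2)
      (nhdsWithin t₀ J) (nhds 0)

/-- The regularity class (R_T):  `u ∈ C⁰([0,T];W₀^{1,2})`, `u_t ∈ C⁰([0,T];L²)`,
`Θ ∈ C⁰([0,T];L²) ∩ L²((0,T);W^{1,2})`. -/
structure RegT (a b T : ℝ) (u ut ux Θ Θx : ℝ → ℝ → ℝ) : Prop where
  u_cont : ContL2 a b (Icc 0 T) u
  ux_cont : ContL2 a b (Icc 0 T) ux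
  u_W0 : ∀ t ∈ Icc (0 : ℝ) T, WeakDerivZ a b (fun x => u x t) (fun x => ux x t)
  ut_cont : ContL2 a b (Icc 0 T) ut
  Θ_cont : ContL2 a b (Icc 0 T) Θ
  Θ_sq_int : IntegrableOn (fun p : ℝ × ℝ => (Θ p.1 p.2) ^ 2) ((Ioo a b) ×ˢ (Ioo 0 T))
  Θx_sq_int : IntegrableOn (fun p : ℝ × ℝ => (Θx p.1 p.2) ^ 2) ((Ioo a b) ×ˢ (Ioo 0 T))

/-- Data hypothesis (I), with `u0x` the weak derivative of `u0 ∈ W₀^{1,2}(Ω)`. -/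
structure DataI (a b : ℝ) (u0 u0x u0t Θ0 : ℝ → ℝ) : Prop where
  u0_L2 : MemL2 a b u0
  u0x_L2 : MemL2 a b u0x
  u0_W0 : WeakDerivZ a b u0 u0x
  u0t_L2 : MemL2 a b u0t
  Θ0_L2 : MemL2 a b Θ0
  Θ0_nonneg : ∀ᵐ x ∂volume.restrict (Ioo a b), 0 ≤ Θ0 x

/-- Smooth-data hypothesis (I∞). -/
structure SmoothData (a b : ℝ) (v0 u0 Θ0 : ℝ → ℝ) : Prop where
  v0_smooth : ContDiff ℝ (⊤ : ℕ∞) v0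
  v0_supp : ∃ K : Set ℝ, IsCompact K ∧ K ⊆ Ioo a b ∧ ∀ x, x ∉ K → v0 x = 0
  u0_smooth : ContDiff ℝ (⊤ : ℕ∞) u0
  u0_supp : ∃ K : Set ℝ, IsCompact K ∧ K ⊆ Ioo a b ∧ ∀ x, x ∉ K → u0 x = 0
  Θ0_smooth : ContDiff ℝ (⊤ : ℕ∞) Θ0
  Θ0_pos : ∀ x ∈ Icc a b, 0 < Θ0 x
  Θ0x_supp : ∃ K : Set ℝ, IsCompact K ∧ K ⊆ Ioo a b ∧ ∀ x, x ∉ K → deriv Θ0 x = 0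

/-- Classical solution of the regularized problem (P_ε), of class
`C^{4,1} × C^{2,1} × C^{2,1}(Ω̄ × [0,∞))`, with positive temperature. -/
structure IsClassicalSolEps (a b : ℝ) (f : ℝ → ℝ) (ε : ℝ) (v0 u0 Θ0 : ℝ → ℝ)
    (v u Θ : ℝ → ℝ → ℝ) : Prop where
  diffx_v : ∀ k < 4, ∀ x ∈ Icc a b, ∀ t ∈ Ici (0 : ℝ),
    DifferentiableAt ℝ (fun y => pdx^[k] v y t) x
  difft_v : ∀ x ∈ Icc a b, ∀ t ∈ Ici (0 : ℝ), DifferentiableAt ℝ (fun s => v x s) t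
  cont_v : ∀ k ≤ 4, ContinuousOn (uncurry (pdx^[k] v)) ((Icc a b) ×ˢ (Ici 0))
  contt_v : ContinuousOn (uncurry (pdt v)) ((Icc a b) ×ˢ (Ici 0))
  diffx_u : ∀ k < 2, ∀ x ∈ Icc a b, ∀ t ∈ Ici (0 : ℝ),
    DifferentiableAt ℝ (fun y => pdx^[k] u y t) x
  difft_u : ∀ x ∈ Icc a b, ∀ t ∈ Ici (0 : ℝ), DifferentiableAt ℝ (fun s => u x s) t
  cont_u : ∀ k ≤ 2, ContinuousOn (uncurry (pdx^[k] u)) ((Icc a b) ×ˢ (Ici 0))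
  contt_u : ContinuousOn (uncurry (pdt u)) ((Icc a b) ×ˢ (Ici 0))
  diffx_Θ : ∀ k < 2, ∀ x ∈ Icc a b, ∀ t ∈ Ici (0 : ℝ),
    DifferentiableAt ℝ (fun y => pdx^[k] Θ y t) x
  difft_Θ : ∀ x ∈ Icc a b, ∀ t ∈ Ici (0 : ℝ), DifferentiableAt ℝ (fun s => Θ x s) t
  cont_Θ : ∀ k ≤ 2, ContinuousOn (uncurry (pdx^[k] Θ)) ((Icc a b) ×ˢ (Ici 0))
  contt_Θ : ContinuousOn (uncurry (pdt Θ)) ((Icc a b) ×ˢ (Ici 0))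
  Θ_pos : ∀ x ∈ Icc a b, ∀ t ∈ Ici (0 : ℝ), 0 < Θ x t
  eq_v : ∀ x ∈ Ioo a b, ∀ t ∈ Ioi (0 : ℝ),
    pdt v x t = -ε * pdx^[4] v x t + pdx^[2] u x t - pdx (fun y s => f (Θ y s)) x t
  eq_u : ∀ x ∈ Ioo a b, ∀ t ∈ Ioi (0 : ℝ), pdt u x t = ε * pdx^[2] u x t + v x t
  eq_Θ : ∀ x ∈ Ioo a b, ∀ t ∈ Ioi (0 : ℝ),
    pdt Θ x t = pdx^[2] Θ x t - f (Θ x t) * pdx v x t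
  bc_v : ∀ t ∈ Ioi (0 : ℝ),
    v a t = 0 ∧ v b t = 0 ∧ pdx^[2] v a t = 0 ∧ pdx^[2] v b t = 0
  bc_u : ∀ t ∈ Ioi (0 : ℝ), u a t = 0 ∧ u b t = 0
  bc_Θ : ∀ t ∈ Ioi (0 : ℝ), pdx Θ a t = 0 ∧ pdx Θ b t = 0
  init : ∀ x ∈ Icc a b, v x 0 = v0 x ∧ u x 0 = u0 x ∧ Θ x 0 = Θ0 x

/-- Weak convergence in `L²_loc(Ω̄ × [0,∞))`. -/
def WkL2loc (a b : ℝ) (wj : ℕ → ℝ → ℝ → ℝ) (w : ℝ → ℝ → ℝ) : Prop :=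
  ∀ T > (0 : ℝ), ∀ ψ : ℝ → ℝ → ℝ,
    AEStronglyMeasurable (fun p : ℝ × ℝ => ψ p.1 p.2)
      (volume.restrict ((Icc a b) ×ˢ (Icc 0 T))) →
    IntegrableOn (fun p : ℝ × ℝ => (ψ p.1 p.2) ^ 2) ((Icc a b) ×ˢ (Icc 0 T)) →
    Tendsto (fun j => ∫ p in (Icc a b) ×ˢ (Icc 0 T), wj j p.1 p.2 * ψ p.1 p.2) atTop
      (nhds (∫ p in (Icc a b) ×ˢ (Icc 0 T), w p.1 p.2 * ψ p.1 p.2))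

namespace EpsReg

/-- The frequencies `kπ/L`. -/
def lam (L : ℝ) (k : ℕ) : ℝ := k * (Real.pi / L)

/-- The cosine basis functions. -/
def bc (L : ℝ) (k : ℕ) (x : ℝ) : ℝ := Real.cos (lam L k * x)

/-- The sine basis functions. -/
def bs (L : ℝ) (k : ℕ) (x : ℝ) : ℝ := Real.sin (lam L k * x)

/-- The function series with time-dependent coefficients `c` in the system `e`. -/
def ser (e : ℕ → ℝ → ℝ) (c : ℕ → ℝ → ℝ) (x t : ℝ) : ℝ := ∑' k, c k t * e k x

/-- Absolute summability of `∑ c k t`, with tails uniformly small for `t ∈ I`. -/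
def US (c : ℕ → ℝ → ℝ) (I : Set ℝ) : Prop :=
  ∀ η > (0 : ℝ), ∃ N : ℕ, 1 ≤ N ∧ ∀ M : ℕ, ∀ t ∈ I, ∑ k ∈ Finset.Ico N M, |c k t| ≤ η

lemma lam_zero (L : ℝ) : lam L 0 = 0 := by simp [lam]

lemma lam_nonneg {L : ℝ} (hL : 0 < L) (k : ℕ) : 0 ≤ lam L k := by
  unfold lam; positivity

lemma lam_pos {L : ℝ} (hL : 0 < L) {k : ℕ} (hk : 1 ≤ k) : 0 < lam L k := by
  have : (0 : ℝ) < k := by exact_mod_cast hk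
  unfold lam; positivity

lemma lam_one_le {L : ℝ} (hL : 0 < L) {k : ℕ} (hk : 1 ≤ k) : lam L 1 ≤ lam L k := by
  have : (1 : ℝ) ≤ k := by exact_mod_cast hk
  unfold lam
  gcongr

lemma abs_bc_le (L : ℝ) (k : ℕ) (x : ℝ) : |bc L k x| ≤ 1 := Real.abs_cos_le_one _

lemma abs_bs_le (L : ℝ) (k : ℕ) (x : ℝ) : |bs L k x| ≤ 1 := Real.abs_sin_le_one _

lemma continuous_bc (L : ℝ) (k : ℕ) : Continuous (bc L k) := by unfold bc; fun_prop

lemma continuous_bs (L : ℝ) (k : ℕ) : Continuous (bs L k) := by unfold bs; fun_prop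

lemma hasDerivAt_bc (L : ℝ) (k : ℕ) (x : ℝ) :
    HasDerivAt (bc L k) (-(lam L k * bs L k x)) x := by
  have := ((hasDerivAt_id x).const_mul (lam L k)).cos
  refine this.congr_deriv ?_
  simp [bs]; ring

lemma hasDerivAt_bs (L : ℝ) (k : ℕ) (x : ℝ) :
    HasDerivAt (bs L k) (lam L k * bc L k x) x := by
  have := ((hasDerivAt_id x).const_mul (lam L k)).sin
  refine this.congr_deriv ?_
  simp [bc]; ring

lemma bs_neg (L : ℝ) (k : ℕ) (x : ℝ) : bs L k (-x) = -bs L k x := by simp [bs]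

lemma bc_neg (L : ℝ) (k : ℕ) (x : ℝ) : bc L k (-x) = bc L k x := by simp [bc]

lemma lam_mul_L {L : ℝ} (hL : 0 < L) (k : ℕ) : lam L k * L = k * Real.pi := by
  unfold lam; field_simp

lemma bs_L {L : ℝ} (hL : 0 < L) (k : ℕ) : bs L k L = 0 := by
  simp [bs, lam_mul_L hL, Real.sin_nat_mul_pi]

lemma bs_zero (L : ℝ) (k : ℕ) : bs L k 0 = 0 := by simp [bs]

lemma bc_periodic {L : ℝ} (hL : 0 < L) (k : ℕ) : Function.Periodic (bc L k) (2 * L) := by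
  intro x
  have : lam L k * (x + 2 * L) = lam L k * x + k * (2 * Real.pi) := by
    have := lam_mul_L hL k; linear_combination 2 * this
  simp only [bc, this, Real.cos_add_nat_mul_two_pi]

lemma bs_periodic {L : ℝ} (hL : 0 < L) (k : ℕ) : Function.Periodic (bs L k) (2 * L) := by
  intro x
  have : lam L k * (x + 2 * L) = lam L k * x + k * (2 * Real.pi) := by
    have := lam_mul_L hL k; linear_combination 2 * this
  simp only [bs, this, Real.sin_add_nat_mul_two_pi]

/-- A system of continuous functions bounded by one. -/
structure Sys (e : ℕ → ℝ → ℝ) : Prop where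
  bdd : ∀ k x, |e k x| ≤ 1
  cont : ∀ k, Continuous (e k)

lemma sys_bc (L : ℝ) : Sys (bc L) := ⟨abs_bc_le L, continuous_bc L⟩

lemma sys_bs (L : ℝ) : Sys (bs L) := ⟨abs_bs_le L, continuous_bs L⟩

namespace US

variable {c d : ℕ → ℝ → ℝ} {I J : Set ℝ}

lemma mono (h : US c I) (hJ : J ⊆ I) : US c J := by
  intro η hη
  obtain ⟨N, hN, h⟩ := h η hη
  exact ⟨N, hN, fun M t ht => h M t (hJ ht)⟩

lemma summable (h : US c I) {t : ℝ} (ht : t ∈ I) : Summable (fun k => |c k t|) := by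
  obtain ⟨N, hN, h⟩ := h 1 one_pos
  refine summable_of_sum_range_le (c := ∑ k ∈ Finset.range N, |c k t| + 1)
    (fun _ => abs_nonneg _) (fun n => ?_)
  rcases le_total n N with hn | hn
  · have := Finset.sum_le_sum_of_subset_of_nonneg (Finset.range_mono hn)
      (fun i _ _ => abs_nonneg (c i t))
    linarith
  · rw [← Finset.sum_range_add_sum_Ico _ hn]
    have := h n t ht
    linarith

lemma of_le {C : ℝ} (h : US d I) (hC : 0 ≤ C) (hcd : ∀ k, 1 ≤ k → ∀ t ∈ I, |c k t| ≤ C * |d k t|) :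
    US c I := by
  intro η hη
  obtain ⟨N, hN, h⟩ := h (η / (C + 1)) (by positivity)
  refine ⟨N, hN, fun M t ht => ?_⟩
  calc ∑ k ∈ Finset.Ico N M, |c k t| ≤ ∑ k ∈ Finset.Ico N M, C * |d k t| :=
        Finset.sum_le_sum fun k hk => hcd k (hN.trans (Finset.mem_Ico.1 hk).1) t ht
    _ = C * ∑ k ∈ Finset.Ico N M, |d k t| := by rw [Finset.mul_sum]
    _ ≤ C * (η / (C + 1)) := by gcongr; exact h M t ht
    _ ≤ η := by
        rw [mul_div_assoc', div_le_iff₀ (by positivity)]; nlinarith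

lemma of_bound {B : ℕ → ℝ} (hB : Summable B) (h : ∀ k, 1 ≤ k → ∀ t ∈ I, |c k t| ≤ B k) :
    US c I := by
  intro η hη
  have hB' : Summable fun k => |B k| := hB.abs
  obtain ⟨s, hs⟩ := summable_iff_vanishing_norm.1 hB' η hη
  refine ⟨s.sup id + 1, by omega, fun M t ht => ?_⟩
  have := hs (Finset.Ico (s.sup id + 1) M) (by
    rw [Finset.disjoint_left]
    intro a ha ha'
    have := Finset.le_sup (f := id) ha'
    simp only [Finset.mem_Ico, id] at *
    omega)
  rw [Real.norm_eq_abs] at this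
  refine le_trans ?_ ((le_abs_self _).trans this.le)
  refine Finset.sum_le_sum fun k hk => ?_
  exact (h k (by have := (Finset.mem_Ico.1 hk).1; omega) t ht).trans (le_abs_self _)

lemma add (hc : US c I) (hd : US d I) : US (fun k t => c k t + d k t) I := by
  intro η hη
  obtain ⟨N, hN, h⟩ := hc (η / 2) (by positivity)
  obtain ⟨N', hN', h'⟩ := hd (η / 2) (by positivity)
  refine ⟨max N N', by omega, fun M t ht => ?_⟩
  have h1 : ∑ k ∈ Finset.Ico (max N N') M, |c k t| ≤ η / 2 :=
    (Finset.sum_le_sum_of_subset_of_nonneg (Finset.Ico_subset_Ico_left (le_max_left _ _))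
      (fun i _ _ => abs_nonneg (c i t))).trans (h M t ht)
  have h2 : ∑ k ∈ Finset.Ico (max N N') M, |d k t| ≤ η / 2 :=
    (Finset.sum_le_sum_of_subset_of_nonneg (Finset.Ico_subset_Ico_left (le_max_right _ _))
      (fun i _ _ => abs_nonneg (d i t))).trans (h' M t ht)
  calc ∑ k ∈ Finset.Ico (max N N') M, |c k t + d k t|
      ≤ ∑ k ∈ Finset.Ico (max N N') M, (|c k t| + |d k t|) :=
        Finset.sum_le_sum fun k _ => abs_add_le _ _
    _ ≤ η := by rw [Finset.sum_add_distrib]; linarith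

lemma const_mul (hc : US c I) (C : ℝ) : US (fun k t => C * c k t) I :=
  hc.of_le (abs_nonneg C) fun k _ t _ => by rw [abs_mul]

lemma congr (hc : US c I) (h : ∀ k, 1 ≤ k → ∀ t ∈ I, d k t = c k t) : US d I :=
  hc.of_le zero_le_one fun k hk t ht => by rw [h k hk t ht, one_mul]

lemma sub (hc : US c I) (hd : US d I) : US (fun k t => c k t - d k t) I :=
  (hc.add (hd.const_mul (-1))).congr fun k _ t _ => by ring

/-- Uniform convergence of the associated function series. -/
lemma tendstoUniformlyOn (h : US c I) {e : ℕ → ℝ → ℝ} (he : ∀ k x, |e k x| ≤ 1) :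
    TendstoUniformlyOn (fun (N : ℕ) (p : ℝ × ℝ) => ∑ k ∈ Finset.range N, c k p.2 * e k p.1)
      (uncurry (ser e c)) atTop (univ ×ˢ I) := by
  rw [Metric.tendstoUniformlyOn_iff]
  intro η hη
  obtain ⟨N, hN, hNb⟩ := h (η / 2) (by positivity)
  filter_upwards [eventually_ge_atTop N] with n hn p hp
  have hs : Summable fun k => c k p.2 * e k p.1 := by
    refine Summable.of_norm_bounded (h.summable hp.2) fun k => ?_
    rw [Real.norm_eq_abs, abs_mul]
    exact mul_le_of_le_one_right (abs_nonneg _) (he _ _)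
  have hlim : Tendsto (fun M => |∑ k ∈ Finset.range M, c k p.2 * e k p.1
      - ∑ k ∈ Finset.range n, c k p.2 * e k p.1|) atTop
      (nhds |uncurry (ser e c) p - ∑ k ∈ Finset.range n, c k p.2 * e k p.1|) :=
    ((hs.hasSum.tendsto_sum_nat).sub_const _).abs
  rw [Real.dist_eq]
  refine lt_of_le_of_lt (le_of_tendsto hlim ?_) (half_lt_self hη)
  filter_upwards [eventually_ge_atTop n] with M hM
  rw [← Finset.sum_range_add_sum_Ico _ hM, add_sub_cancel_left]
  refine (Finset.abs_sum_le_sum_abs _ _).trans (le_trans ?_ (hNb M p.2 hp.2))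
  refine le_trans (Finset.sum_le_sum (g := fun k => |c k p.2|) fun k _ => ?_)
    (Finset.sum_le_sum_of_subset_of_nonneg (Finset.Ico_subset_Ico_left hn)
      (fun i _ _ => abs_nonneg _))
  rw [abs_mul]
  exact mul_le_of_le_one_right (abs_nonneg _) (he _ _)

lemma continuousOn_ser (h : US c I) {e : ℕ → ℝ → ℝ} (he : Sys e)
    (hc : ∀ k, ContinuousOn (c k) I) : ContinuousOn (uncurry (ser e c)) (univ ×ˢ I) := by
  refine (h.tendstoUniformlyOn he.bdd).continuousOn (Frequently.of_forall fun n => ?_)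
  refine continuousOn_finsetSum _ fun k _ => ?_
  exact ((hc k).comp continuousOn_snd fun p hp => hp.2).mul
    ((he.cont k).comp continuous_fst).continuousOn

lemma hasDerivAt_time (hd : US d I) (hI : IsOpen I) {e : ℕ → ℝ → ℝ} (he : ∀ k x, |e k x| ≤ 1)
    (hc : ∀ t ∈ I, Summable fun k => |c k t|)
    (hderiv : ∀ k, ∀ t ∈ I, HasDerivAt (c k) (d k t) t) (x : ℝ) {t : ℝ} (ht : t ∈ I) :
    HasDerivAt (fun s => ser e c x s) (ser e d x t) t := by
  refine hasDerivAt_of_tendstoUniformlyOn (l := atTop) (s := I)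
    (f := fun N s => ∑ k ∈ Finset.range N, c k s * e k x)
    (f' := fun N s => ∑ k ∈ Finset.range N, d k s * e k x)
    (g := fun s => ser e c x s) (g' := fun s => ser e d x s) hI ?_ ?_ ?_ ht
  · have := (hd.tendstoUniformlyOn he).comp (fun s : ℝ => (x, s))
    exact this.mono fun s hs => by simpa using hs
  · refine Eventually.of_forall fun n s hs => ?_
    exact HasDerivAt.fun_sum fun k _ => (hderiv k s hs).mul_const _
  · intro s hs
    have hs : Summable fun k => c k s * e k x := by
      refine Summable.of_norm_bounded (hc s hs) fun k => ?_
      rw [Real.norm_eq_abs, abs_mul]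
      exact mul_le_of_le_one_right (abs_nonneg _) (he _ _)
    exact hs.hasSum.tendsto_sum_nat

end US

lemma summable_mul_sys {e : ℕ → ℝ → ℝ} (he : ∀ k x, |e k x| ≤ 1) {c : ℕ → ℝ}
    (hc : Summable fun k => |c k|) (x : ℝ) : Summable fun k => c k * e k x := by
  refine Summable.of_norm_bounded hc fun k => ?_
  rw [Real.norm_eq_abs, abs_mul]
  exact mul_le_of_le_one_right (abs_nonneg _) (he _ _)

lemma abs_tsum_sys_le {e : ℕ → ℝ → ℝ} (he : ∀ k x, |e k x| ≤ 1) {c : ℕ → ℝ}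
    (hc : Summable fun k => |c k|) (x : ℝ) : |∑' k, c k * e k x| ≤ ∑' k, |c k| := by
  rw [← Real.norm_eq_abs]
  refine tsum_of_norm_bounded hc.hasSum fun k => ?_
  rw [Real.norm_eq_abs, abs_mul]
  exact mul_le_of_le_one_right (abs_nonneg _) (he _ _)

lemma summable_of_lam_mul {L : ℝ} (hL : 0 < L) {c : ℕ → ℝ}
    (h : Summable fun k => |lam L k * c k|) : Summable fun k => |c k| := by
  rw [← summable_nat_add_iff 1] at h ⊢
  refine Summable.of_nonneg_of_le (fun _ => abs_nonneg _) (fun k => ?_) (h.mul_left (lam L 1)⁻¹)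
  have h1 := lam_pos hL (le_refl 1)
  have h2 := lam_one_le hL (Nat.le_add_left 1 k)
  rw [abs_mul, abs_of_nonneg (h1.le.trans h2), ← mul_assoc]
  refine le_mul_of_one_le_left (abs_nonneg _) ?_
  rw [inv_mul_eq_div, le_div_iff₀ h1, one_mul]; exact h2

lemma hasDerivAt_tsum_bs {L : ℝ} (hL : 0 < L) {c : ℕ → ℝ}
    (h : Summable fun k => |lam L k * c k|) (x : ℝ) :
    HasDerivAt (fun y => ∑' k, c k * bs L k y) (∑' k, lam L k * c k * bc L k x) x := by
  refine (hasDerivAt_tsum h (g' := fun k y => lam L k * c k * bc L k y) (fun k y => ?_)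
    (fun k y => ?_) (y₀ := 0) (summable_mul_sys (abs_bs_le L) (summable_of_lam_mul hL h) 0) x)
  · refine ((hasDerivAt_bs L k y).const_mul (c k)).congr_deriv (by ring)
  · rw [Real.norm_eq_abs, abs_mul]
    exact mul_le_of_le_one_right (abs_nonneg _) (abs_bc_le _ _ _)

lemma hasDerivAt_tsum_bc {L : ℝ} (hL : 0 < L) {c : ℕ → ℝ}
    (h : Summable fun k => |lam L k * c k|) (x : ℝ) :
    HasDerivAt (fun y => ∑' k, c k * bc L k y) (∑' k, -(lam L k * c k) * bs L k x) x := by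
  refine (hasDerivAt_tsum h (g' := fun k y => -(lam L k * c k) * bs L k y) (fun k y => ?_)
    (fun k y => ?_) (y₀ := 0) (summable_mul_sys (abs_bc_le L) (summable_of_lam_mul hL h) 0) x)
  · refine ((hasDerivAt_bc L k y).const_mul (c k)).congr_deriv (by ring)
  · rw [Real.norm_eq_abs, abs_mul, abs_neg]
    exact mul_le_of_le_one_right (abs_nonneg _) (abs_bs_le _ _ _)

/-- Normalisation of the Fourier coefficients on `[-L, L]`. -/
def wt (L : ℝ) (k : ℕ) : ℝ := if k = 0 then 1 / (2 * L) else 1 / L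

/-- Cosine coefficients on `[-L, L]`. -/
def cc (L : ℝ) (g : ℝ → ℝ) (k : ℕ) : ℝ := wt L k * ∫ x in (-L)..L, g x * bc L k x

/-- Sine coefficients on `[-L, L]`. -/
def sc (L : ℝ) (g : ℝ → ℝ) (k : ℕ) : ℝ := wt L k * ∫ x in (-L)..L, g x * bs L k x

lemma wt_pos {L : ℝ} (hL : 0 < L) (k : ℕ) : 0 < wt L k := by
  unfold wt; split_ifs <;> positivity

lemma wt_le {L : ℝ} (hL : 0 < L) (k : ℕ) : wt L k ≤ 1 / L := by
  unfold wt
  split_ifs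
  · gcongr; linarith
  · exact le_rfl

lemma abs_coef_le {L : ℝ} (hL : 0 < L) {e : ℝ → ℝ} (he : ∀ x, |e x| ≤ 1) {g : ℝ → ℝ} {B : ℝ}
    (hg : ∀ x ∈ Icc (-L) L, |g x| ≤ B) (k : ℕ) : |wt L k * ∫ x in (-L)..L, g x * e x| ≤ 2 * B := by
  have hB : 0 ≤ B := (abs_nonneg _).trans (hg 0 ⟨by linarith, hL.le⟩)
  have h1 : ‖∫ x in (-L)..L, g x * e x‖ ≤ B * |L - -L| := by
    refine intervalIntegral.norm_integral_le_of_norm_le_const fun x hx => ?_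
    rw [uIoc_of_le (by linarith)] at hx
    rw [Real.norm_eq_abs, abs_mul]
    have := hg x ⟨hx.1.le, hx.2⟩
    have h2 := he x
    nlinarith [abs_nonneg (g x), abs_nonneg (e x)]
  rw [Real.norm_eq_abs, abs_of_pos (by linarith : (0 : ℝ) < L - -L)] at h1
  rw [abs_mul, abs_of_pos (wt_pos hL k)]
  calc wt L k * |∫ x in (-L)..L, g x * e x| ≤ (1 / L) * (B * (L - -L)) := by
        gcongr; exact wt_le hL k
    _ = 2 * B := by field_simp; ring

lemma abs_cc_le {L : ℝ} (hL : 0 < L) {g : ℝ → ℝ} {B : ℝ}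
    (hg : ∀ x ∈ Icc (-L) L, |g x| ≤ B) (k : ℕ) : |cc L g k| ≤ 2 * B :=
  abs_coef_le hL (abs_bc_le L k) hg k

lemma abs_sc_le {L : ℝ} (hL : 0 < L) {g : ℝ → ℝ} {B : ℝ}
    (hg : ∀ x ∈ Icc (-L) L, |g x| ≤ B) (k : ℕ) : |sc L g k| ≤ 2 * B :=
  abs_coef_le hL (abs_bs_le L k) hg k

lemma cc_sub (L : ℝ) {g h : ℝ → ℝ} (hg : Continuous g) (hh : Continuous h) (k : ℕ) :
    cc L (fun x => g x - h x) k = cc L g k - cc L h k := by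
  unfold cc
  simp only [sub_mul]
  have := continuous_bc L k
  rw [intervalIntegral.integral_sub, mul_sub]
  · exact (by fun_prop : Continuous fun x => g x * bc L k x).intervalIntegrable _ _
  · exact (by fun_prop : Continuous fun x => h x * bc L k x).intervalIntegrable _ _

lemma lam_mul_sc {L : ℝ} {g g' : ℝ → ℝ} (hg : ∀ x, HasDerivAt g (g' x) x)
    (hg' : Continuous g') (hper : g (-L) = g L) (k : ℕ) : lam L k * sc L g k = cc L g' k := by
  have hc : Continuous g := continuous_iff_continuousAt.2 fun x => (hg x).continuousAt
  have hbc := continuous_bc L k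
  have hbs := continuous_bs L k
  have := intervalIntegral.integral_mul_deriv_eq_deriv_mul (a := -L) (b := L) (u := g)
    (v := bc L k) (u' := g') (v' := fun x => -(lam L k * bs L k x)) (fun x _ => hg x)
    (fun x _ => hasDerivAt_bc L k x) (hg'.intervalIntegrable _ _)
    ((by fun_prop : Continuous fun x => -(lam L k * bs L k x)).intervalIntegrable _ _)
  rw [hper, bc_neg, sub_self, zero_sub] at this
  have h2 : ∫ x in (-L)..L, g x * -(lam L k * bs L k x)
      = -(lam L k) * ∫ x in (-L)..L, g x * bs L k x := by
    rw [← intervalIntegral.integral_const_mul]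
    congr 1; ext x; ring
  rw [h2] at this
  unfold sc cc
  linear_combination (-wt L k) * this

lemma lam_mul_cc {L : ℝ} (hL : 0 < L) {g g' : ℝ → ℝ} (hg : ∀ x, HasDerivAt g (g' x) x)
    (hg' : Continuous g') (k : ℕ) : lam L k * cc L g k = -sc L g' k := by
  have hc : Continuous g := continuous_iff_continuousAt.2 fun x => (hg x).continuousAt
  have hbc := continuous_bc L k
  have hbs := continuous_bs L k
  have := intervalIntegral.integral_mul_deriv_eq_deriv_mul (a := -L) (b := L) (u := g)
    (v := bs L k) (u' := g') (v' := fun x => (lam L k * bc L k x)) (fun x _ => hg x)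
    (fun x _ => hasDerivAt_bs L k x) (hg'.intervalIntegrable _ _)
    ((by fun_prop : Continuous fun x => (lam L k * bc L k x)).intervalIntegrable _ _)
  rw [bs_neg, bs_L hL, neg_zero, mul_zero, mul_zero, sub_zero, zero_sub] at this
  have h2 : ∫ x in (-L)..L, g x * (lam L k * bc L k x)
      = (lam L k) * ∫ x in (-L)..L, g x * bc L k x := by
    rw [← intervalIntegral.integral_const_mul]
    congr 1; ext x; ring
  rw [h2] at this
  unfold sc cc
  linear_combination (wt L k) * this

lemma integral_symm_of_odd {L : ℝ} {h : ℝ → ℝ} (hh : ∀ x, h (-x) = -h x) :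
    ∫ x in (-L)..L, h x = 0 := by
  have h1 : ∫ x in (-L)..L, h (-x) = ∫ x in (-L)..L, h x := by
    rw [intervalIntegral.integral_comp_neg]; simp
  simp only [hh, intervalIntegral.integral_neg] at h1
  linarith

lemma sc_of_even (L : ℝ) {g : ℝ → ℝ} (hg : ∀ x, g (-x) = g x) (k : ℕ) : sc L g k = 0 := by
  unfold sc
  rw [integral_symm_of_odd (fun x => by rw [hg, bs_neg]; ring), mul_zero]

lemma cc_of_odd (L : ℝ) {g : ℝ → ℝ} (hg : ∀ x, g (-x) = -g x) (k : ℕ) : cc L g k = 0 := by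
  unfold cc
  rw [integral_symm_of_odd (fun x => by rw [hg, bc_neg]; ring), mul_zero]

lemma fourierCoeffOn_ofReal {L : ℝ} (hL : 0 < L) {g : ℝ → ℝ} (hg : Continuous g) (n : ℤ) (r : ℝ)
    (hr : r = n * (Real.pi / L)) :
    fourierCoeffOn (show -L < L by linarith) (fun x => (g x : ℂ)) n
      = ((1 / (2 * L) : ℝ) : ℂ) * (((∫ x in (-L)..L, g x * Real.cos (r * x) : ℝ) : ℂ)
        - Complex.I * ((∫ x in (-L)..L, g x * Real.sin (r * x) : ℝ) : ℂ)) := by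
  rw [fourierCoeffOn_eq_integral, ← intervalIntegral.integral_ofReal,
    ← intervalIntegral.integral_ofReal, ← intervalIntegral.integral_const_mul,
    ← intervalIntegral.integral_sub]
  · rw [show L - -L = 2 * L by ring, Complex.real_smul]
    congr 1
    congr 1
    ext x
    rw [fourier_coe_apply]
    have h1 : (2 * Real.pi * Complex.I * ((-n : ℤ) : ℂ) * (x : ℂ) / ((2 * L : ℝ) : ℂ))
        = ((-(r * x) : ℝ) : ℂ) * Complex.I := by
      have : (L : ℂ) ≠ 0 := by exact_mod_cast hL.ne'
      rw [hr]; push_cast; field_simp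
    rw [h1, Complex.exp_mul_I, ← Complex.ofReal_cos, ← Complex.ofReal_sin, Real.cos_neg,
      Real.sin_neg, smul_eq_mul]
    push_cast
    ring
  · exact (by fun_prop : Continuous fun x => ((g x * Real.cos (r * x) : ℝ) : ℂ)).intervalIntegrable
      _ _
  · exact (by fun_prop : Continuous fun x =>
      Complex.I * ((g x * Real.sin (r * x) : ℝ) : ℂ)).intervalIntegrable _ _

lemma fourierCoeffOn_nat {L : ℝ} (hL : 0 < L) {g : ℝ → ℝ} (hg : Continuous g) (k : ℕ) :
    fourierCoeffOn (show -L < L by linarith) (fun x => (g x : ℂ)) k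
      = (((1 / (2 * L)) * ∫ x in (-L)..L, g x * bc L k x : ℝ) : ℂ)
        - Complex.I * (((1 / (2 * L)) * ∫ x in (-L)..L, g x * bs L k x : ℝ) : ℂ) := by
  rw [fourierCoeffOn_ofReal hL hg k (lam L k) (by simp [lam])]
  simp only [bc, bs]
  push_cast
  ring

lemma fourierCoeffOn_neg_nat {L : ℝ} (hL : 0 < L) {g : ℝ → ℝ} (hg : Continuous g) (k : ℕ) :
    fourierCoeffOn (show -L < L by linarith) (fun x => (g x : ℂ)) (-(k : ℤ))
      = (((1 / (2 * L)) * ∫ x in (-L)..L, g x * bc L k x : ℝ) : ℂ)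
        + Complex.I * (((1 / (2 * L)) * ∫ x in (-L)..L, g x * bs L k x : ℝ) : ℂ) := by
  rw [fourierCoeffOn_ofReal hL hg (-(k : ℤ)) (-lam L k) (by simp [lam])]
  simp only [bc, bs, neg_mul, Real.cos_neg, Real.sin_neg, mul_neg, intervalIntegral.integral_neg]
  push_cast
  ring

/-- Bessel's inequality for bounded functions. -/
lemma bessel {L : ℝ} (hL : 0 < L) {g : ℝ → ℝ} (hg : Continuous g) {B : ℝ}
    (hB : ∀ x ∈ Icc (-L) L, |g x| ≤ B) (N : ℕ) :
    ∑ k ∈ Finset.range N, (cc L g k ^ 2 + sc L g k ^ 2) ≤ 4 * B ^ 2 := by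
  have hab : -L < L := by linarith
  have hgc : Continuous fun x => (g x : ℂ) := by fun_prop
  have hmem : MemLp (fun x => (g x : ℂ)) 2 (volume.restrict (Ioc (-L) L)) := by
    refine MemLp.of_bound hgc.aestronglyMeasurable B ?_
    filter_upwards [ae_restrict_mem measurableSet_Ioc] with x hx
    simpa using hB x ⟨hx.1.le, hx.2⟩
  have hs := hasSum_sq_fourierCoeffOn hab hmem
  have hint : (L - -L)⁻¹ • ∫ x in (-L)..L, ‖(g x : ℂ)‖ ^ 2 ≤ B ^ 2 := by
    have h1 : ‖∫ x in (-L)..L, ‖(g x : ℂ)‖ ^ 2‖ ≤ B ^ 2 * |L - -L| := by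
      refine intervalIntegral.norm_integral_le_of_norm_le_const fun x hx => ?_
      rw [uIoc_of_le hab.le] at hx
      have := hB x ⟨hx.1.le, hx.2⟩
      rw [Complex.norm_real, Real.norm_eq_abs, Real.norm_eq_abs, abs_of_nonneg (by positivity)]
      gcongr
    rw [abs_of_pos (by linarith : (0 : ℝ) < L - -L)] at h1
    rw [smul_eq_mul, inv_mul_le_iff₀ (by linarith)]
    calc _ ≤ _ := Real.le_norm_self _
      _ ≤ _ := h1
      _ = _ := by ring
  have hle :
      ∑ k ∈ Finset.range N, ‖fourierCoeffOn hab (fun x => (g x : ℂ)) (k : ℤ)‖ ^ 2 ≤ B ^ 2 := by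
    refine le_trans ?_ hint
    have hinj : Injective (fun k : ℕ => (k : ℤ)) := Nat.cast_injective
    have := (sum_le_hasSum ((Finset.range N).map ⟨_, hinj⟩) (fun i _ => by positivity) hs)
    simpa using this
  refine le_trans ?_ (mul_le_mul_of_nonneg_left hle (by norm_num : (0 : ℝ) ≤ 4))
  rw [Finset.mul_sum]
  refine Finset.sum_le_sum fun k _ => ?_
  rw [fourierCoeffOn_nat hL hg, ← Complex.normSq_eq_norm_sq, Complex.normSq_apply]
  simp only [Complex.sub_re, Complex.ofReal_re, Complex.mul_re, Complex.I_re, zero_mul,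
    Complex.I_im, Complex.ofReal_im, mul_zero, sub_zero, Complex.sub_im, Complex.mul_im,
    one_mul, zero_sub, zero_add]
  have hw : wt L k ≤ 2 * (1 / (2 * L)) := (wt_le hL k).trans (by
    apply le_of_eq; field_simp)
  have hw2 : wt L k ^ 2 ≤ 4 * (1 / (2 * L)) ^ 2 := by
    have := wt_pos hL k
    calc wt L k ^ 2 ≤ (2 * (1 / (2 * L))) ^ 2 := by gcongr
      _ = _ := by ring
  unfold cc sc
  set a := ∫ x in (-L)..L, g x * bc L k x
  set b := ∫ x in (-L)..L, g x * bs L k x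
  nlinarith [mul_le_mul_of_nonneg_right hw2 (sq_nonneg a),
    mul_le_mul_of_nonneg_right hw2 (sq_nonneg b)]

/-- Pointwise convergence of absolutely convergent Fourier series. -/
lemma fourier_expansion {L : ℝ} (hL : 0 < L) {g : ℝ → ℝ} (hg : Continuous g)
    (hper : g (-L) = g L) (hc : Summable fun k => |cc L g k|) (hs : Summable fun k => |sc L g k|)
    {x : ℝ} (hx : x ∈ Icc (-L) L) :
    g x = ∑' k, cc L g k * bc L k x + ∑' k, sc L g k * bs L k x := by
  have hab : -L < L := by linarith
  have h2L : L = -L + 2 * L := by ring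
  have : Fact (0 < 2 * L) := ⟨by linarith⟩
  wlog hxL : x < L generalizing x
  · have hxL' : x = L := le_antisymm hx.2 (not_lt.1 hxL)
    have := this (x := -L) ⟨le_rfl, by linarith⟩ (by linarith)
    simp only [bc_neg, bs_neg, bs_L hL, neg_zero, mul_zero, tsum_zero] at this
    rw [hxL', ← hper]
    simpa only [bs_L hL, mul_zero, tsum_zero] using this
  set gC : ℝ → ℂ := fun x => (g x : ℂ) with hgC
  have hgcont : Continuous gC := by fun_prop
  have hcont : Continuous (AddCircle.liftIco (2 * L) (-L) gC) := by
    refine AddCircle.liftIco_continuous ?_ hgcont.continuousOn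
    rw [← h2L]; simp [hgC, hper]
  set F : C(AddCircle (2 * L), ℂ) := ⟨_, hcont⟩
  have hFc : ∀ n, fourierCoeff F n = fourierCoeffOn hab gC n := by
    intro n
    refine (fourierCoeff_liftIco_eq gC n).trans ?_
    congr 1
    exact h2L.symm
  have hcw : ∀ k, |(1 / (2 * L)) * ∫ x in (-L)..L, g x * bc L k x| ≤ |cc L g k| := by
    intro k
    rw [cc, abs_mul, abs_mul, abs_of_pos (wt_pos hL k), abs_of_pos (by positivity)]
    gcongr
    unfold wt; split_ifs
    · exact le_rfl
    · gcongr; linarith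
  have hsw : ∀ k, |(1 / (2 * L)) * ∫ x in (-L)..L, g x * bs L k x| ≤ |sc L g k| := by
    intro k
    rw [sc, abs_mul, abs_mul, abs_of_pos (wt_pos hL k), abs_of_pos (by positivity)]
    gcongr
    unfold wt; split_ifs
    · exact le_rfl
    · gcongr; linarith
  have hsum : Summable (fourierCoeff F) := by
    have e : fourierCoeff F = fun n => fourierCoeffOn hab gC n := funext hFc
    rw [e]
    refine Summable.of_nat_of_neg ?_ ?_
    · refine Summable.of_norm_bounded (hc.add hs) fun k => ?_
      rw [fourierCoeffOn_nat hL hg]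
      refine (norm_sub_le _ _).trans (add_le_add ?_ ?_)
      · rw [Complex.norm_real]; exact hcw k
      · rw [norm_mul, Complex.norm_I, one_mul, Complex.norm_real]; exact hsw k
    · refine Summable.of_norm_bounded (hc.add hs) fun k => ?_
      rw [fourierCoeffOn_neg_nat hL hg]
      refine (norm_add_le _ _).trans (add_le_add ?_ ?_)
      · rw [Complex.norm_real]; exact hcw k
      · rw [norm_mul, Complex.norm_I, one_mul, Complex.norm_real]; exact hsw k
  have hmain := (has_pointwise_sum_fourier_series_of_summable hsum (x : AddCircle (2 * L)))
  have hFx : F (x : AddCircle (2 * L)) = gC x := by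
    change AddCircle.liftIco (2 * L) (-L) gC (x : AddCircle (2 * L)) = gC x
    exact AddCircle.liftIco_coe_apply ⟨hx.1, by rw [← h2L]; exact hxL⟩
  rw [hFx] at hmain
  have h3 := hmain.nat_add_neg
  have hterm : ∀ k : ℕ, fourierCoeff F (k : ℤ) • fourier (k : ℤ) (x : AddCircle (2 * L))
      + fourierCoeff F (-(k : ℤ)) • fourier (-(k : ℤ)) (x : AddCircle (2 * L))
      = (((1 / L) * ((∫ x in (-L)..L, g x * bc L k x) * bc L k x
          + (∫ x in (-L)..L, g x * bs L k x) * bs L k x) : ℝ) : ℂ) := by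
    intro k
    have hL' : (L : ℂ) ≠ 0 := by exact_mod_cast hL.ne'
    have e1 : (2 * Real.pi * Complex.I * ((k : ℤ) : ℂ) * (x : ℂ) / ((2 * L : ℝ) : ℂ))
        = ((lam L k * x : ℝ) : ℂ) * Complex.I := by
      unfold lam; push_cast; field_simp
    have e2 : (2 * Real.pi * Complex.I * ((-(k : ℤ) : ℤ) : ℂ) * (x : ℂ) / ((2 * L : ℝ) : ℂ))
        = ((-(lam L k * x) : ℝ) : ℂ) * Complex.I := by
      unfold lam; push_cast; field_simp
    rw [hFc, hFc, fourierCoeffOn_nat hL hg, fourierCoeffOn_neg_nat hL hg, fourier_coe_apply,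
      fourier_coe_apply, e1, e2, Complex.exp_mul_I, Complex.exp_mul_I, ← Complex.ofReal_cos,
      ← Complex.ofReal_sin, ← Complex.ofReal_cos, ← Complex.ofReal_sin, Real.cos_neg,
      Real.sin_neg, smul_eq_mul, smul_eq_mul]
    rw [show Real.cos (lam L k * x) = bc L k x from rfl,
      show Real.sin (lam L k * x) = bs L k x from rfl]
    push_cast
    field_simp
    ring_nf
    rw [Complex.I_sq]
    ring
  simp only [hterm] at h3
  have h0 : fourierCoeff F 0 • fourier 0 (x : AddCircle (2 * L))
      = (((1 / (2 * L)) * ∫ x in (-L)..L, g x * bc L 0 x : ℝ) : ℂ) := by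
    have := fourierCoeffOn_nat hL hg 0
    rw [hFc, fourier_zero, smul_eq_mul, mul_one]
    refine this.trans ?_
    simp [bs, lam_zero]
  rw [h0, hgC, ← Complex.ofReal_add] at h3
  have h4 := Complex.hasSum_ofReal.1 h3
  have h5 : HasSum
      (fun k : ℕ => if k = 0 then (1 / (2 * L)) * ∫ x in (-L)..L, g x * bc L 0 x else 0)
      ((1 / (2 * L)) * ∫ x in (-L)..L, g x * bc L 0 x) := hasSum_ite_eq 0 _
  have h6 := h4.sub h5
  rw [add_sub_cancel_right] at h6
  rw [← h6.tsum_eq, ← (summable_mul_sys (abs_bc_le L) hc x).tsum_add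
    (summable_mul_sys (abs_bs_le L) hs x)]
  refine tsum_congr fun k => ?_
  unfold cc sc wt
  split_ifs with hk
  · subst hk
    simp [bc, bs, lam_zero]
    field_simp
    ring
  · ring

/-- Termwise integration against a continuous function. -/
lemma integral_mul_tsum {L : ℝ} {e : ℕ → ℝ → ℝ} (he : Sys e) {c : ℕ → ℝ}
    (hc : Summable fun k => |c k|) {g : ℝ → ℝ} (hg : Continuous g) {B : ℝ} (hL : 0 < L)
    (hB : ∀ x ∈ Icc (-L) L, |g x| ≤ B) :
    HasSum (fun k => c k * ∫ x in (-L)..L, g x * e k x)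
      (∫ x in (-L)..L, g x * ∑' k, c k * e k x) := by
  have hB0 : 0 ≤ B := (abs_nonneg _).trans (hB 0 ⟨by linarith, hL.le⟩)
  have := intervalIntegral.hasSum_integral_of_dominated_convergence (a := -L) (b := L)
    (μ := volume) (F := fun k x => c k * (g x * e k x))
    (f := fun x => g x * ∑' k, c k * e k x) (fun k _ => B * |c k|)
    (fun k => ?_) (fun k => ?_) ?_ ?_ ?_
  · simpa only [intervalIntegral.integral_const_mul] using this
  · have := he.cont k
    exact (by fun_prop : Continuous fun x => c k * (g x * e k x)).aestronglyMeasurable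
  · refine Eventually.of_forall fun x hx => ?_
    rw [uIoc_of_le (by linarith)] at hx
    rw [Real.norm_eq_abs, abs_mul, abs_mul, mul_comm B]
    have h1 := hB x ⟨hx.1.le, hx.2⟩
    have h2 := he.bdd k x
    gcongr
    nlinarith [abs_nonneg (g x), abs_nonneg (e k x)]
  · exact Eventually.of_forall fun x _ => hc.mul_left B
  · simp
  · refine Eventually.of_forall fun x _ => ?_
    have := ((summable_mul_sys he.bdd hc x).hasSum).mul_left (g x)
    refine this.congr_fun ?_ |> fun h => h
    intro k; ring

/-- Existence for linear equations with continuous forcing. -/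
lemma exists_linear_ode {E : Type*} [NormedAddCommGroup E] [NormedSpace ℝ E] [CompleteSpace E]
    (A : E →L[ℝ] E) (x0 : E) {Φ : ℝ → E} (hΦ : Continuous Φ) :
    ∃ x : ℝ → E, x 0 = x0 ∧ ∀ t, HasDerivAt x (A (x t) + Φ t) t := by
  let : NormedAlgebra ℚ (E →L[ℝ] E) := NormedAlgebra.restrictScalars ℚ ℝ (E →L[ℝ] E)
  set P : ℝ → (E →L[ℝ] E) := fun t => NormedSpace.exp (t • A) with hP
  have hPd : ∀ t, HasDerivAt P (A * P t) t := fun t => hasDerivAt_exp_smul_const' A t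
  have hPc : Continuous P := continuous_iff_continuousAt.2 fun t => (hPd t).continuousAt
  have hinv : ∀ t, P t * P (-t) = 1 := by
    intro t
    simp only [hP]
    rw [← NormedSpace.exp_add_of_commute, neg_smul, add_neg_cancel, NormedSpace.exp_zero]
    rw [neg_smul]
    exact (Commute.refl _).neg_right
  set w : ℝ → E := fun t => x0 + ∫ s in (0 : ℝ)..t, P (-s) (Φ s) with hw
  have hcont : Continuous fun s => P (-s) (Φ s) := (hPc.comp continuous_neg).clm_apply hΦ
  have hwd : ∀ t, HasDerivAt w (P (-t) (Φ t)) t := fun t =>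
    (intervalIntegral.integral_hasDerivAt_right (hcont.intervalIntegrable _ _)
      hcont.aestronglyMeasurable.stronglyMeasurableAtFilter hcont.continuousAt).const_add x0
  refine ⟨fun t => P t (w t), ?_, fun t => ?_⟩
  · simp [hP, hw]
  · refine ((hPd t).clm_apply (hwd t)).congr_deriv ?_
    have := congrArg (fun B : E →L[ℝ] E => B (Φ t)) (hinv t)
    simp only [mul_apply_eq_comp, one_apply_eq_self] at this ⊢
    rw [this]

lemma hasDerivAt_exp_mul_const (a t : ℝ) :
    HasDerivAt (fun s : ℝ => Real.exp (a * s)) (a * Real.exp (a * t)) t := by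
  have := ((hasDerivAt_id t).const_mul a).exp
  refine this.congr_deriv ?_
  simp; ring

section Scalar

variable {α γ C T : ℝ} {y φ : ℝ → ℝ}

lemma hasDerivAt_integrating (hy : ∀ t, HasDerivAt y (-α * y t + φ t) t) (t : ℝ) :
    HasDerivAt (fun s => Real.exp (α * s) * y s) (Real.exp (α * t) * φ t) t := by
  refine ((hasDerivAt_exp_mul_const α t).mul (hy t)).congr_deriv ?_
  ring

/-- Duhamel's formula. -/
lemma duhamel (hy : ∀ t, HasDerivAt y (-α * y t + φ t) t) (hφ : Continuous φ) (t : ℝ) :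
    y t = Real.exp (-(α * t)) * y 0 + ∫ s in (0 : ℝ)..t, Real.exp (-(α * (t - s))) * φ s := by
  have h := intervalIntegral.integral_eq_sub_of_hasDerivAt (a := 0) (b := t)
    (fun s _ => hasDerivAt_integrating hy s)
    ((by fun_prop : Continuous fun s => Real.exp (α * s) * φ s).intervalIntegrable _ _)
  simp only [mul_zero, Real.exp_zero, one_mul] at h
  have h2 : ∫ s in (0 : ℝ)..t, Real.exp (-(α * (t - s))) * φ s
      = Real.exp (-(α * t)) * ∫ s in (0 : ℝ)..t, Real.exp (α * s) * φ s := by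
    rw [← intervalIntegral.integral_const_mul]
    congr 1; ext s
    rw [← mul_assoc, ← Real.exp_add]
    congr 2; ring
  rw [h2, h, mul_sub, ← mul_assoc, ← Real.exp_add]
  simp

lemma scalar_sub_le (hy : ∀ t, HasDerivAt y (-α * y t + φ t) t) (hαγ : 0 < α + γ) (hC : 0 ≤ C)
    (hφ : ∀ t ∈ Icc 0 T, |φ t| ≤ C * Real.exp (γ * t)) {t : ℝ} (ht : t ∈ Icc 0 T) :
    |y t - Real.exp (-(α * t)) * y 0| ≤ C / (α + γ) * Real.exp (γ * t) := by
  have hB : ∀ x, HasDerivAt (fun s => C / (α + γ) * (Real.exp ((α + γ) * s) - 1))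
      (C * Real.exp ((α + γ) * x)) x := by
    intro x
    refine (((hasDerivAt_exp_mul_const (α + γ) x).sub_const 1).const_mul _).congr_deriv ?_
    field_simp
  have h := image_norm_le_of_norm_deriv_right_le_deriv_boundary (a := 0) (b := T)
    (f := fun s => Real.exp (α * s) * y s - y 0) (f' := fun s => Real.exp (α * s) * φ s)
    (fun s _ => ((hasDerivAt_integrating hy s).sub_const _).continuousAt.continuousWithinAt)
    (fun s _ => ((hasDerivAt_integrating hy s).sub_const _).hasDerivWithinAt)
    (by simp) hB (fun s hs => by
      rw [norm_mul, Real.norm_eq_abs, Real.norm_eq_abs, Real.abs_exp, add_mul, Real.exp_add]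
      have := hφ s ⟨hs.1, hs.2.le⟩
      nlinarith [Real.exp_pos (α * s)]) ht
  rw [Real.norm_eq_abs] at h
  have h2 : y t - Real.exp (-(α * t)) * y 0
      = Real.exp (-(α * t)) * (Real.exp (α * t) * y t - y 0) := by
    rw [mul_sub, ← mul_assoc, ← Real.exp_add]; simp
  rw [h2, abs_mul, Real.abs_exp]
  calc Real.exp (-(α * t)) * |Real.exp (α * t) * y t - y 0|
      ≤ Real.exp (-(α * t)) * (C / (α + γ) * (Real.exp ((α + γ) * t) - 1)) := by gcongr
    _ ≤ Real.exp (-(α * t)) * (C / (α + γ) * (Real.exp ((α + γ) * t))) := by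
        gcongr; linarith
    _ = C / (α + γ) * (Real.exp (-(α * t)) * Real.exp ((α + γ) * t)) := by ring
    _ = _ := by rw [← Real.exp_add]; congr 2; ring

lemma scalar_le (hy : ∀ t, HasDerivAt y (-α * y t + φ t) t) (hα : 0 < α) (hγ : 0 ≤ γ) (hC : 0 ≤ C)
    (hφ : ∀ t ∈ Icc 0 T, |φ t| ≤ C * Real.exp (γ * t)) {t : ℝ} (ht : t ∈ Icc 0 T) :
    |y t| ≤ (|y 0| + C / (α + γ)) * Real.exp (γ * t) := by
  have h := scalar_sub_le hy (by linarith) hC hφ ht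
  have h1 : |Real.exp (-(α * t)) * y 0| ≤ |y 0| * Real.exp (γ * t) := by
    rw [abs_mul, Real.abs_exp, mul_comm]
    gcongr
    have := ht.1
    nlinarith [mul_nonneg hα.le this, mul_nonneg hγ this]
  have h2 := abs_sub_abs_le_abs_sub (y t) (Real.exp (-(α * t)) * y 0)
  linarith

lemma scalar_le_const (hy : ∀ t, HasDerivAt y (-α * y t + φ t) t) (hα : 0 < α) (hC : 0 ≤ C)
    (hφ : ∀ t ∈ Icc 0 T, |φ t| ≤ C) {t : ℝ} (ht : t ∈ Icc 0 T) :
    |y t| ≤ |y 0| + C / α := by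
  simpa using scalar_le hy hα (le_refl (0 : ℝ)) hC (by simpa using hφ) ht

end Scalar

/-- Estimate for the damped two-by-two system of one sine mode. -/
lemma pair_le {a b l m γ C T : ℝ} {v u φ : ℝ → ℝ}
    (hv : ∀ t, HasDerivAt v (-a * v t + (φ t - l ^ 2 * u t)) t)
    (hu : ∀ t, HasDerivAt u (-b * u t + v t) t)
    (hm : 0 < m) (hma : m ≤ a) (hmb : m ≤ b) (hl : 0 ≤ l) (hγ : 0 ≤ γ) (hC : 0 ≤ C)
    (hφ : ∀ t ∈ Icc 0 T, |φ t| ≤ C * Real.exp (γ * t)) {t : ℝ} (ht : t ∈ Icc 0 T) :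
    |v t| ≤ (|v 0| + l * |u 0| + C / m) * Real.exp (γ * t) ∧
      l * |u t| ≤ (|v 0| + l * |u 0| + C / m) * Real.exp (γ * t) := by
  set N0 := |v 0| + l * |u 0| with hN0
  have hN0' : 0 ≤ N0 := by positivity
  set Z : ℝ → ℝ := fun s => v s ^ 2 + l ^ 2 * u s ^ 2 with hZ
  have hZd : ∀ s, HasDerivAt Z (2 * v s * (-a * v s + (φ s - l ^ 2 * u s))
      + l ^ 2 * (2 * u s * (-b * u s + v s))) s := by
    intro s
    refine (((hv s).pow 2).add (((hu s).pow 2).const_mul (l ^ 2))).congr_deriv ?_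
    simp
  have hEd : ∀ s, HasDerivAt (fun s => Real.exp (m * s) * Z s)
      (m * Real.exp (m * s) * Z s + Real.exp (m * s) * (2 * v s * (-a * v s + (φ s - l ^ 2 * u s))
      + l ^ 2 * (2 * u s * (-b * u s + v s)))) s := fun s =>
    (hasDerivAt_exp_mul_const m s).mul (hZd s)
  have hBd : ∀ s, HasDerivAt (fun s => N0 ^ 2 + C ^ 2 / (m * (m + 2 * γ)) *
      Real.exp ((m + 2 * γ) * s)) (C ^ 2 / m * Real.exp ((m + 2 * γ) * s)) s := by
    intro s
    refine (((hasDerivAt_exp_mul_const (m + 2 * γ) s).const_mul _).const_add _).congr_deriv ?_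
    have : 0 < m + 2 * γ := by linarith
    field_simp
  have hmain := image_le_of_deriv_right_le_deriv_boundary (a := 0) (b := T)
    (fun s _ => (hEd s).continuousAt.continuousWithinAt)
    (fun s _ => (hEd s).hasDerivWithinAt) ?_
    (fun s _ => (hBd s).continuousAt.continuousWithinAt)
    (fun s _ => (hBd s).hasDerivWithinAt) ?_ ht
  · have hZt : Z t ≤ (N0 + C / m) ^ 2 * Real.exp (γ * t) ^ 2 := by
      have e1 : Z t = Real.exp (-(m * t)) * (Real.exp (m * t) * Z t) := by
        rw [← mul_assoc, ← Real.exp_add]; simp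
      have e3 : C ^ 2 / (m * (m + 2 * γ)) ≤ (C / m) ^ 2 := by
        rw [div_pow]
        gcongr
        nlinarith
      have e4 : Real.exp (-(m * t)) ≤ Real.exp (γ * t) ^ 2 := by
        rw [← Real.exp_nat_mul]
        gcongr
        have := ht.1
        push_cast
        nlinarith [mul_nonneg hm.le this, mul_nonneg hγ this]
      have e5 : Real.exp (-(m * t)) * Real.exp ((m + 2 * γ) * t) = Real.exp (γ * t) ^ 2 := by
        rw [← Real.exp_nat_mul, ← Real.exp_add]
        congr 1; push_cast; ring
      have hCm : 0 ≤ C / m := by positivity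
      calc Z t = Real.exp (-(m * t)) * (Real.exp (m * t) * Z t) := e1
        _ ≤ Real.exp (-(m * t)) * (N0 ^ 2 + C ^ 2 / (m * (m + 2 * γ)) *
            Real.exp ((m + 2 * γ) * t)) := by gcongr
        _ = Real.exp (-(m * t)) * N0 ^ 2 + C ^ 2 / (m * (m + 2 * γ)) *
            (Real.exp (-(m * t)) * Real.exp ((m + 2 * γ) * t)) := by ring
        _ ≤ Real.exp (γ * t) ^ 2 * N0 ^ 2 + (C / m) ^ 2 * Real.exp (γ * t) ^ 2 := by
            rw [e5]; gcongr
        _ ≤ _ := by nlinarith [mul_nonneg (mul_nonneg hN0' hCm) (sq_nonneg (Real.exp (γ * t)))]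
    rw [← mul_pow] at hZt
    have hnn : 0 ≤ (N0 + C / m) * Real.exp (γ * t) := by positivity
    constructor
    · refine abs_le_of_sq_le_sq (le_trans ?_ hZt) hnn
      simp only [hZ]
      nlinarith [mul_nonneg (sq_nonneg l) (sq_nonneg (u t))]
    · have : |l * u t| ≤ (N0 + C / m) * Real.exp (γ * t) := by
        refine abs_le_of_sq_le_sq (le_trans ?_ hZt) hnn
        simp only [hZ]
        nlinarith [sq_nonneg (v t)]
      rwa [abs_mul, abs_of_nonneg hl] at this
  · simp only [hZ, mul_zero, Real.exp_zero, one_mul, mul_one]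
    have h1 : 0 ≤ C ^ 2 / (m * (m + 2 * γ)) := by positivity
    have h2 : v 0 ^ 2 + l ^ 2 * u 0 ^ 2 ≤ N0 ^ 2 := by
      rw [hN0, ← sq_abs (v 0), ← sq_abs (u 0)]
      nlinarith [mul_nonneg (abs_nonneg (v 0)) (mul_nonneg hl (abs_nonneg (u 0)))]
    linarith
  · intro s hs
    have h1 := hφ s ⟨hs.1, hs.2.le⟩
    have h2 : φ s ^ 2 ≤ C ^ 2 * Real.exp (γ * s) ^ 2 := by
      rw [← sq_abs, ← mul_pow]
      gcongr
    have h3 : 2 * v s * φ s ≤ m * v s ^ 2 + φ s ^ 2 / m := by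
      have : 0 ≤ (m * v s - φ s) ^ 2 / m := by positivity
      have e : (m * v s - φ s) ^ 2 / m = m * v s ^ 2 - 2 * v s * φ s + φ s ^ 2 / m := by
        field_simp; ring
      linarith
    have h4 : φ s ^ 2 / m ≤ C ^ 2 / m * Real.exp (γ * s) ^ 2 := by
      rw [div_mul_eq_mul_div]; gcongr
    have h5 : Real.exp ((m + 2 * γ) * s) = Real.exp (m * s) * Real.exp (γ * s) ^ 2 := by
      rw [← Real.exp_nat_mul, ← Real.exp_add]
      congr 1; push_cast; ring
    rw [h5]
    have h6 : m * Z s + (2 * v s * (-a * v s + (φ s - l ^ 2 * u s))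
      + l ^ 2 * (2 * u s * (-b * u s + v s))) ≤ C ^ 2 / m * Real.exp (γ * s) ^ 2 := by
      simp only [hZ]
      nlinarith [mul_nonneg (sub_nonneg.2 hma) (sq_nonneg (v s)),
        mul_nonneg (sub_nonneg.2 hmb) (mul_nonneg (sq_nonneg l) (sq_nonneg (u s))),
        mul_nonneg hm.le (mul_nonneg (sq_nonneg l) (sq_nonneg (u s))),
        mul_nonneg hm.le (sq_nonneg (v s))]
    calc _ = Real.exp (m * s) * (m * Z s + (2 * v s * (-a * v s + (φ s - l ^ 2 * u s))
      + l ^ 2 * (2 * u s * (-b * u s + v s)))) := by ring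
      _ ≤ Real.exp (m * s) * (C ^ 2 / m * Real.exp (γ * s) ^ 2) := by gcongr
      _ = _ := by ring

/-- Polynomial decay of coefficients, uniform on `[0, T]`. -/
def Dec (L : ℝ) (p : ℕ) (c : ℕ → ℝ → ℝ) (T : ℝ) : Prop :=
  ∃ C : ℝ, 0 ≤ C ∧ ∀ k, 1 ≤ k → ∀ t ∈ Icc 0 T, lam L k ^ p * |c k t| ≤ C

/-- Polynomial decay of a sequence. -/
def DecS (L : ℝ) (p : ℕ) (c : ℕ → ℝ) : Prop :=
  ∃ C : ℝ, 0 ≤ C ∧ ∀ k, 1 ≤ k → lam L k ^ p * |c k| ≤ C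

lemma DecS.dec {L : ℝ} {p : ℕ} {c : ℕ → ℝ} (h : DecS L p c) (T : ℝ) :
    Dec L p (fun k _ => c k) T := by
  obtain ⟨C, hC, h⟩ := h
  exact ⟨C, hC, fun k hk t _ => h k hk⟩

lemma Dec.decS {L : ℝ} {p : ℕ} {c : ℕ → ℝ → ℝ} {T : ℝ} (h : Dec L p c T) {t : ℝ}
    (ht : t ∈ Icc 0 T) : DecS L p (fun k => c k t) := by
  obtain ⟨C, hC, h⟩ := h
  exact ⟨C, hC, fun k hk => h k hk t ht⟩

lemma lam_pow_le {L : ℝ} (hL : 0 < L) {p q : ℕ} (hpq : p ≤ q) {k : ℕ} (hk : 1 ≤ k) :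
    lam L k ^ p ≤ (lam L 1 ^ (q - p))⁻¹ * lam L k ^ q := by
  have h1 := lam_pos hL (le_refl 1)
  have h2 := lam_one_le hL hk
  have h3 := lam_pos hL hk
  rw [inv_mul_eq_div, le_div_iff₀ (by positivity)]
  calc lam L k ^ p * lam L 1 ^ (q - p) ≤ lam L k ^ p * lam L k ^ (q - p) := by gcongr
    _ = lam L k ^ q := by rw [← pow_add]; congr 1; omega

namespace Dec

variable {L : ℝ} {p q j m : ℕ} {c d : ℕ → ℝ → ℝ} {T : ℝ}

lemma mono (h : Dec L q c T) (hL : 0 < L) (hpq : p ≤ q) : Dec L p c T := by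
  obtain ⟨C, hC, h⟩ := h
  have h1 := lam_pos hL (le_refl 1)
  refine ⟨(lam L 1 ^ (q - p))⁻¹ * C, by positivity, fun k hk t ht => ?_⟩
  have h2 := h k hk t ht
  calc lam L k ^ p * |c k t| ≤ ((lam L 1 ^ (q - p))⁻¹ * lam L k ^ q) * |c k t| := by
        gcongr; exact lam_pow_le hL hpq hk
    _ = (lam L 1 ^ (q - p))⁻¹ * (lam L k ^ q * |c k t|) := by ring
    _ ≤ _ := by gcongr

lemma add (hL : 0 < L) (hc : Dec L p c T) (hd : Dec L p d T) :
    Dec L p (fun k t => c k t + d k t) T := by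
  obtain ⟨C, hC, h⟩ := hc
  obtain ⟨D, hD, h'⟩ := hd
  refine ⟨C + D, by positivity, fun k hk t ht => ?_⟩
  have h3 := lam_pos hL hk
  calc lam L k ^ p * |c k t + d k t| ≤ lam L k ^ p * (|c k t| + |d k t|) := by
        gcongr; exact abs_add_le _ _
    _ = lam L k ^ p * |c k t| + lam L k ^ p * |d k t| := by ring
    _ ≤ C + D := add_le_add (h k hk t ht) (h' k hk t ht)

lemma const_mul (hc : Dec L p c T) (a : ℝ) : Dec L p (fun k t => a * c k t) T := by
  obtain ⟨C, hC, h⟩ := hc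
  refine ⟨|a| * C, by positivity, fun k hk t ht => ?_⟩
  rw [abs_mul, mul_left_comm]
  exact mul_le_mul_of_nonneg_left (h k hk t ht) (abs_nonneg _)

lemma congr (hc : Dec L p c T) (h : ∀ k, 1 ≤ k → ∀ t ∈ Icc 0 T, d k t = c k t) : Dec L p d T := by
  obtain ⟨C, hC, h'⟩ := hc
  exact ⟨C, hC, fun k hk t ht => by rw [h k hk t ht]; exact h' k hk t ht⟩

lemma sub (hL : 0 < L) (hc : Dec L p c T) (hd : Dec L p d T) :
    Dec L p (fun k t => c k t - d k t) T :=
  (hc.add hL (hd.const_mul (-1))).congr fun k _ t _ => by ring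

lemma lam_pow_mul (hL : 0 < L) (hc : Dec L (p + j) c T) :
    Dec L p (fun k t => lam L k ^ j * c k t) T := by
  obtain ⟨C, hC, h⟩ := hc
  refine ⟨C, hC, fun k hk t ht => ?_⟩
  have h3 := lam_pos hL hk
  rw [abs_mul, abs_of_pos (by positivity : 0 < lam L k ^ j), ← mul_assoc, ← pow_add]
  exact h k hk t ht

lemma us (hL : 0 < L) (hc : Dec L q c T) (hj : j + 2 ≤ q) :
    US (fun k t => lam L k ^ j * c k t) (Icc 0 T) := by
  obtain ⟨C, hC, h⟩ := hc.mono hL hj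
  have hs : Summable fun k : ℕ => C / (Real.pi / L) ^ 2 * (1 / (k : ℝ) ^ 2) :=
    (Real.summable_one_div_nat_pow.2 (by norm_num)).mul_left _
  refine US.of_bound hs fun k hk t ht => ?_
  have h3 := lam_pos hL hk
  have hk' : (0 : ℝ) < k := by exact_mod_cast hk
  rw [abs_mul, abs_of_pos (by positivity : 0 < lam L k ^ j)]
  have h1 := h k hk t ht
  rw [pow_add, mul_right_comm, ← le_div_iff₀ (by positivity)] at h1
  refine h1.trans (le_of_eq ?_)
  unfold lam
  have := Real.pi_pos
  field_simp

lemma us' (hL : 0 < L) (hc : Dec L q c T) (hj : 2 ≤ q) : US c (Icc 0 T) :=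
  (hc.us hL (j := 0) (by simpa using hj)).congr fun k _ t _ => by simp

/-- Gain of decay in a damped equation. -/
lemma ode (hL : 0 < L) {κ : ℝ} (hκ : 0 < κ) {y φ : ℕ → ℝ → ℝ}
    (hy : ∀ k t, HasDerivAt (y k) (-(κ * lam L k ^ m) * y k t + φ k t) t)
    (hφ : Dec L p φ T) (h0 : DecS L (p + m) (fun k => y k 0)) : Dec L (p + m) y T := by
  obtain ⟨C, hC, h⟩ := hφ
  obtain ⟨D, hD, h'⟩ := h0
  refine ⟨D + C / κ, by positivity, fun k hk t ht => ?_⟩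
  have h3 := lam_pos hL hk
  have h4 := scalar_le_const (C := C / lam L k ^ p) (hy k) (by positivity) (by positivity)
    (fun s hs => by rw [le_div_iff₀ (by positivity), mul_comm]; exact h k hk s hs) ht
  calc lam L k ^ (p + m) * |y k t|
      ≤ lam L k ^ (p + m) * (|y k 0| + C / lam L k ^ p / (κ * lam L k ^ m)) := by gcongr
    _ = lam L k ^ (p + m) * |y k 0| + C / κ := by rw [pow_add]; field_simp
    _ ≤ D + C / κ := by gcongr; exact h' k hk

end Dec

lemma rpow_mul_exp_neg_le {x β : ℝ} (hx : 0 < x) (hβ0 : 0 ≤ β) (hβ1 : β ≤ 1) :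
    x ^ β * Real.exp (-x) ≤ 1 := by
  rw [Real.exp_neg, ← div_eq_mul_inv, div_le_one (Real.exp_pos _)]
  rcases le_total x 1 with h | h
  · exact (Real.rpow_le_one hx.le h hβ0).trans (Real.one_le_exp hx.le)
  · calc x ^ β ≤ x ^ (1 : ℝ) := Real.rpow_le_rpow_of_exponent_le h hβ1
      _ = x := Real.rpow_one x
      _ ≤ Real.exp x := by linarith [Real.add_one_le_exp x]

lemma summable_lam_rpow {L : ℝ} (hL : 0 < L) :
    Summable fun k : ℕ => lam L k ^ (-(3 / 2) : ℝ) := by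
  have h := (Real.summable_nat_rpow.2 (by norm_num : (-(3 / 2) : ℝ) < -1)).mul_right
    ((Real.pi / L) ^ (-(3 / 2) : ℝ))
  refine h.congr fun k => ?_
  have := Real.pi_pos
  rw [lam, Real.mul_rpow (by positivity) (by positivity)]

/-- Smoothing: a damped system with forcing bounded in `ℓ²` gains `m - 1` powers of the frequency
in `ℓ¹`. -/
lemma smoothing {L : ℝ} (hL : 0 < L) {κ : ℝ} (hκ : 0 < κ) {m : ℕ} (hm : 1 ≤ m) {T B : ℝ}
    {y φ : ℕ → ℝ → ℝ}
    (hy : ∀ k t, HasDerivAt (y k) (-(κ * lam L k ^ m) * y k t + φ k t) t)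
    (hφ : ∀ k, Continuous (φ k))
    (hB : ∀ N, ∀ t ∈ Icc 0 T, ∑ k ∈ Finset.range N, φ k t ^ 2 ≤ B)
    (h0 : Summable fun k => |lam L k ^ (m - 1) * y k 0|) :
    US (fun k t => lam L k ^ (m - 1) * y k t) (Icc 0 T) := by
  rcases lt_or_ge T 0 with hT | hT
  · intro η hη
    exact ⟨1, le_rfl, fun M t ht => by linarith [ht.1, ht.2]⟩
  have hm' : (1 : ℝ) ≤ m := by exact_mod_cast hm
  set β : ℝ := 1 - 1 / (4 * m) with hβ
  have hβ1 : β < 1 := by rw [hβ]; have : 0 < 1 / (4 * (m : ℝ)) := by positivity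
                         linarith
  have hβ0 : 0 < β := by
    have : 1 / (4 * (m : ℝ)) ≤ 1 / 4 := by gcongr; linarith
    rw [hβ]; linarith
  have hmβ : (m : ℝ) * β = m - 1 / 4 := by rw [hβ]; field_simp
  set K : ℝ := κ ^ (-β) * √B * (T ^ (1 - β) / (1 - β)) with hK
  have hK0 : 0 ≤ K := by
    have : 0 ≤ T ^ (1 - β) / (1 - β) := div_nonneg (Real.rpow_nonneg hT _) (by linarith)
    positivity
  -- the kernel bound
  have hker : ∀ k, 1 ≤ k → ∀ τ, 0 < τ → lam L k ^ (m - 1) * Real.exp (-(κ * lam L k ^ m * τ))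
      ≤ κ ^ (-β) * τ ^ (-β) * lam L k ^ (-(3 / 4) : ℝ) := by
    intro k hk τ hτ
    have hl := lam_pos hL hk
    have h1 := rpow_mul_exp_neg_le (x := κ * lam L k ^ m * τ) (by positivity) hβ0.le hβ1.le
    have h2 : (κ * lam L k ^ m * τ) ^ β = κ ^ β * lam L k ^ ((m : ℝ) * β) * τ ^ β := by
      rw [Real.mul_rpow (by positivity) hτ.le, Real.mul_rpow hκ.le (by positivity),
        ← Real.rpow_natCast, ← Real.rpow_mul hl.le]
    have h3 : lam L k ^ (m - 1) = lam L k ^ ((m : ℝ) * β) * lam L k ^ (-(3 / 4) : ℝ) := by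
      rw [← Real.rpow_natCast, ← Real.rpow_add hl, hmβ, Nat.cast_sub hm]
      congr 1; push_cast; ring
    have h4 : κ ^ (-β) * κ ^ β = 1 := by rw [← Real.rpow_add hκ]; simp
    have h5 : τ ^ (-β) * τ ^ β = 1 := by rw [← Real.rpow_add hτ]; simp
    rw [h2] at h1
    calc lam L k ^ (m - 1) * Real.exp (-(κ * lam L k ^ m * τ))
        = (κ ^ (-β) * κ ^ β) * (τ ^ (-β) * τ ^ β) * (lam L k ^ (m - 1)
          * Real.exp (-(κ * lam L k ^ m * τ))) := by rw [h4, h5]; ring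
      _ = κ ^ (-β) * τ ^ (-β) * lam L k ^ (-(3 / 4) : ℝ) * (κ ^ β * lam L k ^ ((m : ℝ) * β) * τ ^ β
          * Real.exp (-(κ * lam L k ^ m * τ))) := by rw [h3]; ring
      _ ≤ κ ^ (-β) * τ ^ (-β) * lam L k ^ (-(3 / 4) : ℝ) * 1 := by gcongr
      _ = _ := mul_one _
  have hmain : ∀ N M : ℕ, 1 ≤ N → ∀ t ∈ Icc 0 T,
      ∑ k ∈ Finset.Ico N M, |lam L k ^ (m - 1) * y k t|
      ≤ ∑ k ∈ Finset.Ico N M, |lam L k ^ (m - 1) * y k 0|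
        + K * √(∑ k ∈ Finset.Ico N M, lam L k ^ (-(3 / 2) : ℝ)) := by
    intro N M hN t ht
    set D := ∑ k ∈ Finset.Ico N M, lam L k ^ (-(3 / 2) : ℝ)
    have hterm : ∀ k ∈ Finset.Ico N M, |lam L k ^ (m - 1) * y k t| ≤ |lam L k ^ (m - 1) * y k 0|
        + ∫ s in (0 : ℝ)..t, lam L k ^ (m - 1) *
          (Real.exp (-(κ * lam L k ^ m * (t - s))) * |φ k s|) := by
      intro k hk
      have hl := lam_pos hL (hN.trans (Finset.mem_Ico.1 hk).1)
      rw [duhamel (hy k) (hφ k) t, intervalIntegral.integral_const_mul, abs_mul, abs_mul,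
        abs_of_pos (by positivity : 0 < lam L k ^ (m - 1)), ← mul_add]
      gcongr
      refine (abs_add_le _ _).trans (add_le_add ?_ ?_)
      · rw [abs_mul, Real.abs_exp]
        refine mul_le_of_le_one_left (abs_nonneg _) (Real.exp_le_one_iff.2 ?_)
        have := ht.1
        have : 0 ≤ κ * lam L k ^ m * t := by positivity
        linarith
      · refine (intervalIntegral.abs_integral_le_integral_abs ht.1).trans (le_of_eq ?_)
        congr 1; ext s
        rw [abs_mul, Real.abs_exp]
    refine (Finset.sum_le_sum hterm).trans ?_
    rw [Finset.sum_add_distrib]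
    gcongr
    have hcont : ∀ k, Continuous fun s => lam L k ^ (m - 1) *
        (Real.exp (-(κ * lam L k ^ m * (t - s))) * |φ k s|) := fun k => by
      have := hφ k; fun_prop
    rw [← intervalIntegral.integral_finsetSum fun k _ => (hcont k).intervalIntegrable _ _]
    have hint : IntervalIntegrable (fun s => (t - s) ^ (-β)) volume 0 t := by
      have := (intervalIntegral.intervalIntegrable_rpow' (a := t) (b := 0)
        (by linarith : -1 < -β)).comp_sub_left t
      simpa using this
    have hval : ∫ s in (0 : ℝ)..t, (t - s) ^ (-β) = t ^ (1 - β) / (1 - β) := by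
      rw [intervalIntegral.integral_comp_sub_left (fun s => s ^ (-β)) t]
      rw [integral_rpow (Or.inl (by linarith))]
      simp only [sub_self, sub_zero]
      rw [Real.zero_rpow (by linarith), sub_zero, neg_add_eq_sub]
    calc ∫ s in (0 : ℝ)..t, ∑ k ∈ Finset.Ico N M, lam L k ^ (m - 1) *
          (Real.exp (-(κ * lam L k ^ m * (t - s))) * |φ k s|)
        ≤ ∫ s in (0 : ℝ)..t, κ ^ (-β) * √B * √D * (t - s) ^ (-β) := by
          refine intervalIntegral.integral_mono_on_of_le_Ioo ht.1
            ((continuous_finsetSum _ fun k _ => hcont k).intervalIntegrable _ _)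
            (hint.const_mul _) fun s hs => ?_
          have hτ : 0 < t - s := by linarith [hs.2]
          calc ∑ k ∈ Finset.Ico N M, lam L k ^ (m - 1) *
                (Real.exp (-(κ * lam L k ^ m * (t - s))) * |φ k s|)
              ≤ ∑ k ∈ Finset.Ico N M, κ ^ (-β) * (t - s) ^ (-β) *
                (lam L k ^ (-(3 / 4) : ℝ) * |φ k s|) := by
                refine Finset.sum_le_sum fun k hk => ?_
                have h1 := mul_le_mul_of_nonneg_right
                  (hker k (hN.trans (Finset.mem_Ico.1 hk).1) _ hτ) (abs_nonneg (φ k s))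
                linarith
            _ = κ ^ (-β) * (t - s) ^ (-β) *
                ∑ k ∈ Finset.Ico N M, lam L k ^ (-(3 / 4) : ℝ) * |φ k s| := by
                rw [Finset.mul_sum]
            _ ≤ κ ^ (-β) * (t - s) ^ (-β) * (√D * √B) := by
                gcongr
                refine (Real.sum_mul_le_sqrt_mul_sqrt _ _ _).trans ?_
                have e1 : ∑ k ∈ Finset.Ico N M, (lam L k ^ (-(3 / 4) : ℝ)) ^ 2 = D := by
                  refine Finset.sum_congr rfl fun k hk => ?_
                  have hl := lam_nonneg hL k
                  rw [← Real.rpow_natCast, ← Real.rpow_mul hl]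
                  norm_num
                rw [e1]
                gcongr
                refine le_trans ?_ (hB M s ⟨hs.1.le, hs.2.le.trans ht.2⟩)
                simp only [sq_abs]
                refine Finset.sum_le_sum_of_subset_of_nonneg ?_ fun _ _ _ => sq_nonneg _
                intro k hk
                exact Finset.mem_range.2 (Finset.mem_Ico.1 hk).2
            _ = _ := by ring
      _ = κ ^ (-β) * √B * √D * (t ^ (1 - β) / (1 - β)) := by
          rw [intervalIntegral.integral_const_mul, hval]
      _ ≤ κ ^ (-β) * √B * √D * (T ^ (1 - β) / (1 - β)) := by
          have : 0 < 1 - β := by linarith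
          have h1 := ht.1
          have h2 := ht.2
          gcongr
      _ = K * √D := by rw [hK]; ring
  intro η hη
  have hU0 : US (fun k (_ : ℝ) => lam L k ^ (m - 1) * y k 0) univ :=
    US.of_bound h0 fun k _ t _ => le_rfl
  have hU1 : US (fun k (_ : ℝ) => lam L k ^ (-(3 / 2) : ℝ)) univ :=
    US.of_bound (summable_lam_rpow hL) fun k _ t _ => by
      rw [abs_of_nonneg (Real.rpow_nonneg (lam_nonneg hL k) _)]
  obtain ⟨N, hN, h1⟩ := hU0 (η / 2) (by positivity)
  obtain ⟨N', hN', h2⟩ := hU1 ((η / (2 * (K + 1))) ^ 2) (by positivity)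
  refine ⟨max N N', by omega, fun M t ht => (hmain _ M (by omega) t ht).trans ?_⟩
  have h3 := (Finset.sum_le_sum_of_subset_of_nonneg
    (Finset.Ico_subset_Ico_left (b := M) (le_max_left N N'))
    (fun i _ _ => abs_nonneg (lam L i ^ (m - 1) * y i 0))).trans (h1 M 0 (mem_univ _))
  have h4 := (Finset.sum_le_sum_of_subset_of_nonneg
    (Finset.Ico_subset_Ico_left (b := M) (le_max_right N N'))
    (fun i _ _ => abs_nonneg (lam L i ^ (-(3 / 2) : ℝ)))).trans (h2 M 0 (mem_univ _))
  have h5 : ∑ k ∈ Finset.Ico (max N N') M, lam L k ^ (-(3 / 2) : ℝ) ≤ (η / (2 * (K + 1))) ^ 2 :=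
    (Finset.sum_le_sum fun k _ => le_abs_self _).trans h4
  have h6 : √(∑ k ∈ Finset.Ico (max N N') M, lam L k ^ (-(3 / 2) : ℝ)) ≤ η / (2 * (K + 1)) :=
    Real.sqrt_le_iff.2 ⟨by positivity, h5⟩
  have h7 : K * (η / (2 * (K + 1))) ≤ η / 2 := by
    rw [mul_div_assoc', div_le_div_iff₀ (by positivity) (by positivity)]
    nlinarith
  have h8 := mul_le_mul_of_nonneg_left h6 hK0
  linarith

lemma continuous_slice {G : ℝ → ℝ → ℝ} (hG : Continuous (uncurry G)) (t : ℝ) :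
    Continuous fun x => G x t :=
  hG.comp (by fun_prop : Continuous fun x : ℝ => (x, t))

lemma continuous_cc {L : ℝ} {G : ℝ → ℝ → ℝ} (hG : Continuous (uncurry G)) (k : ℕ) :
    Continuous fun t => cc L (fun x => G x t) k := by
  unfold cc
  refine continuous_const.mul ?_
  refine intervalIntegral.continuous_parametric_intervalIntegral_of_continuous'
    (f := fun t x => G x t * bc L k x) ?_ _ _
  exact (hG.comp (by fun_prop : Continuous fun p : ℝ × ℝ => (p.2, p.1))).mul
    ((continuous_bc L k).comp continuous_snd)

/-- Decay of the damped velocity mode. -/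
lemma mode_v_le {ε l l₁ γ C T : ℝ} {v u φ : ℝ → ℝ} (hε : 0 < ε) (hl₁ : 0 < l₁) (hl : l₁ ≤ l)
    (hv : ∀ t, HasDerivAt v (-(ε * l ^ 4) * v t + (l * φ t - l ^ 2 * u t)) t)
    (hu : ∀ t, HasDerivAt u (-(ε * l ^ 2) * u t + v t) t)
    (hγ : 0 ≤ γ) (hC : 0 ≤ C)
    (hφ : ∀ t ∈ Icc 0 T, |φ t| ≤ C * Real.exp (γ * t)) {t : ℝ} (ht : t ∈ Icc 0 T) :
    l ^ 3 * |v t| ≤ (l ^ 3 * |v 0| + (C + (|v 0| + l * |u 0|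
      + C / (ε * l₁ * min 1 (l₁ ^ 2)))) / ε) * Real.exp (γ * t) := by
  have hl0 : 0 < l := hl₁.trans_le hl
  set μ := min 1 (l₁ ^ 2) with hμ
  have hμ0 : 0 < μ := lt_min one_pos (by positivity)
  set W := |v 0| + l * |u 0| + C / (ε * l₁ * μ) with hW
  have hW0 : 0 ≤ W := by positivity
  have hu' : ∀ s ∈ Icc 0 T, l * |u s| ≤ W * Real.exp (γ * s) := by
    intro s hs
    have h := (pair_le (m := ε * l ^ 2 * μ) (C := l * C) hv hu (by positivity) ?_ ?_ hl0.le hγ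
      (by positivity) (fun r hr => ?_) hs).2
    · refine h.trans ?_
      gcongr
      rw [hW]
      gcongr _ + ?_
      rw [div_le_div_iff₀ (by positivity) (by positivity)]
      have : 0 ≤ ε * μ * C * l * (l - l₁) :=
        mul_nonneg (by positivity) (by linarith)
      nlinarith
    · have h1 : μ ≤ l ^ 2 := (min_le_right _ _).trans (by gcongr)
      calc ε * l ^ 2 * μ ≤ ε * l ^ 2 * l ^ 2 := by gcongr
        _ = ε * l ^ 4 := by ring
    · have h1 : μ ≤ 1 := min_le_left _ _
      calc ε * l ^ 2 * μ ≤ ε * l ^ 2 * 1 := by gcongr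
        _ = ε * l ^ 2 := by ring
    · rw [abs_mul, abs_of_pos hl0, mul_assoc]
      exact mul_le_mul_of_nonneg_left (hφ r hr) hl0.le
  have h2 := scalar_le (C := l * (C + W)) hv (by positivity) hγ (by positivity) (fun s hs => ?_) ht
  · have h3 : l * (C + W) / (ε * l ^ 4 + γ) ≤ l * (C + W) / (ε * l ^ 4) := by
      gcongr; linarith
    calc l ^ 3 * |v t| ≤ l ^ 3 * ((|v 0| + l * (C + W) / (ε * l ^ 4)) * Real.exp (γ * t)) := by
          gcongr; refine h2.trans ?_; gcongr
      _ = (l ^ 3 * |v 0| + (C + W) / ε) * Real.exp (γ * t) := by field_simp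
  · calc |l * φ s - l ^ 2 * u s| ≤ |l * φ s| + |l ^ 2 * u s| := abs_sub _ _
      _ = l * |φ s| + l * (l * |u s|) := by
          rw [abs_mul, abs_mul, abs_of_pos hl0, abs_of_pos (by positivity : 0 < l ^ 2)]; ring
      _ ≤ l * (C * Real.exp (γ * s)) + l * (W * Real.exp (γ * s)) :=
          add_le_add (mul_le_mul_of_nonneg_left (hφ s hs) hl0.le)
            (mul_le_mul_of_nonneg_left (hu' s hs) hl0.le)
      _ = _ := by ring

/-- The cosine series of the spatial derivative of a sine series, frozen for negative times. -/
def VX (L : ℝ) (v : ℕ → ℝ → ℝ) (x t : ℝ) : ℝ :=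
  ser (bc L) (fun k s => lam L k * v k s) x (max t 0)

/-- The mechanical modes driven by a continuous stress `G`. -/
structure PairSol (ε L : ℝ) (A U : ℕ → ℝ) (G : ℝ → ℝ → ℝ) (v u : ℕ → ℝ → ℝ) : Prop where
  contG : Continuous (uncurry G)
  dv : ∀ k t, HasDerivAt (v k) (-(ε * lam L k ^ 4) * v k t
    + (lam L k * cc L (fun x => G x t) k - lam L k ^ 2 * u k t)) t
  du : ∀ k t, HasDerivAt (u k) (-(ε * lam L k ^ 2) * u k t + v k t) t
  v0 : ∀ k, v k 0 = A k
  u0 : ∀ k, u k 0 = U k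

/-- The full system of modes driven by a continuous stress `G`. -/
structure Driven (ε L : ℝ) (A U H : ℕ → ℝ) (G : ℝ → ℝ → ℝ) (v u θ : ℕ → ℝ → ℝ) : Prop
    extends PairSol ε L A U G v u where
  dθ : ∀ k t, HasDerivAt (θ k) (-(1 * lam L k ^ 2) * θ k t
    + -cc L (fun x => G x t * VX L v x t) k) t
  θ0 : ∀ k, θ k 0 = H k

lemma exists_pairSol (ε L : ℝ) (A U : ℕ → ℝ) {G : ℝ → ℝ → ℝ} (hG : Continuous (uncurry G)) :
    ∃ v u, PairSol ε L A U G v u := by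
  have h : ∀ k : ℕ, ∃ x : ℝ → ℝ × ℝ, x 0 = (A k, U k) ∧ ∀ t, HasDerivAt x
      ((-(ε * lam L k ^ 4) * (x t).1 + (lam L k * cc L (fun x => G x t) k
        - lam L k ^ 2 * (x t).2), -(ε * lam L k ^ 2) * (x t).2 + (x t).1)) t := by
    intro k
    let M : ℝ × ℝ →L[ℝ] ℝ × ℝ := ContinuousLinearMap.prod
      (-(ε * lam L k ^ 4) • ContinuousLinearMap.fst ℝ ℝ ℝ
        - (lam L k ^ 2) • ContinuousLinearMap.snd ℝ ℝ ℝ)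
      (-(ε * lam L k ^ 2) • ContinuousLinearMap.snd ℝ ℝ ℝ + ContinuousLinearMap.fst ℝ ℝ ℝ)
    obtain ⟨x, hx0, hx⟩ := exists_linear_ode M (A k, U k)
      (Φ := fun t => (lam L k * cc L (fun x => G x t) k, 0))
      ((continuous_const.mul (continuous_cc hG k)).prodMk continuous_const)
    refine ⟨x, hx0, fun t => (hx t).congr_deriv ?_⟩
    ext
    · simp [M]; ring
    · simp [M]
  choose x hx0 hx using h
  refine ⟨fun k t => (x k t).1, fun k t => (x k t).2, hG, fun k t => ?_, fun k t => ?_,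
    fun k => by simp [hx0], fun k => by simp [hx0]⟩
  · have := (ContinuousLinearMap.fst ℝ ℝ ℝ).hasFDerivAt.comp_hasDerivAt t (hx k t)
    exact this
  · have := (ContinuousLinearMap.snd ℝ ℝ ℝ).hasFDerivAt.comp_hasDerivAt t (hx k t)
    exact this

lemma exists_bound_of_continuous {G : ℝ → ℝ → ℝ} (hG : Continuous (uncurry G)) (L T : ℝ) :
    ∃ B, 0 ≤ B ∧ ∀ x ∈ Icc (-L) L, ∀ t ∈ Icc 0 T, |G x t| ≤ B := by
  obtain ⟨B, hB⟩ := (isCompact_Icc.prod isCompact_Icc : IsCompact (Icc (-L) L ×ˢ Icc 0 T))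
      |>.exists_bound_of_continuousOn
    hG.continuousOn
  exact ⟨max B 0, le_max_right _ _, fun x hx t ht => (hB (x, t) ⟨hx, ht⟩).trans (le_max_left _ _)⟩

lemma summable_lam_inv_sq (L : ℝ) : Summable fun k : ℕ => (lam L k ^ 2)⁻¹ := by
  have h := (Real.summable_one_div_nat_pow.2 (by norm_num : 1 < 2)).mul_left ((Real.pi / L) ^ 2)⁻¹
  refine h.congr fun k => ?_
  rw [lam, mul_pow, mul_inv]; ring

/-- The supremum bound for a cosine series whose coefficients decay like `λ⁻³`. -/
lemma abs_VX_le {L : ℝ} (hL : 0 < L) {v : ℕ → ℝ → ℝ} {t C : ℝ} (ht : 0 ≤ t)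
    (hv : ∀ k, 1 ≤ k → lam L k ^ 3 * |v k t| ≤ C) (x : ℝ) :
    |VX L v x t| ≤ C * ∑' k, (lam L k ^ 2)⁻¹ := by
  have hle : ∀ k, |lam L k * v k t| ≤ C * (lam L k ^ 2)⁻¹ := by
    intro k
    rcases Nat.eq_zero_or_pos k with rfl | hk
    · simp [lam_zero]
    · have h3 := lam_pos hL hk
      rw [abs_mul, abs_of_pos h3, ← div_eq_mul_inv, le_div_iff₀ (by positivity)]
      exact (le_of_eq (by ring)).trans (hv k hk)
  have hs := (summable_lam_inv_sq L).mul_left C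
  have hs' : Summable fun k => |lam L k * v k t| :=
    Summable.of_nonneg_of_le (fun _ => abs_nonneg _) hle hs
  unfold VX ser
  rw [max_eq_left ht]
  exact (abs_tsum_sys_le (abs_bc_le L) hs' x).trans ((hs'.tsum_le_tsum hle hs).trans
    (le_of_eq tsum_mul_left))

namespace PairSol

variable {ε L : ℝ} {A U : ℕ → ℝ} {G : ℝ → ℝ → ℝ} {v u : ℕ → ℝ → ℝ}

/-- Uniform decay of the velocity modes for bounded stress. -/
lemma exists_dec (hε : 0 < ε) (hL : 0 < L) (hA : DecS L 3 A) (hU : DecS L 1 U) (B : ℝ) :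
    ∃ C, 0 ≤ C ∧ ∀ G v u, PairSol ε L A U G v u → ∀ T,
      (∀ x ∈ Icc (-L) L, ∀ t ∈ Icc 0 T, |G x t| ≤ B) →
      ∀ k, 1 ≤ k → ∀ t ∈ Icc 0 T, lam L k ^ 3 * |v k t| ≤ C := by
  obtain ⟨CA, hCA, hA'⟩ := hA.dec 0 |>.mono hL (by norm_num : 0 ≤ 3)
  obtain ⟨CA3, hCA3, hA3⟩ := hA
  obtain ⟨CU, hCU, hU⟩ := hU
  have hl1 := lam_pos hL (le_refl 1)
  refine ⟨CA3 + (2 * |B| + (CA + CU + 2 * |B| / (ε * lam L 1 * min 1 (lam L 1 ^ 2)))) / ε,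
    ?_, fun G v u h T hG k hk t ht => ?_⟩
  · have : 0 < min 1 (lam L 1 ^ 2) := lt_min one_pos (by positivity)
    positivity
  · have h1 := mode_v_le (γ := 0) (C := 2 * |B|) hε hl1 (lam_one_le hL hk) (h.dv k) (h.du k)
      le_rfl (by positivity) (fun s hs => ?_) ht
    · rw [h.v0, h.u0] at h1
      have h2 := hA3 k hk
      have h3 := hU k hk
      have h4 := hA' k hk 0 ⟨le_rfl, le_rfl⟩
      simp only [pow_zero, one_mul, pow_one, zero_mul, Real.exp_zero, mul_one] at h1 h3 h4
      refine h1.trans ?_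
      gcongr
    · simp only [zero_mul, Real.exp_zero, mul_one]
      exact abs_cc_le hL (fun x hx => (hG x hx s hs).trans (le_abs_self B)) k

lemma dec_three (h : PairSol ε L A U G v u) (hε : 0 < ε) (hL : 0 < L) (hA : DecS L 3 A)
    (hU : DecS L 1 U) (T : ℝ) : Dec L 3 v T := by
  obtain ⟨B, -, hB⟩ := exists_bound_of_continuous h.contG L T
  obtain ⟨C, hC, hdec⟩ := exists_dec hε hL hA hU B
  exact ⟨C, hC, hdec G v u h T hB⟩

lemma cont_v (h : PairSol ε L A U G v u) (k : ℕ) : Continuous (v k) :=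
  continuous_iff_continuousAt.2 fun t => (h.dv k t).continuousAt

end PairSol

/-- A series with coefficients uniformly summable on bounded time intervals is continuous when
frozen for negative times. -/
lemma continuous_ser_max {e c : ℕ → ℝ → ℝ} (he : Sys e) (hc : ∀ k, Continuous (c k))
    (h : ∀ T, US c (Icc 0 T)) : Continuous (uncurry fun x t => ser e c x (max t 0)) := by
  refine continuous_iff_continuousAt.2 fun p => ?_
  have h1 := (h (max p.2 0 + 1)).continuousOn_ser he fun k => (hc k).continuousOn
  have h2 : ContinuousOn (fun q : ℝ × ℝ => uncurry (ser e c) (q.1, max q.2 0))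
      {q | q.2 < max p.2 0 + 1} := by
    refine h1.comp (by fun_prop) fun q hq => ⟨mem_univ _, le_max_right _ _, ?_⟩
    have : q.2 < max p.2 0 + 1 := hq
    exact max_le this.le (by linarith [le_max_right p.2 0])
  refine h2.continuousAt (IsOpen.mem_nhds (isOpen_lt (by fun_prop) (by fun_prop)) ?_)
  show p.2 < max p.2 0 + 1
  linarith [le_max_left p.2 0]

lemma PairSol.continuous_VX {ε L : ℝ} {A U : ℕ → ℝ} {G : ℝ → ℝ → ℝ} {v u : ℕ → ℝ → ℝ}
    (h : PairSol ε L A U G v u) (hε : 0 < ε) (hL : 0 < L) (hA : DecS L 3 A)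
    (hU : DecS L 1 U) : Continuous (uncurry (VX L v)) := by
  refine continuous_ser_max (sys_bc L) (fun k => continuous_const.mul (h.cont_v k)) fun T => ?_
  exact ((h.dec_three hε hL hA hU T).us hL (j := 1) (by norm_num)).congr fun k _ t _ => by simp

lemma exists_driven {ε L : ℝ} (hε : 0 < ε) (hL : 0 < L) {A U : ℕ → ℝ} (hA : DecS L 3 A)
    (hU : DecS L 1 U) (H : ℕ → ℝ) {G : ℝ → ℝ → ℝ} (hG : Continuous (uncurry G)) :
    ∃ v u θ, Driven ε L A U H G v u θ := by
  obtain ⟨v, u, h⟩ := exists_pairSol ε L A U hG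
  have hVX := h.continuous_VX hε hL hA hU
  have hn : Continuous (uncurry fun x t => G x t * VX L v x t) := hG.mul hVX
  have hθ : ∀ k : ℕ, ∃ y : ℝ → ℝ, y 0 = H k ∧ ∀ t, HasDerivAt y (-(1 * lam L k ^ 2) * y t
      + -cc L (fun x => G x t * VX L v x t) k) t := by
    intro k
    obtain ⟨y, hy0, hy⟩ := exists_linear_ode
      (-(1 * lam L k ^ 2) • ContinuousLinearMap.id ℝ ℝ) (H k) (continuous_cc (L := L) hn k).neg
    exact ⟨y, hy0, fun t => (hy t).congr_deriv (by simp)⟩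
  choose θ hθ0 hθ using hθ
  exact ⟨v, u, θ, { toPairSol := h, dθ := hθ, θ0 := hθ0 }⟩

lemma Driven.cont_θ {ε L : ℝ} {A U H : ℕ → ℝ} {G : ℝ → ℝ → ℝ} {v u θ : ℕ → ℝ → ℝ}
    (h : Driven ε L A U H G v u θ) (k : ℕ) : Continuous (θ k) :=
  continuous_iff_continuousAt.2 fun t => (h.dθ k t).continuousAt

/-- Lipschitz dependence of the thermal modes on the stress. -/
lemma Driven.exists_lipschitz {ε L : ℝ} (hε : 0 < ε) (hL : 0 < L) {A U : ℕ → ℝ}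
    (hA : DecS L 3 A) (hU : DecS L 1 U) (H : ℕ → ℝ) (B : ℝ) :
    ∃ C, 0 ≤ C ∧ ∀ G₁ v₁ u₁ θ₁ G₂ v₂ u₂ θ₂, Driven ε L A U H G₁ v₁ u₁ θ₁ →
      Driven ε L A U H G₂ v₂ u₂ θ₂ → ∀ T D γ, 0 ≤ D → 0 < γ →
      (∀ x ∈ Icc (-L) L, ∀ t ∈ Icc 0 T, |G₁ x t| ≤ B) →
      (∀ x ∈ Icc (-L) L, ∀ t ∈ Icc 0 T, |G₂ x t| ≤ B) →
      (∀ x ∈ Icc (-L) L, ∀ t ∈ Icc 0 T, |G₁ x t - G₂ x t| ≤ D * Real.exp (γ * t)) →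
      ∀ k, ∀ t ∈ Icc 0 T, |θ₁ k t - θ₂ k t| ≤ C * D / (lam L k ^ 2 + γ) * Real.exp (γ * t) := by
  obtain ⟨CV, hCV, hdec⟩ := PairSol.exists_dec hε hL hA hU B
  have hl1 := lam_pos hL (le_refl 1)
  have hμ : 0 < min 1 (lam L 1 ^ 2) := lt_min one_pos (by positivity)
  set S := ∑' k, (lam L k ^ 2)⁻¹ with hS
  have hS0 : 0 ≤ S := tsum_nonneg fun k => by positivity
  set C1 := (2 + 2 / (ε * lam L 1 * min 1 (lam L 1 ^ 2))) / ε with hC1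
  have hC10 : 0 ≤ C1 := by positivity
  refine ⟨2 * (CV * S + |B| * (C1 * S)), by positivity, ?_⟩
  intro G₁ v₁ u₁ θ₁ G₂ v₂ u₂ θ₂ h₁ h₂ T D γ hD hγ hB₁ hB₂ hG k t ht
  have hcc : ∀ k, ∀ s ∈ Icc 0 T,
      |cc L (fun x => G₁ x s) k - cc L (fun x => G₂ x s) k| ≤ 2 * D * Real.exp (γ * s) := by
    intro k s hs
    rw [← cc_sub L (continuous_slice h₁.contG s) (continuous_slice h₂.contG s), mul_assoc]
    exact abs_cc_le hL (fun x hx => hG x hx s hs) k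
  have hv : ∀ k, 1 ≤ k → ∀ s ∈ Icc 0 T,
      lam L k ^ 3 * |v₁ k s - v₂ k s| ≤ C1 * D * Real.exp (γ * s) := by
    intro k hk s hs
    have h := mode_v_le (v := fun s => v₁ k s - v₂ k s) (u := fun s => u₁ k s - u₂ k s)
      (φ := fun s => cc L (fun x => G₁ x s) k - cc L (fun x => G₂ x s) k)
      hε hl1 (lam_one_le hL hk)
      (fun r => ((h₁.dv k r).sub (h₂.dv k r)).congr_deriv (by ring))
      (fun r => ((h₁.du k r).sub (h₂.du k r)).congr_deriv (by ring)) hγ.le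
      (by positivity : 0 ≤ 2 * D) (hcc k) hs
    simp only [h₁.v0, h₂.v0, h₁.u0, h₂.u0, sub_self, abs_zero, mul_zero, zero_add] at h
    refine h.trans (le_of_eq ?_)
    rw [hC1]; ring
  have hV₁ : ∀ x, ∀ s ∈ Icc 0 T, |VX L v₁ x s| ≤ CV * S := fun x s hs =>
    abs_VX_le hL hs.1 (fun k hk => hdec _ _ _ h₁.toPairSol T hB₁ k hk s hs) x
  have hus : ∀ {G v u θ}, Driven ε L A U H G v u θ → ∀ s ∈ Icc 0 T,
      Summable fun k => |lam L k * v k s| := by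
    intro G v u θ h s hs
    exact ((h.dec_three hε hL hA hU T).us hL (j := 1) (by norm_num)).summable hs |>.congr
      fun k => by simp
  have hVd : ∀ x, ∀ s ∈ Icc 0 T,
      |VX L v₁ x s - VX L v₂ x s| ≤ C1 * D * Real.exp (γ * s) * S := by
    intro x s hs
    have h := abs_VX_le hL hs.1 (v := fun k s => v₁ k s - v₂ k s) (fun k hk => hv k hk s hs) x
    refine le_trans (le_of_eq ?_) h
    unfold VX ser
    rw [max_eq_left hs.1, ← Summable.tsum_sub (summable_mul_sys (abs_bc_le L) (hus h₁ s hs) x)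
      (summable_mul_sys (abs_bc_le L) (hus h₂ s hs) x)]
    congr 2; ext k; ring
  have hn : ∀ x ∈ Icc (-L) L, ∀ s ∈ Icc 0 T, |G₁ x s * VX L v₁ x s - G₂ x s * VX L v₂ x s|
      ≤ (CV * S + |B| * (C1 * S)) * D * Real.exp (γ * s) := by
    intro x hx s hs
    have e : G₁ x s * VX L v₁ x s - G₂ x s * VX L v₂ x s
        = (G₁ x s - G₂ x s) * VX L v₁ x s + G₂ x s * (VX L v₁ x s - VX L v₂ x s) := by ring
    rw [e]
    refine (abs_add_le _ _).trans ?_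
    rw [abs_mul, abs_mul]
    calc |G₁ x s - G₂ x s| * |VX L v₁ x s| + |G₂ x s| * |VX L v₁ x s - VX L v₂ x s|
        ≤ (D * Real.exp (γ * s)) * (CV * S) + |B| * (C1 * D * Real.exp (γ * s) * S) :=
          add_le_add (mul_le_mul (hG x hx s hs) (hV₁ x s hs) (abs_nonneg _) (by positivity))
            (mul_le_mul ((hB₂ x hx s hs).trans (le_abs_self B)) (hVd x s hs) (abs_nonneg _)
              (abs_nonneg _))
      _ = _ := by ring
  have hc₁ : ∀ {G v u θ}, Driven ε L A U H G v u θ → ∀ s,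
      Continuous fun x => G x s * VX L v x s := by
    intro G v u θ h s
    exact continuous_slice (G := fun x t => G x t * VX L v x t)
      (h.contG.mul (h.continuous_VX hε hL hA hU)) s
  have h := scalar_sub_le (y := fun s => θ₁ k s - θ₂ k s) (α := 1 * lam L k ^ 2)
    (φ := fun s => -(cc L (fun x => G₁ x s * VX L v₁ x s) k
      - cc L (fun x => G₂ x s * VX L v₂ x s) k))
    (C := 2 * ((CV * S + |B| * (C1 * S)) * D)) (γ := γ) (T := T)
    (fun r => ((h₁.dθ k r).sub (h₂.dθ k r)).congr_deriv (by ring))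
    (by positivity) (by positivity) (fun s hs => by
      rw [abs_neg, ← cc_sub L (hc₁ h₁ s) (hc₁ h₂ s), mul_assoc]
      exact abs_cc_le hL (fun x hx => hn x hx s hs) k) ht
  simp only [h₁.θ0, h₂.θ0, sub_self, mul_zero, sub_zero, one_mul] at h
  refine h.trans (le_of_eq ?_)
  ring

lemma summable_inv_lam_sq_add {L γ : ℝ} (hL : 0 < L) (hγ : 0 < γ) :
    Summable fun k : ℕ => (lam L k ^ 2 + γ)⁻¹ := by
  have h := summable_lam_inv_sq L
  rw [← summable_nat_add_iff 1] at h ⊢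
  refine Summable.of_nonneg_of_le (fun k => by positivity) (fun k => ?_) h
  have := lam_pos hL (Nat.le_add_left 1 k)
  exact inv_anti₀ (by positivity) (by linarith)

lemma exists_weight {L : ℝ} (hL : 0 < L) (C : ℝ) :
    ∃ γ, 0 < γ ∧ C * ∑' k, (lam L k ^ 2 + γ)⁻¹ ≤ 1 / 2 := by
  have h : Tendsto (fun γ : ℝ => ∑' k : ℕ, (lam L k ^ 2 + γ)⁻¹) atTop
      (nhds (∑' _ : ℕ, (0 : ℝ))) := by
    refine tendsto_tsum_of_dominated_convergence (summable_inv_lam_sq_add hL one_pos)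
      (fun k => ?_) ?_
    · exact tendsto_inv_atTop_zero.comp (tendsto_atTop_add_const_left _ _ tendsto_id)
    · filter_upwards [eventually_ge_atTop 1] with γ hγ k
      have : 0 ≤ lam L k ^ 2 := sq_nonneg _
      rw [Real.norm_eq_abs, abs_of_nonneg (by positivity)]
      exact inv_anti₀ (by positivity) (by linarith)
  rw [tsum_zero] at h
  have h2 := (h.const_mul C).eventually (gt_mem_nhds (by simp : C * 0 < 1 / 2))
  obtain ⟨γ, h3, h4⟩ := (h2.and (eventually_gt_atTop 0)).exists
  exact ⟨γ, h4, h3.le⟩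

namespace Driven

variable {ε L : ℝ} {A U H : ℕ → ℝ}

/-- A bound for the thermal modes for bounded stress. -/
lemma exists_theta_bound (hε : 0 < ε) (hL : 0 < L) (hA : DecS L 3 A) (hU : DecS L 1 U)
    (H : ℕ → ℝ) {B : ℝ} (hB : 0 ≤ B) :
    ∃ C, 0 ≤ C ∧ ∀ G v u θ, Driven ε L A U H G v u θ → ∀ T γ, 0 < γ →
      (∀ x ∈ Icc (-L) L, ∀ t ∈ Icc 0 T, |G x t| ≤ B) →
      ∀ k, ∀ t ∈ Icc 0 T, |θ k t| ≤ |H k| + C * (lam L k ^ 2 + γ)⁻¹ * Real.exp (γ * t) := by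
  obtain ⟨CV, hCV, hdec⟩ := PairSol.exists_dec hε hL hA hU B
  set S := ∑' k, (lam L k ^ 2)⁻¹ with hS
  have hS0 : 0 ≤ S := tsum_nonneg fun k => by positivity
  refine ⟨2 * (B * (CV * S)), by positivity, fun G v u θ h T γ hγ hG k t ht => ?_⟩
  have h1 := scalar_sub_le (C := 2 * (B * (CV * S))) (h.dθ k) (γ := γ) (T := T) (by positivity)
    (by positivity) (fun s hs => by
      rw [abs_neg]
      have h2 := abs_cc_le hL (g := fun x => G x s * VX L v x s) (B := B * (CV * S))
        (fun x hx => by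
          rw [abs_mul]
          exact mul_le_mul (hG x hx s hs) (abs_VX_le hL hs.1 (fun k hk =>
            hdec _ _ _ h.toPairSol T hG k hk s hs) x) (abs_nonneg _) hB) k
      refine h2.trans (le_mul_of_one_le_right (by positivity) (Real.one_le_exp ?_))
      exact mul_nonneg hγ.le hs.1) ht
  rw [h.θ0, one_mul, div_eq_mul_inv] at h1
  have h2 : |Real.exp (-(lam L k ^ 2 * t)) * H k| ≤ |H k| := by
    rw [abs_mul, Real.abs_exp]
    refine mul_le_of_le_one_left (abs_nonneg _) (Real.exp_le_one_iff.2 ?_)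
    have := ht.1
    have : 0 ≤ lam L k ^ 2 * t := by positivity
    linarith
  have h3 := abs_sub_abs_le_abs_sub (θ k t) (Real.exp (-(lam L k ^ 2 * t)) * H k)
  linarith

lemma us_theta {G : ℝ → ℝ → ℝ} {v u θ : ℕ → ℝ → ℝ} (h : Driven ε L A U H G v u θ) (hε : 0 < ε)
    (hL : 0 < L) (hA : DecS L 3 A) (hU : DecS L 1 U) (hH : Summable fun k => |H k|) (T : ℝ) :
    US θ (Icc 0 T) := by
  obtain ⟨B, hB0, hB⟩ := exists_bound_of_continuous h.contG L T
  obtain ⟨C, hC, hb⟩ := exists_theta_bound hε hL hA hU H hB0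
  refine US.of_bound (hH.add (((summable_inv_lam_sq_add hL one_pos).mul_left C).mul_right
    (Real.exp (1 * T)))) fun k hk t ht => ?_
  refine (hb G v u θ h T 1 one_pos hB k t ht).trans ?_
  have := ht.2
  gcongr

lemma continuous_theta {G : ℝ → ℝ → ℝ} {v u θ : ℕ → ℝ → ℝ} (h : Driven ε L A U H G v u θ)
    (hε : 0 < ε) (hL : 0 < L) (hA : DecS L 3 A) (hU : DecS L 1 U) (hH : Summable fun k => |H k|) :
    Continuous (uncurry fun x t => ser (bc L) θ x (max t 0)) :=
  continuous_ser_max (sys_bc L) h.cont_θ (h.us_theta hε hL hA hU hH)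

end Driven

/-- Global solvability of the system of modes for bounded Lipschitz stress. -/
lemma exists_solution {ε L : ℝ} (hε : 0 < ε) (hL : 0 < L) {A U H : ℕ → ℝ} (hA : DecS L 3 A)
    (hU : DecS L 1 U) (hH : Summable fun k => |H k|) {F : ℝ → ℝ} {B K : ℝ}
    (hFB : ∀ s, |F s| ≤ B) (hFK : ∀ s r, |F s - F r| ≤ K * |s - r|) :
    ∃ v u θ, Driven ε L A U H (fun x t => F (ser (bc L) θ x (max t 0))) v u θ := by
  have hB0 : 0 ≤ B := (abs_nonneg _).trans (hFB 0)
  have hK0 : 0 ≤ K := by simpa using (abs_nonneg _).trans (hFK 1 0)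
  have hFc : Continuous F := by
    have : LipschitzWith ⟨K, hK0⟩ F := LipschitzWith.of_dist_le_mul fun s r => by
      rw [Real.dist_eq, Real.dist_eq]; exact hFK s r
    exact this.continuous
  obtain ⟨C, hC, hlip⟩ := Driven.exists_lipschitz hε hL hA hU H B
  obtain ⟨C', hC', hbd⟩ := Driven.exists_theta_bound hε hL hA hU H hB0
  obtain ⟨γ, hγ, hsum⟩ := exists_weight hL (C * K)
  let Th : BoundedContinuousFunction (ℝ × ℝ) ℝ → ℝ → ℝ → ℝ :=
    fun w x t => Real.exp (γ * max t 0) * w (x, t)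
  have hTh : ∀ w, Continuous (uncurry fun x t => F (Th w x t)) := by
    intro w
    refine hFc.comp ?_
    have := w.continuous
    show Continuous fun p : ℝ × ℝ => Real.exp (γ * max p.2 0) * w (p.1, p.2)
    fun_prop
  choose v u θ hD using fun w => exists_driven hε hL hA hU H (hTh w)
  have hexp : ∀ t : ℝ, Real.exp (-(γ * t)) * Real.exp (γ * t) = 1 := fun t => by
    rw [← Real.exp_add]; simp
  have hsm := summable_inv_lam_sq_add hL hγ
  have hΦ : ∀ w : BoundedContinuousFunction (ℝ × ℝ) ℝ,
      ∃ z : BoundedContinuousFunction (ℝ × ℝ) ℝ, ∀ x t,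
        z (x, t) = Real.exp (-(γ * max t 0)) * ser (bc L) (θ w) x (max t 0) := by
    intro w
    have hc := (hD w).continuous_theta hε hL hA hU hH
    have hc' : Continuous fun p : ℝ × ℝ =>
        Real.exp (-(γ * max p.2 0)) * ser (bc L) (θ w) p.1 (max p.2 0) :=
      (by fun_prop : Continuous fun p : ℝ × ℝ => Real.exp (-(γ * max p.2 0))).mul hc
    refine ⟨BoundedContinuousFunction.ofNormedAddCommGroup _ hc'
      (∑' k, (|H k| + C' * (lam L k ^ 2 + γ)⁻¹)) (fun p => ?_), fun x t => rfl⟩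
    set τ := max p.2 0
    have hτ : 0 ≤ τ := le_max_right _ _
    have h1 : ∀ k, |Real.exp (-(γ * τ)) * θ w k τ| ≤ |H k| + C' * (lam L k ^ 2 + γ)⁻¹ := by
      intro k
      have h2 := hbd _ _ _ _ (hD w) τ γ hγ (fun x _ t _ => hFB _) k τ ⟨hτ, le_rfl⟩
      rw [abs_mul, Real.abs_exp]
      have h3 : Real.exp (-(γ * τ)) ≤ 1 := Real.exp_le_one_iff.2 (by
        have := mul_nonneg hγ.le hτ; linarith)
      calc Real.exp (-(γ * τ)) * |θ w k τ|
          ≤ Real.exp (-(γ * τ)) * (|H k| + C' * (lam L k ^ 2 + γ)⁻¹ * Real.exp (γ * τ)) := by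
            gcongr
        _ = Real.exp (-(γ * τ)) * |H k| + C' * (lam L k ^ 2 + γ)⁻¹
            * (Real.exp (-(γ * τ)) * Real.exp (γ * τ)) := by ring
        _ ≤ 1 * |H k| + C' * (lam L k ^ 2 + γ)⁻¹ * 1 := by rw [hexp]; gcongr
        _ = _ := by ring
    have hs := hH.add (hsm.mul_left C')
    have hs' : Summable fun k => |Real.exp (-(γ * τ)) * θ w k τ| :=
      Summable.of_nonneg_of_le (fun _ => abs_nonneg _) h1 hs
    have h4 := abs_tsum_sys_le (abs_bc_le L) hs' p.1
    rw [Real.norm_eq_abs, ser, ← tsum_mul_left]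
    simp only [← mul_assoc]
    exact h4.trans (hs'.tsum_le_tsum h1 hs)
  choose Φ hΦ using hΦ
  have hcontr : ContractingWith (1 / 2) Φ := by
    refine ⟨by norm_num, LipschitzWith.of_dist_le_mul fun w z => ?_⟩
    rw [BoundedContinuousFunction.dist_le (by positivity)]
    rintro ⟨x, t⟩
    rw [hΦ, hΦ, Real.dist_eq, ← mul_sub, abs_mul, Real.abs_exp]
    set τ := max t 0
    have hτ : 0 ≤ τ := le_max_right _ _
    have hmem : τ ∈ Icc 0 τ := ⟨hτ, le_rfl⟩
    have h1 := hlip _ _ _ _ _ _ _ _ (hD w) (hD z) τ (K * dist w z) γ (by positivity) hγ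
      (fun x _ t _ => hFB _) (fun x _ t _ => hFB _) (fun x _ s hs => by
        refine (hFK _ _).trans ?_
        rw [mul_assoc]
        refine mul_le_mul_of_nonneg_left ?_ hK0
        show |Real.exp (γ * max s 0) * w (x, s) - Real.exp (γ * max s 0) * z (x, s)| ≤ _
        rw [← mul_sub, abs_mul, Real.abs_exp, max_eq_left hs.1, mul_comm, ← Real.dist_eq]
        gcongr
        exact BoundedContinuousFunction.dist_coe_le_dist _)
    have hs₁ := ((hD w).us_theta hε hL hA hU hH τ).summable hmem
    have hs₂ := ((hD z).us_theta hε hL hA hU hH τ).summable hmem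
    have e : ser (bc L) (θ w) x τ - ser (bc L) (θ z) x τ
        = ∑' k, (θ w k τ - θ z k τ) * bc L k x := by
      rw [ser, ser, ← (summable_mul_sys (abs_bc_le L) hs₁ x).tsum_sub
        (summable_mul_sys (abs_bc_le L) hs₂ x)]
      congr 1; ext k; ring
    have h2 : ∀ k, |θ w k τ - θ z k τ|
        ≤ C * K * dist w z * Real.exp (γ * τ) * (lam L k ^ 2 + γ)⁻¹ := fun k =>
      (h1 k τ hmem).trans (le_of_eq (by rw [div_eq_mul_inv]; ring))
    have hs := hsm.mul_left (C * K * dist w z * Real.exp (γ * τ))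
    have hs' : Summable fun k => |θ w k τ - θ z k τ| :=
      Summable.of_nonneg_of_le (fun _ => abs_nonneg _) h2 hs
    rw [e]
    calc Real.exp (-(γ * τ)) * |∑' k, (θ w k τ - θ z k τ) * bc L k x|
        ≤ Real.exp (-(γ * τ)) * ∑' k, C * K * dist w z * Real.exp (γ * τ)
          * (lam L k ^ 2 + γ)⁻¹ := by
          gcongr
          exact (abs_tsum_sys_le (abs_bc_le L) hs' x).trans (hs'.tsum_le_tsum h2 hs)
      _ = (C * K * ∑' k, (lam L k ^ 2 + γ)⁻¹) * dist w z
          * (Real.exp (-(γ * τ)) * Real.exp (γ * τ)) := by rw [tsum_mul_left]; ring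
      _ ≤ 1 / 2 * dist w z * 1 := by rw [hexp]; gcongr
      _ = _ := by push_cast; ring
  have hfix := hcontr.fixedPoint_isFixedPt
  set w := ContractingWith.fixedPoint Φ hcontr
  refine ⟨v w, u w, θ w, ?_⟩
  have e : (fun x t => F (ser (bc L) (θ w) x (max t 0))) = fun x t => F (Th w x t) := by
    ext x t
    congr 1
    have h1 := hΦ w x t
    rw [hfix.eq] at h1
    show _ = Real.exp (γ * max t 0) * w (x, t)
    rw [h1, ← mul_assoc, mul_comm (Real.exp _), hexp, one_mul]
  rw [e]
  exact hD w

/-- Uniqueness for the system of modes. -/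
lemma Driven.ser_eq {ε L : ℝ} (hε : 0 < ε) (hL : 0 < L) {A U H : ℕ → ℝ} (hA : DecS L 3 A)
    (hU : DecS L 1 U) (hH : Summable fun k => |H k|) {G₁ G₂ : ℝ → ℝ → ℝ}
    {v₁ u₁ θ₁ v₂ u₂ θ₂ : ℕ → ℝ → ℝ} (h₁ : Driven ε L A U H G₁ v₁ u₁ θ₁)
    (h₂ : Driven ε L A U H G₂ v₂ u₂ θ₂) {K T : ℝ} (hK : 0 ≤ K)
    (hG : ∀ x ∈ Icc (-L) L, ∀ t ∈ Icc 0 T,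
      |G₁ x t - G₂ x t| ≤ K * |ser (bc L) θ₁ x t - ser (bc L) θ₂ x t|)
    (x : ℝ) {t : ℝ} (ht : t ∈ Icc 0 T) : ser (bc L) θ₁ x t = ser (bc L) θ₂ x t := by
  obtain ⟨B₁, hB₁0, hB₁⟩ := exists_bound_of_continuous h₁.contG L T
  obtain ⟨B₂, hB₂0, hB₂⟩ := exists_bound_of_continuous h₂.contG L T
  obtain ⟨C, hC, hlip⟩ := Driven.exists_lipschitz hε hL hA hU H (max B₁ B₂)
  obtain ⟨γ, hγ, hsum⟩ := exists_weight hL (C * K)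
  have hsm := summable_inv_lam_sq_add hL hγ
  have hus₁ := h₁.us_theta hε hL hA hU hH T
  have hus₂ := h₂.us_theta hε hL hA hU hH T
  have hT : 0 ≤ T := ht.1.trans ht.2
  have hcont : ContinuousOn (fun p : ℝ × ℝ => Real.exp (-(γ * p.2))
      * |uncurry (ser (bc L) θ₁) p - uncurry (ser (bc L) θ₂) p|) (Icc (-L) L ×ˢ Icc 0 T) := by
    have hsub : Icc (-L) L ×ˢ Icc 0 T ⊆ univ ×ˢ Icc (0 : ℝ) T :=
      prod_mono (subset_univ _) subset_rfl
    refine ContinuousOn.mul (by fun_prop) (ContinuousOn.abs (ContinuousOn.sub ?_ ?_))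
    · exact (hus₁.continuousOn_ser (sys_bc L) fun k => (h₁.cont_θ k).continuousOn).mono hsub
    · exact (hus₂.continuousOn_ser (sys_bc L) fun k => (h₂.cont_θ k).continuousOn).mono hsub
  obtain ⟨⟨x₀, t₀⟩, hp, hmax⟩ := (isCompact_Icc.prod isCompact_Icc).exists_isMaxOn
    (⟨(0, 0), ⟨by constructor <;> linarith, by constructor <;> linarith⟩⟩ :
      (Icc (-L) L ×ˢ Icc (0 : ℝ) T).Nonempty) hcont
  set M := Real.exp (-(γ * t₀)) * |ser (bc L) θ₁ x₀ t₀ - ser (bc L) θ₂ x₀ t₀| with hM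
  have hM0 : 0 ≤ M := by positivity
  have hexp : ∀ t : ℝ, Real.exp (-(γ * t)) * Real.exp (γ * t) = 1 := fun t => by
    rw [← Real.exp_add]; simp
  have hGD : ∀ x ∈ Icc (-L) L, ∀ t ∈ Icc 0 T,
      |G₁ x t - G₂ x t| ≤ K * M * Real.exp (γ * t) := by
    intro y hy s hs
    have h1 : Real.exp (-(γ * s)) * |ser (bc L) θ₁ y s - ser (bc L) θ₂ y s| ≤ M :=
      hmax (show (y, s) ∈ Icc (-L) L ×ˢ Icc 0 T from ⟨hy, hs⟩)
    refine (hG y hy s hs).trans ?_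
    rw [mul_assoc]
    gcongr
    calc |ser (bc L) θ₁ y s - ser (bc L) θ₂ y s|
        = (Real.exp (-(γ * s)) * |ser (bc L) θ₁ y s - ser (bc L) θ₂ y s|) * Real.exp (γ * s) := by
          rw [mul_right_comm, hexp, one_mul]
      _ ≤ M * Real.exp (γ * s) := by gcongr
  have hdiff : ∀ y, ∀ s ∈ Icc 0 T,
      |ser (bc L) θ₁ y s - ser (bc L) θ₂ y s| ≤ 1 / 2 * M * Real.exp (γ * s) := by
    intro y s hs
    have h1 := hlip _ _ _ _ _ _ _ _ h₁ h₂ T (K * M) γ (by positivity) hγ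
      (fun x hx t ht => (hB₁ x hx t ht).trans (le_max_left _ _))
      (fun x hx t ht => (hB₂ x hx t ht).trans (le_max_right _ _)) hGD
    have e : ser (bc L) θ₁ y s - ser (bc L) θ₂ y s
        = ∑' k, (θ₁ k s - θ₂ k s) * bc L k y := by
      rw [ser, ser, ← (summable_mul_sys (abs_bc_le L) (hus₁.summable hs) y).tsum_sub
        (summable_mul_sys (abs_bc_le L) (hus₂.summable hs) y)]
      congr 1; ext k; ring
    have h2 : ∀ k, |θ₁ k s - θ₂ k s|
        ≤ C * K * M * Real.exp (γ * s) * (lam L k ^ 2 + γ)⁻¹ := fun k =>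
      (h1 k s hs).trans (le_of_eq (by rw [div_eq_mul_inv]; ring))
    have hs1 := hsm.mul_left (C * K * M * Real.exp (γ * s))
    have hs' : Summable fun k => |θ₁ k s - θ₂ k s| :=
      Summable.of_nonneg_of_le (fun _ => abs_nonneg _) h2 hs1
    rw [e]
    calc |∑' k, (θ₁ k s - θ₂ k s) * bc L k y|
        ≤ ∑' k, C * K * M * Real.exp (γ * s) * (lam L k ^ 2 + γ)⁻¹ :=
          (abs_tsum_sys_le (abs_bc_le L) hs' y).trans (hs'.tsum_le_tsum h2 hs1)
      _ = (C * K * ∑' k, (lam L k ^ 2 + γ)⁻¹) * M * Real.exp (γ * s) := by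
          rw [tsum_mul_left]; ring
      _ ≤ 1 / 2 * M * Real.exp (γ * s) := by gcongr
  have hM' : M = 0 := by
    have h1 := hdiff x₀ t₀ hp.2
    have h2 : M ≤ 1 / 2 * M := by
      calc M ≤ Real.exp (-(γ * t₀)) * (1 / 2 * M * Real.exp (γ * t₀)) := by
            rw [hM]; gcongr
        _ = 1 / 2 * M * (Real.exp (-(γ * t₀)) * Real.exp (γ * t₀)) := by ring
        _ = 1 / 2 * M := by rw [hexp, mul_one]
    linarith
  have h1 := hdiff x t ht
  rw [hM'] at h1
  simp only [mul_zero, zero_mul] at h1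
  exact sub_eq_zero.1 (abs_nonpos_iff.1 h1)

/-- Square summability of coefficients, uniform on `[0, T]`. -/
def Bes (c : ℕ → ℝ → ℝ) (T : ℝ) : Prop :=
  ∃ B : ℝ, ∀ N, ∀ t ∈ Icc 0 T, ∑ k ∈ Finset.range N, c k t ^ 2 ≤ B

namespace Bes

variable {L : ℝ} {c d : ℕ → ℝ → ℝ} {T : ℝ} {j : ℕ}

lemma congr (h : Bes c T) (hcd : ∀ k, ∀ t ∈ Icc 0 T, d k t ^ 2 = c k t ^ 2) : Bes d T := by
  obtain ⟨B, hB⟩ := h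
  refine ⟨B, fun N t ht => ?_⟩
  rw [Finset.sum_congr rfl fun k _ => hcd k t ht]
  exact hB N t ht

lemma sub (hc : Bes c T) (hd : Bes d T) : Bes (fun k t => c k t - d k t) T := by
  obtain ⟨B, hB⟩ := hc
  obtain ⟨B', hB'⟩ := hd
  refine ⟨2 * B + 2 * B', fun N t ht => ?_⟩
  calc ∑ k ∈ Finset.range N, (c k t - d k t) ^ 2
      ≤ ∑ k ∈ Finset.range N, (2 * c k t ^ 2 + 2 * d k t ^ 2) :=
        Finset.sum_le_sum fun k _ => by nlinarith [sq_nonneg (c k t + d k t)]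
    _ = 2 * ∑ k ∈ Finset.range N, c k t ^ 2 + 2 * ∑ k ∈ Finset.range N, d k t ^ 2 := by
        rw [Finset.sum_add_distrib, Finset.mul_sum, Finset.mul_sum]
    _ ≤ _ := by linarith [hB N t ht, hB' N t ht]

lemma dec (hL : 0 < L) (h : Bes (fun k t => lam L k ^ j * c k t) T) : Dec L j c T := by
  obtain ⟨B, hB⟩ := h
  refine ⟨√|B|, by positivity, fun k hk t ht => ?_⟩
  have h3 := lam_pos hL hk
  have h1 : (lam L k ^ j * c k t) ^ 2 ≤ B := (Finset.single_le_sum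
    (f := fun k => (lam L k ^ j * c k t) ^ 2) (fun _ _ => sq_nonneg _)
    (Finset.self_mem_range_succ k)).trans (hB (k + 1) t ht)
  rw [← abs_of_pos (by positivity : 0 < lam L k ^ j), ← abs_mul]
  exact Real.abs_le_sqrt (h1.trans (le_abs_self B))

lemma us (hL : 0 < L) (h : Bes (fun k t => lam L k ^ (j + 1) * c k t) T) :
    US (fun k t => lam L k ^ j * c k t) (Icc 0 T) := by
  obtain ⟨B, hB⟩ := h
  have hU1 : US (fun k (_ : ℝ) => (lam L k ^ 2)⁻¹) univ :=
    US.of_bound (summable_lam_inv_sq L) fun k _ t _ => by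
      rw [abs_of_nonneg (by positivity)]
  intro η hη
  obtain ⟨N, hN, hNb⟩ := hU1 ((η / (√|B| + 1)) ^ 2) (by positivity)
  refine ⟨N, hN, fun M t ht => ?_⟩
  have h1 : ∀ k ∈ Finset.Ico N M, |lam L k ^ j * c k t|
      = (lam L k)⁻¹ * |lam L k ^ (j + 1) * c k t| := by
    intro k hk
    have h3 := lam_pos hL (hN.trans (Finset.mem_Ico.1 hk).1)
    rw [pow_succ', mul_assoc, abs_mul (lam L k), abs_of_pos h3, inv_mul_cancel_left₀ h3.ne']
  rw [Finset.sum_congr rfl h1]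
  refine (Real.sum_mul_le_sqrt_mul_sqrt _ _ _).trans ?_
  have h2 : √(∑ k ∈ Finset.Ico N M, (lam L k)⁻¹ ^ 2) ≤ η / (√|B| + 1) := by
    refine Real.sqrt_le_iff.2 ⟨by positivity, le_trans ?_ (hNb M 0 (mem_univ _))⟩
    refine Finset.sum_le_sum fun k _ => ?_
    rw [inv_pow]; exact le_abs_self _
  have h4 : √(∑ k ∈ Finset.Ico N M, |lam L k ^ (j + 1) * c k t| ^ 2) ≤ √|B| := by
    refine Real.sqrt_le_sqrt (le_trans ?_ ((hB M t ht).trans (le_abs_self B)))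
    simp only [sq_abs]
    refine Finset.sum_le_sum_of_subset_of_nonneg ?_ fun _ _ _ => sq_nonneg _
    intro k hk
    exact Finset.mem_range.2 (Finset.mem_Ico.1 hk).2
  calc _ ≤ η / (√|B| + 1) * √|B| := by gcongr
    _ ≤ η := by
        rw [div_mul_eq_mul_div, div_le_iff₀ (by positivity)]
        nlinarith [Real.sqrt_nonneg |B|]

end Bes

lemma Dec.bes {L : ℝ} (hL : 0 < L) {q j : ℕ} {c : ℕ → ℝ → ℝ} {T : ℝ} (hc : Dec L q c T)
    (hj : 1 ≤ j) (hjq : j + 1 ≤ q) : Bes (fun k t => lam L k ^ j * c k t) T := by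
  obtain ⟨C, hC, h⟩ := hc.mono hL hjq
  refine ⟨C ^ 2 * ∑' k, (lam L k ^ 2)⁻¹, fun N t ht => ?_⟩
  calc ∑ k ∈ Finset.range N, (lam L k ^ j * c k t) ^ 2
      ≤ ∑ k ∈ Finset.range N, C ^ 2 * (lam L k ^ 2)⁻¹ := by
        refine Finset.sum_le_sum fun k _ => ?_
        rcases Nat.eq_zero_or_pos k with rfl | hk
        · rw [lam_zero, zero_pow (by omega), zero_mul]; simp
        · have h3 := lam_pos hL hk
          rw [← div_eq_mul_inv, le_div_iff₀ (by positivity)]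
          have h1 := pow_le_pow_left₀ (by positivity) (h k hk t ht) 2
          rw [mul_pow, sq_abs] at h1
          exact (le_of_eq (by ring)).trans h1
    _ ≤ _ := by
        rw [← Finset.mul_sum]
        gcongr
        exact (summable_lam_inv_sq L).sum_le_tsum _ fun _ _ => by positivity

section Coefficients

variable {L : ℝ} {g g' g'' : ℝ → ℝ → ℝ}

lemma bes_cc (hL : 0 < L) (hg : Continuous (uncurry g)) (T : ℝ) :
    Bes (fun k t => cc L (fun x => g x t) k) T := by
  obtain ⟨B, -, hB⟩ := exists_bound_of_continuous hg L T
  refine ⟨4 * B ^ 2, fun N t ht => le_trans ?_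
    (bessel hL (continuous_slice hg t) (fun x hx => hB x hx t ht) N)⟩
  exact Finset.sum_le_sum fun k _ => le_add_of_nonneg_right (sq_nonneg _)

lemma bes_sc (hL : 0 < L) (hg : Continuous (uncurry g)) (T : ℝ) :
    Bes (fun k t => sc L (fun x => g x t) k) T := by
  obtain ⟨B, -, hB⟩ := exists_bound_of_continuous hg L T
  refine ⟨4 * B ^ 2, fun N t ht => le_trans ?_
    (bessel hL (continuous_slice hg t) (fun x hx => hB x hx t ht) N)⟩
  exact Finset.sum_le_sum fun k _ => le_add_of_nonneg_left (sq_nonneg _)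

lemma bes_lam_cc (hL : 0 < L) (hd : ∀ t x, HasDerivAt (fun y => g y t) (g' x t) x)
    (hg' : Continuous (uncurry g')) (T : ℝ) :
    Bes (fun k t => lam L k ^ 1 * cc L (fun x => g x t) k) T := by
  refine (bes_sc hL hg' T).congr fun k t _ => ?_
  rw [pow_one, lam_mul_cc hL (hd t) (continuous_slice hg' t), neg_sq]

lemma lam_sq_mul_cc (hL : 0 < L) (hd : ∀ t x, HasDerivAt (fun y => g y t) (g' x t) x)
    (hd' : ∀ t x, HasDerivAt (fun y => g' y t) (g'' x t) x)
    (hg'' : Continuous (uncurry g'')) (hper : ∀ t, g' (-L) t = g' L t) (k : ℕ) (t : ℝ) :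
    lam L k ^ 2 * cc L (fun x => g x t) k = -cc L (fun x => g'' x t) k := by
  have hc : Continuous fun x => g' x t :=
    continuous_iff_continuousAt.2 fun x => (hd' t x).continuousAt
  rw [pow_two, mul_assoc, lam_mul_cc hL (hd t) hc, mul_neg,
    lam_mul_sc (hd' t) (continuous_slice hg'' t) (hper t)]

lemma bes_lam_sq_cc (hL : 0 < L) (hd : ∀ t x, HasDerivAt (fun y => g y t) (g' x t) x)
    (hd' : ∀ t x, HasDerivAt (fun y => g' y t) (g'' x t) x)
    (hg'' : Continuous (uncurry g'')) (hper : ∀ t, g' (-L) t = g' L t) (T : ℝ) :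
    Bes (fun k t => lam L k ^ 2 * cc L (fun x => g x t) k) T := by
  refine (bes_cc hL hg'' T).congr fun k t _ => ?_
  rw [lam_sq_mul_cc hL hd hd' hg'' hper, neg_sq]

end Coefficients

section Series

variable {L : ℝ} {c : ℕ → ℝ → ℝ} {I : Set ℝ}

lemma hasDerivAt_ser_bc (hL : 0 < L) (h : US (fun k t => lam L k * c k t) I) {t : ℝ} (ht : t ∈ I)
    (x : ℝ) : HasDerivAt (fun y => ser (bc L) c y t)
      (ser (bs L) (fun k s => -(lam L k * c k s)) x t) x :=
  hasDerivAt_tsum_bc hL (c := fun k => c k t) (h.summable ht) x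

lemma hasDerivAt_ser_bs (hL : 0 < L) (h : US (fun k t => lam L k * c k t) I) {t : ℝ} (ht : t ∈ I)
    (x : ℝ) : HasDerivAt (fun y => ser (bs L) c y t)
      (ser (bc L) (fun k s => lam L k * c k s) x t) x :=
  hasDerivAt_tsum_bs hL (c := fun k => c k t) (h.summable ht) x

lemma ser_bc_neg (L : ℝ) (c : ℕ → ℝ → ℝ) (x t : ℝ) : ser (bc L) c (-x) t = ser (bc L) c x t := by
  simp only [ser, bc_neg]

lemma ser_bs_neg (L : ℝ) (c : ℕ → ℝ → ℝ) (x t : ℝ) :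
    ser (bs L) c (-x) t = -ser (bs L) c x t := by
  simp only [ser, bs_neg, mul_neg, tsum_neg]

lemma ser_bs_L (hL : 0 < L) (c : ℕ → ℝ → ℝ) (t : ℝ) : ser (bs L) c L t = 0 := by
  simp [ser, bs_L hL]

lemma ser_bs_zero (L : ℝ) (c : ℕ → ℝ → ℝ) (t : ℝ) : ser (bs L) c 0 t = 0 := by
  simp [ser, bs_zero]

lemma mem_Icc_max (t : ℝ) : max t 0 ∈ Icc 0 (max t 0) := ⟨le_max_right _ _, le_rfl⟩

end Series

/-- A regular nonlinearity together with a solution of the system of modes and regular data. -/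
structure Setup (ε L : ℝ) (A U H : ℕ → ℝ) (F F' F'' : ℝ → ℝ) (v u θ : ℕ → ℝ → ℝ) : Prop where
  hε : 0 < ε
  hL : 0 < L
  dA : DecS L 7 A
  dU : DecS L 7 U
  dH : DecS L 6 H
  dF : ∀ s, HasDerivAt F (F' s) s
  dF' : ∀ s, HasDerivAt F' (F'' s) s
  cF'' : Continuous F''
  drv : Driven ε L A U H (fun x t => F (ser (bc L) θ x (max t 0))) v u θ

lemma DecS.mono {L : ℝ} {p q : ℕ} {c : ℕ → ℝ} (h : DecS L q c) (hL : 0 < L) (hpq : p ≤ q) :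
    DecS L p c :=
  ((h.dec 0).mono hL hpq).decS (t := 0) ⟨le_rfl, le_rfl⟩

lemma DecS.summable {L : ℝ} {q j : ℕ} {c : ℕ → ℝ} (h : DecS L q c) (hL : 0 < L) (hj : j + 2 ≤ q) :
    Summable fun k => |lam L k ^ j * c k| :=
  ((h.dec 0).us hL hj).summable (t := 0) ⟨le_rfl, le_rfl⟩

/-- The cosine coefficients of the stress. -/
def stress (L : ℝ) (F : ℝ → ℝ) (θ : ℕ → ℝ → ℝ) (k : ℕ) (t : ℝ) : ℝ :=
  cc L (fun x => F (ser (bc L) θ x (max t 0))) k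

/-- The cosine coefficients of the mechanical work. -/
def work (L : ℝ) (F : ℝ → ℝ) (v θ : ℕ → ℝ → ℝ) (k : ℕ) (t : ℝ) : ℝ :=
  cc L (fun x => F (ser (bc L) θ x (max t 0)) * VX L v x t) k

namespace Setup

variable {ε L : ℝ} {A U H : ℕ → ℝ} {F F' F'' : ℝ → ℝ} {v u θ : ℕ → ℝ → ℝ}

lemma hA (h : Setup ε L A U H F F' F'' v u θ) : DecS L 3 A := h.dA.mono h.hL (by norm_num)

lemma hU (h : Setup ε L A U H F F' F'' v u θ) : DecS L 1 U := h.dU.mono h.hL (by norm_num)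

lemma hH (h : Setup ε L A U H F F' F'' v u θ) : Summable fun k => |H k| :=
  (h.dH.summable h.hL (j := 0) (by norm_num)).congr fun k => by simp

lemma cont_F' (h : Setup ε L A U H F F' F'' v u θ) : Continuous F' :=
  continuous_iff_continuousAt.2 fun s => (h.dF' s).continuousAt

lemma us_theta (h : Setup ε L A U H F F' F'' v u θ) (T : ℝ) : US θ (Icc 0 T) :=
  h.drv.us_theta h.hε h.hL h.hA h.hU h.hH T

lemma cont_theta (h : Setup ε L A U H F F' F'' v u θ) :
    Continuous (uncurry fun x t => ser (bc L) θ x (max t 0)) :=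
  h.drv.continuous_theta h.hε h.hL h.hA h.hU h.hH

lemma cont_VX (h : Setup ε L A U H F F' F'' v u θ) : Continuous (uncurry (VX L v)) :=
  h.drv.continuous_VX h.hε h.hL h.hA h.hU

lemma cont_n (h : Setup ε L A U H F F' F'' v u θ) :
    Continuous (uncurry fun x t => F (ser (bc L) θ x (max t 0)) * VX L v x t) :=
  h.drv.contG.mul h.cont_VX

lemma us_lam_theta (h : Setup ε L A U H F F' F'' v u θ) (T : ℝ) :
    US (fun k t => lam L k * θ k t) (Icc 0 T) := by
  obtain ⟨B, hB⟩ := bes_cc h.hL h.cont_n T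
  refine (smoothing h.hL one_pos (m := 2) (by norm_num) h.drv.dθ
    (fun k => (continuous_cc h.cont_n k).neg) (B := B)
    (fun N t ht => by simpa only [neg_sq] using hB N t ht) ?_).congr fun k _ t _ => by simp
  simp only [h.drv.θ0]
  exact h.dH.summable h.hL (by norm_num)

lemma cont_theta_x (h : Setup ε L A U H F F' F'' v u θ) :
    Continuous (uncurry fun x t => ser (bs L) (fun k s => -(lam L k * θ k s)) x (max t 0)) :=
  continuous_ser_max (sys_bs L) (fun k => (continuous_const.mul (h.drv.cont_θ k)).neg) fun T =>
    ((h.us_lam_theta T).const_mul (-1)).congr fun k _ t _ => by ring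

/-- The spatial derivative of the stress. -/
lemma deriv_G (h : Setup ε L A U H F F' F'' v u θ) (t x : ℝ) :
    HasDerivAt (fun y => F (ser (bc L) θ y (max t 0))) (F' (ser (bc L) θ x (max t 0))
      * ser (bs L) (fun k s => -(lam L k * θ k s)) x (max t 0)) x :=
  (h.dF _).comp x (hasDerivAt_ser_bc h.hL (h.us_lam_theta _) (mem_Icc_max t) x)

lemma cont_G_x (h : Setup ε L A U H F F' F'' v u θ) :
    Continuous (uncurry fun x t => F' (ser (bc L) θ x (max t 0))
      * ser (bs L) (fun k s => -(lam L k * θ k s)) x (max t 0)) :=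
  (h.cont_F'.comp h.cont_theta).mul h.cont_theta_x

lemma dec_v_four (h : Setup ε L A U H F F' F'' v u θ) (T : ℝ) : Dec L 4 v T := by
  have hv := h.drv.dec_three h.hε h.hL h.hA h.hU T
  have hu : Dec L (3 + 2) u T :=
    Dec.ode h.hL h.hε h.drv.du hv (by simpa only [h.drv.u0] using h.dU.mono h.hL (by norm_num))
  have hF : Dec L (0 + 1) (stress L F θ) T := (bes_lam_cc h.hL h.deriv_G h.cont_G_x T).dec h.hL
  have h1 := (hF.lam_pow_mul h.hL).sub h.hL
    (Dec.lam_pow_mul (p := 0) (j := 2) h.hL (hu.mono h.hL (by norm_num)))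
  exact Dec.ode (p := 0) (m := 4) h.hL h.hε h.drv.dv
    (h1.congr fun k _ t _ => by simp only [pow_one, stress])
    (by simpa only [h.drv.v0] using h.dA.mono h.hL (by norm_num))

end Setup

namespace Setup

variable {ε L : ℝ} {A U H : ℕ → ℝ} {F F' F'' : ℝ → ℝ} {v u θ : ℕ → ℝ → ℝ}

lemma dv (h : Setup ε L A U H F F' F'' v u θ) (k : ℕ) (t : ℝ) : HasDerivAt (v k)
    (-(ε * lam L k ^ 4) * v k t + (lam L k * stress L F θ k t - lam L k ^ 2 * u k t)) t :=
  h.drv.dv k t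

lemma du (h : Setup ε L A U H F F' F'' v u θ) (k : ℕ) (t : ℝ) : HasDerivAt (u k)
    (-(ε * lam L k ^ 2) * u k t + v k t) t :=
  h.drv.du k t

lemma dθ (h : Setup ε L A U H F F' F'' v u θ) (k : ℕ) (t : ℝ) : HasDerivAt (θ k)
    (-(1 * lam L k ^ 2) * θ k t + -work L F v θ k t) t :=
  h.drv.dθ k t

lemma cont_stress (h : Setup ε L A U H F F' F'' v u θ) (k : ℕ) : Continuous (stress L F θ k) :=
  continuous_cc h.drv.contG k

lemma cont_work (h : Setup ε L A U H F F' F'' v u θ) (k : ℕ) : Continuous (work L F v θ k) :=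
  continuous_cc h.cont_n k

lemma cont_v (h : Setup ε L A U H F F' F'' v u θ) (k : ℕ) : Continuous (v k) :=
  continuous_iff_continuousAt.2 fun t => (h.dv k t).continuousAt

lemma cont_u (h : Setup ε L A U H F F' F'' v u θ) (k : ℕ) : Continuous (u k) :=
  continuous_iff_continuousAt.2 fun t => (h.du k t).continuousAt

lemma deriv_VX (h : Setup ε L A U H F F' F'' v u θ) (t x : ℝ) :
    HasDerivAt (fun y => VX L v y t)
      (ser (bs L) (fun k s => -(lam L k * (lam L k * v k s))) x (max t 0)) x :=
  hasDerivAt_ser_bc h.hL (((h.dec_v_four _).us h.hL (j := 2) (by norm_num)).congr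
    fun k _ s _ => by ring) (mem_Icc_max t) x

lemma cont_VXX (h : Setup ε L A U H F F' F'' v u θ) :
    Continuous (uncurry fun x t =>
      ser (bs L) (fun k s => -(lam L k * (lam L k * v k s))) x (max t 0)) :=
  continuous_ser_max (sys_bs L)
    (fun k => (continuous_const.mul (continuous_const.mul (h.cont_v k))).neg) fun T =>
    (((h.dec_v_four T).us h.hL (j := 2) (by norm_num)).const_mul (-1)).congr
      fun k _ t _ => by ring

/-- The spatial derivative of the mechanical work. -/
lemma deriv_n (h : Setup ε L A U H F F' F'' v u θ) (t x : ℝ) :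
    HasDerivAt (fun y => F (ser (bc L) θ y (max t 0)) * VX L v y t)
      (F' (ser (bc L) θ x (max t 0)) * ser (bs L) (fun k s => -(lam L k * θ k s)) x (max t 0)
          * VX L v x t
        + F (ser (bc L) θ x (max t 0))
          * ser (bs L) (fun k s => -(lam L k * (lam L k * v k s))) x (max t 0)) x :=
  (h.deriv_G t x).mul (h.deriv_VX t x)

lemma cont_n_x (h : Setup ε L A U H F F' F'' v u θ) :
    Continuous (uncurry fun x t =>
      F' (ser (bc L) θ x (max t 0)) * ser (bs L) (fun k s => -(lam L k * θ k s)) x (max t 0)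
          * VX L v x t
        + F (ser (bc L) θ x (max t 0))
          * ser (bs L) (fun k s => -(lam L k * (lam L k * v k s))) x (max t 0)) :=
  (h.cont_G_x.mul h.cont_VX).add (h.drv.contG.mul h.cont_VXX)

lemma bes_lam_work (h : Setup ε L A U H F F' F'' v u θ) (T : ℝ) :
    Bes (fun k t => lam L k ^ 1 * work L F v θ k t) T :=
  bes_lam_cc h.hL h.deriv_n h.cont_n_x T

lemma us_lam_sq_theta (h : Setup ε L A U H F F' F'' v u θ) (T : ℝ) :
    US (fun k t => lam L k ^ 2 * θ k t) (Icc 0 T) := by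
  obtain ⟨B, hB⟩ := h.bes_lam_work T
  have hy : ∀ k t, HasDerivAt (fun s => lam L k * θ k s)
      (-(1 * lam L k ^ 2) * (lam L k * θ k t) + -(lam L k ^ 1 * work L F v θ k t)) t := by
    intro k t
    exact ((h.dθ k t).const_mul (lam L k)).congr_deriv (by ring)
  refine (smoothing h.hL one_pos (m := 2) (by norm_num) hy
    (fun k => (continuous_const.mul (h.cont_work k)).neg) (B := B)
    (fun N t ht => by simpa only [neg_sq] using hB N t ht) ?_).congr fun k _ t _ => by ring
  simp only [h.drv.θ0]
  exact (h.dH.summable h.hL (j := 2) (by norm_num)).congr fun k => by ring_nf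

lemma deriv_theta_x (h : Setup ε L A U H F F' F'' v u θ) (t x : ℝ) :
    HasDerivAt (fun y => ser (bs L) (fun k s => -(lam L k * θ k s)) y (max t 0))
      (ser (bc L) (fun k s => lam L k * -(lam L k * θ k s)) x (max t 0)) x :=
  hasDerivAt_ser_bs h.hL (((h.us_lam_sq_theta _).const_mul (-1)).congr
    fun k _ s _ => by ring) (mem_Icc_max t) x

lemma cont_theta_xx (h : Setup ε L A U H F F' F'' v u θ) :
    Continuous (uncurry fun x t =>
      ser (bc L) (fun k s => lam L k * -(lam L k * θ k s)) x (max t 0)) :=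
  continuous_ser_max (sys_bc L)
    (fun k => continuous_const.mul (continuous_const.mul (h.drv.cont_θ k)).neg) fun T =>
    ((h.us_lam_sq_theta T).const_mul (-1)).congr fun k _ t _ => by ring

lemma deriv_G_x (h : Setup ε L A U H F F' F'' v u θ) (t x : ℝ) :
    HasDerivAt (fun y => F' (ser (bc L) θ y (max t 0))
      * ser (bs L) (fun k s => -(lam L k * θ k s)) y (max t 0))
      (F'' (ser (bc L) θ x (max t 0)) * ser (bs L) (fun k s => -(lam L k * θ k s)) x (max t 0)
          * ser (bs L) (fun k s => -(lam L k * θ k s)) x (max t 0)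
        + F' (ser (bc L) θ x (max t 0))
          * ser (bc L) (fun k s => lam L k * -(lam L k * θ k s)) x (max t 0)) x :=
  ((h.dF' _).comp x (hasDerivAt_ser_bc h.hL (h.us_lam_theta _) (mem_Icc_max t) x)).mul
    (h.deriv_theta_x t x)

lemma cont_G_xx (h : Setup ε L A U H F F' F'' v u θ) :
    Continuous (uncurry fun x t =>
      F'' (ser (bc L) θ x (max t 0)) * ser (bs L) (fun k s => -(lam L k * θ k s)) x (max t 0)
          * ser (bs L) (fun k s => -(lam L k * θ k s)) x (max t 0)
        + F' (ser (bc L) θ x (max t 0))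
          * ser (bc L) (fun k s => lam L k * -(lam L k * θ k s)) x (max t 0)) :=
  (((h.cF''.comp h.cont_theta).mul h.cont_theta_x).mul h.cont_theta_x).add
    ((h.cont_F'.comp h.cont_theta).mul h.cont_theta_xx)

lemma bes_lam_sq_stress (h : Setup ε L A U H F F' F'' v u θ) (T : ℝ) :
    Bes (fun k t => lam L k ^ 2 * stress L F θ k t) T :=
  bes_lam_sq_cc h.hL h.deriv_G h.deriv_G_x h.cont_G_xx
    (fun t => by rw [ser_bs_neg, ser_bs_L h.hL]; simp) T

lemma dec_u_six (h : Setup ε L A U H F F' F'' v u θ) (T : ℝ) : Dec L 6 u T :=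
  Dec.ode (p := 4) (m := 2) h.hL h.hε h.du (h.dec_v_four T)
    (by simpa only [h.drv.u0] using h.dU.mono h.hL (by norm_num))

lemma dec_stress (h : Setup ε L A U H F F' F'' v u θ) (T : ℝ) : Dec L 2 (stress L F θ) T :=
  (h.bes_lam_sq_stress T).dec h.hL

lemma dec_v (h : Setup ε L A U H F F' F'' v u θ) (T : ℝ) : Dec L 5 v T := by
  have h1 := (((h.dec_stress T).lam_pow_mul (p := 1) (j := 1) h.hL)).sub h.hL
    (Dec.lam_pow_mul (p := 1) (j := 2) h.hL ((h.dec_u_six T).mono h.hL (by norm_num)))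
  exact Dec.ode (p := 1) (m := 4) h.hL h.hε h.dv
    (h1.congr fun k _ t _ => by simp only [pow_one])
    (by simpa only [h.drv.v0] using h.dA.mono h.hL (by norm_num))

lemma dec_u (h : Setup ε L A U H F F' F'' v u θ) (T : ℝ) : Dec L 7 u T :=
  Dec.ode (p := 5) (m := 2) h.hL h.hε h.du (h.dec_v T) (by simpa only [h.drv.u0] using h.dU)

lemma deriv_VXX (h : Setup ε L A U H F F' F'' v u θ) (t x : ℝ) :
    HasDerivAt (fun y => ser (bs L) (fun k s => -(lam L k * (lam L k * v k s))) y (max t 0))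
      (ser (bc L) (fun k s => lam L k * -(lam L k * (lam L k * v k s))) x (max t 0)) x :=
  hasDerivAt_ser_bs h.hL ((((h.dec_v _).us h.hL (j := 3) (by norm_num)).const_mul (-1)).congr
    fun k _ s _ => by ring) (mem_Icc_max t) x

lemma cont_VXXX (h : Setup ε L A U H F F' F'' v u θ) :
    Continuous (uncurry fun x t =>
      ser (bc L) (fun k s => lam L k * -(lam L k * (lam L k * v k s))) x (max t 0)) :=
  continuous_ser_max (sys_bc L)
    (fun k => continuous_const.mul (continuous_const.mul
      (continuous_const.mul (h.cont_v k))).neg) fun T =>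
    (((h.dec_v T).us h.hL (j := 3) (by norm_num)).const_mul (-1)).congr
      fun k _ t _ => by ring

lemma bes_lam_sq_work (h : Setup ε L A U H F F' F'' v u θ) (T : ℝ) :
    Bes (fun k t => lam L k ^ 2 * work L F v θ k t) T :=
  bes_lam_sq_cc h.hL h.deriv_n
    (fun t x => ((h.deriv_G_x t x).mul (h.deriv_VX t x)).add
      ((h.deriv_G t x).mul (h.deriv_VXX t x)))
    (((h.cont_G_xx.mul h.cont_VX).add (h.cont_G_x.mul h.cont_VXX)).add
      ((h.cont_G_x.mul h.cont_VXX).add (h.drv.contG.mul h.cont_VXXX)))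
    (fun t => by simp only [ser_bs_neg, ser_bs_L h.hL]; simp) T

lemma us_lam_cube_theta (h : Setup ε L A U H F F' F'' v u θ) (T : ℝ) :
    US (fun k t => lam L k ^ 3 * θ k t) (Icc 0 T) := by
  obtain ⟨B, hB⟩ := h.bes_lam_sq_work T
  have hy : ∀ k t, HasDerivAt (fun s => lam L k ^ 2 * θ k s)
      (-(1 * lam L k ^ 2) * (lam L k ^ 2 * θ k t) + -(lam L k ^ 2 * work L F v θ k t)) t := by
    intro k t
    exact ((h.dθ k t).const_mul (lam L k ^ 2)).congr_deriv (by ring)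
  refine (smoothing h.hL one_pos (m := 2) (by norm_num) hy
    (fun k => (continuous_const.mul (h.cont_work k)).neg) (B := B)
    (fun N t ht => by simpa only [neg_sq] using hB N t ht) ?_).congr fun k _ t _ => by ring
  simp only [h.drv.θ0]
  exact (h.dH.summable h.hL (j := 3) (by norm_num)).congr fun k => by ring_nf

lemma us_lam_work (h : Setup ε L A U H F F' F'' v u θ) (T : ℝ) :
    US (fun k t => lam L k ^ 1 * work L F v θ k t) (Icc 0 T) :=
  (h.bes_lam_sq_work T).us h.hL

lemma us_lam_stress (h : Setup ε L A U H F F' F'' v u θ) (T : ℝ) :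
    US (fun k t => lam L k ^ 1 * stress L F θ k t) (Icc 0 T) :=
  (h.bes_lam_sq_stress T).us h.hL

lemma us_lam_four_v (h : Setup ε L A U H F F' F'' v u θ) (T : ℝ) :
    US (fun k t => lam L k ^ 4 * v k t) (Icc 0 T) := by
  obtain ⟨B, hB⟩ := (h.bes_lam_sq_stress T).sub
    ((h.dec_u T).bes h.hL (j := 3) (by norm_num) (by norm_num))
  have hy : ∀ k t, HasDerivAt (fun s => lam L k * v k s)
      (-(ε * lam L k ^ 4) * (lam L k * v k t)
        + (lam L k ^ 2 * stress L F θ k t - lam L k ^ 3 * u k t)) t := by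
    intro k t
    exact ((h.dv k t).const_mul (lam L k)).congr_deriv (by ring)
  refine (smoothing h.hL h.hε (m := 4) (by norm_num) hy
    (fun k => (continuous_const.mul (h.cont_stress k)).sub (continuous_const.mul (h.cont_u k)))
    hB ?_).congr fun k _ t _ => by ring
  simp only [h.drv.v0]
  exact (h.dA.summable h.hL (j := 4) (by norm_num)).congr fun k => by ring_nf

/-- Time derivatives of the coefficients. -/
lemma us_dot_v (h : Setup ε L A U H F F' F'' v u θ) (T : ℝ) :
    US (fun k t => -(ε * lam L k ^ 4) * v k t
      + (lam L k * stress L F θ k t - lam L k ^ 2 * u k t)) (Icc 0 T) :=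
  (((h.us_lam_four_v T).const_mul (-ε)).add ((h.us_lam_stress T).sub
    ((h.dec_u T).us h.hL (j := 2) (by norm_num)))).congr fun k _ t _ => by ring

lemma us_lam_sq_dot_u (h : Setup ε L A U H F F' F'' v u θ) (T : ℝ) :
    US (fun k t => lam L k ^ 2 * (-(ε * lam L k ^ 2) * u k t + v k t)) (Icc 0 T) :=
  ((((h.dec_u T).us h.hL (j := 4) (by norm_num)).const_mul (-ε)).add
    ((h.dec_v T).us h.hL (j := 2) (by norm_num))).congr fun k _ t _ => by ring

lemma us_lam_dot_theta (h : Setup ε L A U H F F' F'' v u θ) (T : ℝ) :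
    US (fun k t => lam L k * (-(1 * lam L k ^ 2) * θ k t + -work L F v θ k t)) (Icc 0 T) :=
  (((h.us_lam_cube_theta T).const_mul (-1)).sub (h.us_lam_work T)).congr
    fun k _ t _ => by ring

end Setup

section Algebra

variable {e : ℕ → ℝ → ℝ} {c d : ℕ → ℝ → ℝ} {t : ℝ}

lemma ser_neg (e : ℕ → ℝ → ℝ) (c : ℕ → ℝ → ℝ) (x t : ℝ) :
    ser e (fun k s => -c k s) x t = -ser e c x t := by
  simp only [ser, neg_mul, tsum_neg]

lemma ser_const_mul (e : ℕ → ℝ → ℝ) (a : ℝ) (c : ℕ → ℝ → ℝ) (x t : ℝ) :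
    ser e (fun k s => a * c k s) x t = a * ser e c x t := by
  simp only [ser, mul_assoc, tsum_mul_left]

lemma ser_add (he : Sys e) (hc : Summable fun k => |c k t|) (hd : Summable fun k => |d k t|)
    (x : ℝ) : ser e (fun k s => c k s + d k s) x t = ser e c x t + ser e d x t := by
  simp only [ser, add_mul]
  exact (summable_mul_sys he.bdd hc x).tsum_add (summable_mul_sys he.bdd hd x)

lemma ser_congr {c d : ℕ → ℝ → ℝ} {t : ℝ} (h : ∀ k, c k t = d k t) (x : ℝ) :
    ser e c x t = ser e d x t := by
  simp only [ser, h]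

end Algebra

namespace Setup

variable {ε L : ℝ} {A U H : ℕ → ℝ} {F F' F'' : ℝ → ℝ} {v u θ : ℕ → ℝ → ℝ}

lemma stress_expansion (h : Setup ε L A U H F F' F'' v u θ) {x : ℝ} (hx : x ∈ Icc (-L) L) {t : ℝ}
    (ht : 0 ≤ t) : F (ser (bc L) θ x t) = ser (bc L) (stress L F θ) x t := by
  have h0 : ∀ k, sc L (fun x => F (ser (bc L) θ x (max t 0))) k = 0 :=
    fun k => sc_of_even L (fun x => by rw [ser_bc_neg]) k
  have h1 := fourier_expansion h.hL (g := fun x => F (ser (bc L) θ x (max t 0)))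
    (continuous_slice h.drv.contG t) (by simp only [ser_bc_neg])
    (((h.dec_stress (max t 0)).us' h.hL le_rfl).summable (t := t) ⟨ht, le_max_left _ _⟩)
    (by simp [h0]) hx
  simp only [h0, zero_mul, tsum_zero, add_zero] at h1
  rw [max_eq_left ht] at h1
  rw [h1]
  simp only [ser, stress, max_eq_left ht]

lemma work_expansion (h : Setup ε L A U H F F' F'' v u θ) {x : ℝ} (hx : x ∈ Icc (-L) L) {t : ℝ}
    (ht : 0 ≤ t) : F (ser (bc L) θ x t) * ser (bc L) (fun k s => lam L k * v k s) x t
      = ser (bc L) (work L F v θ) x t := by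
  have h0 : ∀ k, sc L (fun x => F (ser (bc L) θ x (max t 0)) * VX L v x t) k = 0 :=
    fun k => sc_of_even L (fun x => by rw [VX, VX, ser_bc_neg, ser_bc_neg]) k
  have h1 := fourier_expansion h.hL (g := fun x => F (ser (bc L) θ x (max t 0)) * VX L v x t)
    (continuous_slice h.cont_n t) (by simp only [VX, ser_bc_neg])
    ((((h.bes_lam_work (max t 0)).us (j := 0) h.hL).summable (t := t)
      ⟨ht, le_max_left _ _⟩).congr fun k => by rw [pow_zero, one_mul]; rfl)
    (by simp [h0]) hx
  simp only [h0, zero_mul, tsum_zero, add_zero] at h1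
  simp only [VX, max_eq_left ht] at h1
  rw [h1]
  simp only [ser, work, VX, max_eq_left ht]

lemma eq_v (h : Setup ε L A U H F F' F'' v u θ) {x : ℝ} (hx : x ∈ Ioo (-L) L) {t : ℝ}
    (ht : 0 ≤ t) :
    ser (bs L) (fun k t => -(ε * lam L k ^ 4) * v k t
      + (lam L k * stress L F θ k t - lam L k ^ 2 * u k t)) x t
    = -ε * ser (bs L) (fun k t => lam L k ^ 4 * v k t) x t
      - ser (bs L) (fun k t => lam L k ^ 2 * u k t) x t
      - deriv (fun y => F (ser (bc L) θ y t)) x := by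
  have htT : t ∈ Icc 0 t := ⟨ht, le_rfl⟩
  have hS := (h.us_lam_stress t).summable htT
  have hd : HasDerivAt (fun y => F (ser (bc L) θ y t))
      (ser (bs L) (fun k s => -(lam L k * stress L F θ k s)) x t) x := by
    refine (hasDerivAt_ser_bc h.hL ((h.us_lam_stress t).congr
      fun k _ s _ => by rw [pow_one]) htT x).congr_of_eventuallyEq ?_
    filter_upwards [isOpen_Ioo.mem_nhds hx] with y hy
    exact h.stress_expansion (Ioo_subset_Icc_self hy) ht
  have h2 := ((h.dec_u t).us h.hL (j := 2) (by norm_num)).summable htT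
  have h4 := (h.us_lam_four_v t).summable htT
  rw [hd.deriv, ser_neg, ser_congr (d := fun k t => -ε * (lam L k ^ 4 * v k t)
    + (lam L k ^ 1 * stress L F θ k t + -1 * (lam L k ^ 2 * u k t))) (fun k => by ring),
    ser_add (sys_bs L) (c := fun k t => -ε * (lam L k ^ 4 * v k t))
      (d := fun k t => lam L k ^ 1 * stress L F θ k t + -1 * (lam L k ^ 2 * u k t))
      (by simpa [abs_mul] using h4.mul_left |ε|)
      (Summable.of_nonneg_of_le (fun _ => abs_nonneg _) (fun k => abs_add_le _ _)
        (hS.add (by simpa using h2))),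
    ser_add (sys_bs L) (c := fun k t => lam L k ^ 1 * stress L F θ k t)
      (d := fun k t => -1 * (lam L k ^ 2 * u k t)) hS (by simpa using h2),
      ser_const_mul, ser_const_mul]
  simp only [pow_one]
  ring

lemma eq_u (h : Setup ε L A U H F F' F'' v u θ) (x : ℝ) {t : ℝ} (ht : 0 ≤ t) :
    ser (bs L) (fun k t => -(ε * lam L k ^ 2) * u k t + v k t) x t
    = -ε * ser (bs L) (fun k t => lam L k ^ 2 * u k t) x t + ser (bs L) v x t := by
  have htT : t ∈ Icc 0 t := ⟨ht, le_rfl⟩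
  have h2 := ((h.dec_u t).us h.hL (j := 2) (by norm_num)).summable htT
  have hv := ((h.dec_v t).us' h.hL (by norm_num)).summable htT
  rw [ser_congr (d := fun k t => -ε * (lam L k ^ 2 * u k t) + v k t) (fun k => by ring),
    ser_add (sys_bs L) (c := fun k t => -ε * (lam L k ^ 2 * u k t)) (d := v)
      (by simpa [abs_mul] using h2.mul_left |ε|) hv, ser_const_mul]

lemma eq_theta (h : Setup ε L A U H F F' F'' v u θ) {x : ℝ} (hx : x ∈ Icc (-L) L) {t : ℝ}
    (ht : 0 ≤ t) :
    ser (bc L) (fun k t => -(1 * lam L k ^ 2) * θ k t + -work L F v θ k t) x t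
    = -ser (bc L) (fun k t => lam L k ^ 2 * θ k t) x t
      - F (ser (bc L) θ x t) * ser (bc L) (fun k s => lam L k * v k s) x t := by
  have htT : t ∈ Icc 0 t := ⟨ht, le_rfl⟩
  have h2 := (h.us_lam_sq_theta t).summable htT
  have hw : Summable fun k => |work L F v θ k t| :=
    (((h.bes_lam_work t).us (j := 0) h.hL).summable htT).congr fun k => by simp
  rw [h.work_expansion hx ht,
    ser_congr (d := fun k t => -1 * (lam L k ^ 2 * θ k t) + -1 * work L F v θ k t)
      (fun k => by ring),
    ser_add (sys_bc L) (c := fun k t => -1 * (lam L k ^ 2 * θ k t))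
      (d := fun k t => -1 * work L F v θ k t) (by simpa using h2) (by simpa using hw),
      ser_const_mul, ser_const_mul]
  ring

end Setup

open scoped FourierTransform in
/-- A kernel with Fourier multiplier `exp (-ξ ^ 4)`. -/
lemma exists_biharmonic_kernel : ∃ K : ℝ → ℝ, Integrable K ∧
    (∀ ξ, ∫ y, K y * Real.cos (2 * Real.pi * y * ξ) = Real.exp (-ξ ^ 4)) ∧
    ∀ ξ, ∫ y, K y * Real.sin (2 * Real.pi * y * ξ) = 0 := by
  have hexp : ∀ x : ℝ, Real.exp (-x ^ 4) * (1 + x ^ 2) * (1 + x ^ 6) ≤ 8 := by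
    intro x
    have h1 := Real.quadratic_le_exp_of_nonneg (by positivity : 0 ≤ x ^ 4)
    rw [show -x ^ 4 = -(x ^ 4) by ring, Real.exp_neg, mul_assoc, inv_mul_le_iff₀ (Real.exp_pos _)]
    have h2 : x ^ 2 ≤ 1 + x ^ 4 := by nlinarith [sq_nonneg (x ^ 2 - 1)]
    have h3 : x ^ 6 ≤ 1 + x ^ 8 := by
      nlinarith [sq_nonneg (x ^ 2), sq_nonneg (x ^ 4 - x ^ 2), sq_nonneg (x ^ 4 - 1),
        sq_nonneg (x ^ 2 - 1)]
    nlinarith [sq_nonneg (x ^ 2), sq_nonneg (x ^ 4)]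
  have hint : ∀ g : ℝ → ℂ, Continuous g → (∃ C : ℝ, ∀ x, ‖g x‖ ≤ C * (1 + x ^ 2)⁻¹) →
      Integrable g := fun g hg ⟨C, hC⟩ =>
    (integrable_inv_one_add_sq.const_mul C).mono' hg.aestronglyMeasurable (.of_forall hC)
  set ψ : ℝ → ℂ := fun x => (Real.exp (-x ^ 4) : ℝ) with hψ
  set ψ₁ : ℝ → ℂ := fun x => (-(4 * x ^ 3) * Real.exp (-x ^ 4) : ℝ) with hψ₁
  set ψ₂ : ℝ → ℂ := fun x => ((16 * x ^ 6 - 12 * x ^ 2) * Real.exp (-x ^ 4) : ℝ) with hψ₂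
  have d0 : ∀ x : ℝ, HasDerivAt (fun x : ℝ => Real.exp (-x ^ 4))
      (-(4 * x ^ 3) * Real.exp (-x ^ 4)) x := fun x =>
    ((hasDerivAt_pow 4 x).neg.exp).congr_deriv (by simp only [Pi.neg_apply]; push_cast; ring)
  have d1 : ∀ x : ℝ, HasDerivAt (fun x : ℝ => -(4 * x ^ 3) * Real.exp (-x ^ 4))
      ((16 * x ^ 6 - 12 * x ^ 2) * Real.exp (-x ^ 4)) x := fun x =>
    (((hasDerivAt_pow 3 x).const_mul 4).neg.mul (d0 x)).congr_deriv
      (by simp only [Pi.neg_apply]; push_cast; ring)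
  have D0 : deriv ψ = ψ₁ := funext fun x => (d0 x).ofReal_comp.deriv
  have D1 : deriv ψ₁ = ψ₂ := funext fun x => (d1 x).ofReal_comp.deriv
  have i0 : Integrable ψ := hint ψ (by fun_prop) ⟨8, fun x => by
    rw [hψ, Complex.norm_real, Real.norm_eq_abs, abs_of_pos (Real.exp_pos _),
      ← div_eq_mul_inv, le_div_iff₀ (by positivity)]
    refine le_trans ?_ (hexp x)
    exact le_mul_of_one_le_right (by positivity) (by nlinarith [sq_nonneg (x ^ 3)])⟩
  have i1 : Integrable ψ₁ := hint ψ₁ (by fun_prop) ⟨32, fun x => by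
    rw [hψ₁, Complex.norm_real, Real.norm_eq_abs, abs_mul, abs_of_pos (Real.exp_pos _),
      ← div_eq_mul_inv, le_div_iff₀ (by positivity)]
    have h2 : |-(4 * x ^ 3)| ≤ 4 * (1 + x ^ 6) := by
      rw [abs_le]; constructor <;> nlinarith [sq_nonneg (x ^ 3 - 1), sq_nonneg (x ^ 3 + 1)]
    calc _ ≤ 4 * (1 + x ^ 6) * Real.exp (-x ^ 4) * (1 + x ^ 2) := by gcongr
      _ ≤ _ := by linarith [hexp x]⟩
  have i2 : Integrable ψ₂ := hint ψ₂ (by fun_prop) ⟨8 * 28, fun x => by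
    rw [hψ₂, Complex.norm_real, Real.norm_eq_abs, abs_mul, abs_of_pos (Real.exp_pos _),
      ← div_eq_mul_inv, le_div_iff₀ (by positivity)]
    have h4 : x ^ 2 ≤ 1 + x ^ 6 := by
      rcases le_total (x ^ 2) 1 with h | h
      · nlinarith [sq_nonneg (x ^ 3)]
      · nlinarith [mul_le_mul h h zero_le_one (by positivity), sq_nonneg (x ^ 2),
          mul_nonneg (sq_nonneg x) (sub_nonneg.2 (one_le_pow₀ (n := 2) h))]
    have h2 : |16 * x ^ 6 - 12 * x ^ 2| ≤ 28 * (1 + x ^ 6) := by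
      rw [abs_le]; constructor <;> nlinarith [sq_nonneg (x ^ 3), sq_nonneg x]
    calc _ ≤ 28 * (1 + x ^ 6) * Real.exp (-x ^ 4) * (1 + x ^ 2) := by gcongr
      _ ≤ _ := by linarith [hexp x]⟩
  set φ : ℝ → ℂ := 𝓕 ψ with hφ
  set φ₂ : ℝ → ℂ := 𝓕 ψ₂ with hφ₂
  have F1 := Real.fourier_deriv i0 (fun x => (d0 x).ofReal_comp.differentiableAt) (D0 ▸ i1)
  have F2 := Real.fourier_deriv i1 (fun x => (d1 x).ofReal_comp.differentiableAt) (D1 ▸ i2)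
  rw [D0] at F1
  rw [D1] at F2
  have hb : ∀ (g : ℝ → ℂ) (y : ℝ), ‖(𝓕 g : ℝ → ℂ) y‖ ≤ ∫ x, ‖g x‖ := fun g y =>
    VectorFourier.norm_fourierIntegral_le_integral_norm Real.fourierChar volume _ g y
  have hcont : Continuous φ :=
    VectorFourier.fourierIntegral_continuous Real.continuous_fourierChar
      (by exact continuous_inner) i0
  have iF : Integrable φ := hint _ hcont ⟨(∫ x, ‖ψ x‖) + ∫ x, ‖ψ₂ x‖, fun y => by
    rw [← div_eq_mul_inv, le_div_iff₀ (by positivity), mul_add, mul_one]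
    refine add_le_add (hb ψ y) (le_trans (b := ‖φ₂ y‖) ?_ (hb ψ₂ y))
    have : φ₂ y = (2 * Real.pi * Complex.I * y) * ((2 * Real.pi * Complex.I * y) * φ y) := by
      simp only [hφ₂, F2, hφ, F1, smul_eq_mul]
    rw [this, norm_mul, norm_mul]
    simp only [norm_mul, Complex.norm_real, Complex.norm_I, mul_one, Complex.norm_ofNat,
      Real.norm_eq_abs, abs_of_pos Real.pi_pos]
    have h1 : (1 : ℝ) ≤ 2 * Real.pi := by linarith [Real.pi_gt_three]
    have h2 : 0 ≤ ‖φ y‖ * y ^ 2 := by positivity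
    calc _ = 1 * 1 * (‖φ y‖ * y ^ 2) := by ring
      _ ≤ (2 * Real.pi) * (2 * Real.pi) * (‖φ y‖ * y ^ 2) := by gcongr
      _ = _ := by rw [← sq_abs]; ring⟩
  have hinv := Continuous.fourierInv_fourier_eq (by fun_prop : Continuous ψ) i0 iF
  have hI : ∀ ξ : ℝ, ∫ y : ℝ, Complex.exp (2 * Real.pi * y * ξ * Complex.I) * φ y = ψ ξ := by
    intro ξ
    rw [← congrFun hinv ξ, Real.fourierInv_eq']
    refine integral_congr_ae (.of_forall fun y => ?_)
    simp only [smul_eq_mul, RCLike.inner_apply, conj_trivial, hφ]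
    push_cast
    ring_nf
  have hi : ∀ ξ : ℝ, Integrable fun y : ℝ =>
      Complex.exp (2 * Real.pi * y * ξ * Complex.I) * φ y := by
    intro ξ
    refine iF.mono (by fun_prop) (.of_forall fun y => ?_)
    rw [norm_mul, show (2 * Real.pi * y * ξ * Complex.I : ℂ)
      = ((2 * Real.pi * y * ξ : ℝ) : ℂ) * Complex.I by push_cast; ring,
      Complex.norm_exp_ofReal_mul_I, one_mul]
  have hc : ∀ ξ : ℝ, ∫ y : ℝ, φ y * (Real.cos (2 * Real.pi * y * ξ) : ℂ) = ψ ξ := by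
    intro ξ
    have h1 : ∀ y : ℝ, φ y * (Real.cos (2 * Real.pi * y * ξ) : ℂ)
        = (Complex.exp (2 * Real.pi * y * ξ * Complex.I) * φ y
          + Complex.exp (2 * Real.pi * y * (-ξ : ℝ) * Complex.I) * φ y) / 2 := by
      intro y
      rw [Complex.ofReal_cos, Complex.cos]
      push_cast
      ring_nf
    rw [integral_congr_ae (.of_forall h1), integral_div, integral_add (hi _) (hi _), hI, hI]
    simp only [hψ]
    rw [show (-ξ) ^ 4 = ξ ^ 4 by ring]
    ring
  have hs : ∀ ξ : ℝ, ∫ y : ℝ, φ y * (Real.sin (2 * Real.pi * y * ξ) : ℂ) = 0 := by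
    intro ξ
    have h1 : ∀ y : ℝ, φ y * (Real.sin (2 * Real.pi * y * ξ) : ℂ)
        = (Complex.exp (2 * Real.pi * y * (-ξ : ℝ) * Complex.I) * φ y
          - Complex.exp (2 * Real.pi * y * ξ * Complex.I) * φ y) * (Complex.I / 2) := by
      intro y
      rw [Complex.ofReal_sin, Complex.sin]
      push_cast
      ring_nf
    rw [integral_congr_ae (.of_forall h1), integral_mul_const, integral_sub (hi _) (hi _), hI, hI]
    simp only [hψ]
    rw [show (-ξ) ^ 4 = ξ ^ 4 by ring]
    ring
  have hre : ∀ w : ℝ → ℝ, Continuous w → (∀ y, |w y| ≤ 1) →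
      ∫ y, (φ y).re * w y = (∫ y, φ y * (w y : ℂ)).re := by
    intro w hw hw1
    have : Integrable fun y => φ y * (w y : ℂ) := by
      refine iF.mono (hcont.mul (Complex.continuous_ofReal.comp hw)).aestronglyMeasurable
        (.of_forall fun y => ?_)
      rw [norm_mul, Complex.norm_real]
      exact mul_le_of_le_one_right (norm_nonneg _) (hw1 y)
    rw [← Complex.reCLM_apply, ← ContinuousLinearMap.integral_comp_comm _ this]
    simp
  refine ⟨fun y => (φ y).re, iF.re, fun ξ => ?_, fun ξ => ?_⟩
  · rw [hre _ (by fun_prop) fun y => Real.abs_cos_le_one _, hc, hψ, Complex.ofReal_re]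
  · rw [hre _ (by fun_prop) fun y => Real.abs_sin_le_one _, hs, Complex.zero_re]

/-- The biharmonic heat semigroup does not increase Lipschitz constants by more than a fixed
factor. -/
lemma exists_semigroup_bound : ∃ C : ℝ, 0 ≤ C ∧ ∀ (L : ℝ) (_ : 0 < L) (c : ℕ → ℝ)
    (_ : Summable fun k => |c k|) (M : ℝ) (_ : 0 ≤ M)
    (_ : ∀ x y, |∑' k, c k * bs L k x - ∑' k, c k * bs L k y| ≤ M * |x - y|) (r : ℝ)
    (_ : Summable fun k => |lam L k * (Real.exp (-(lam L k * r) ^ 4) * c k)|) (x : ℝ),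
    |∑' k, lam L k * (Real.exp (-(lam L k * r) ^ 4) * c k) * bc L k x| ≤ C * M := by
  obtain ⟨K, hK, hcos, hsin⟩ := exists_biharmonic_kernel
  refine ⟨∫ y, |K y|, integral_nonneg fun y => abs_nonneg _,
    fun L hL c hc M hM hlip r hr x => ?_⟩
  have hKm : ∀ w : ℝ → ℝ, Continuous w → (∃ B, ∀ y, |w y| ≤ B) →
      Integrable fun y => K y * w y := by
    rintro w hw ⟨B, hB⟩
    exact (hK.mul_bdd (c := B) hw.aestronglyMeasurable (.of_forall hB))
  have hg : Continuous fun x => ∑' k, c k * bs L k x :=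
    continuous_tsum (fun k => continuous_const.mul (continuous_bs L k)) hc fun k x => by
      rw [Real.norm_eq_abs, abs_mul]
      exact mul_le_of_le_one_right (abs_nonneg _) (abs_bs_le L k x)
  have hgb : ∀ x, |∑' k, c k * bs L k x| ≤ ∑' k, |c k| := abs_tsum_sys_le (abs_bs_le L) hc
  have hrep : ∀ x, ∑' k, Real.exp (-(lam L k * r) ^ 4) * c k * bs L k x
      = ∫ y, K y * ∑' k, c k * bs L k (x + 2 * Real.pi * r * y) := by
    intro x
    have hint : ∀ k, Integrable fun y => K y * (c k * bs L k (x + 2 * Real.pi * r * y)) :=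
      fun k => hKm _ (continuous_const.mul ((continuous_bs L k).comp (by fun_prop)))
        ⟨|c k|, fun y => by
          rw [abs_mul]; exact mul_le_of_le_one_right (abs_nonneg _) (abs_bs_le L k _)⟩
    have hle : ∀ k, ∫ y, ‖K y * (c k * bs L k (x + 2 * Real.pi * r * y))‖
        ≤ |c k| * ∫ y, |K y| := by
      intro k
      rw [← integral_const_mul]
      refine integral_mono (hint k).norm (hK.norm.const_mul _) fun y => ?_
      simp only [Real.norm_eq_abs, abs_mul]
      calc _ ≤ |K y| * (|c k| * 1) := by
            gcongr; exact abs_bs_le L k _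
        _ = _ := by ring
    have hsum := hasSum_integral_of_summable_integral_norm hint
      (Summable.of_nonneg_of_le (fun k => integral_nonneg fun y => norm_nonneg _) hle
        (hc.mul_right _))
    simp only [tsum_mul_left] at hsum
    rw [← hsum.tsum_eq]
    refine tsum_congr fun k => ?_
    have h1 : ∀ y, K y * (c k * bs L k (x + 2 * Real.pi * r * y))
        = c k * bs L k x * (K y * Real.cos (2 * Real.pi * y * (lam L k * r)))
          + c k * bc L k x * (K y * Real.sin (2 * Real.pi * y * (lam L k * r))) := by
      intro y
      unfold bs bc
      rw [show lam L k * (x + 2 * Real.pi * r * y)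
        = lam L k * x + 2 * Real.pi * y * (lam L k * r) by ring, Real.sin_add]
      ring
    rw [integral_congr_ae (.of_forall h1), integral_add, integral_const_mul, integral_const_mul,
      hcos, hsin]
    · ring
    · exact (hKm _ (by fun_prop) ⟨1, fun y => Real.abs_cos_le_one _⟩).const_mul _
    · exact (hKm _ (by fun_prop) ⟨1, fun y => Real.abs_sin_le_one _⟩).const_mul _
  have hder := hasDerivAt_tsum_bs hL hr x
  rw [← hder.deriv, ← Real.norm_eq_abs]
  refine norm_deriv_le_of_lip' (by positivity) (.of_forall fun z => ?_)
  have hi : ∀ x, Integrable fun y => K y * ∑' k, c k * bs L k (x + 2 * Real.pi * r * y) :=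
    fun x => hKm _ (hg.comp (by fun_prop : Continuous fun y => x + 2 * Real.pi * r * y))
      ⟨_, fun y => hgb _⟩
  rw [hrep, hrep, ← integral_sub (hi z) (hi x),
    show (∫ y, |K y|) * M * ‖z - x‖ = M * ‖z - x‖ * ∫ y, ‖K y‖ by
      simp only [Real.norm_eq_abs]; ring, ← integral_const_mul]
  refine norm_integral_le_of_norm_le (G := ℝ) (hK.norm.const_mul (M * ‖z - x‖))
    (.of_forall fun y => ?_)
  rw [← mul_sub, norm_mul, mul_comm, Real.norm_eq_abs, Real.norm_eq_abs]
  refine mul_le_mul_of_nonneg_right ?_ (abs_nonneg _)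
  simpa using hlip (z + 2 * Real.pi * r * y) (x + 2 * Real.pi * r * y)

section Extension

variable {L : ℝ} {e : ℕ → ℝ → ℝ} {c d : ℕ → ℝ → ℝ}

/-- Extension of coefficients to negative times by point reflection at `t = 0`. -/
def extT (c : ℕ → ℝ → ℝ) (k : ℕ) (t : ℝ) : ℝ := if 0 ≤ t then c k t else 2 * c k 0 - c k (-t)

lemma extT_of_nonneg (c : ℕ → ℝ → ℝ) (k : ℕ) {t : ℝ} (ht : 0 ≤ t) : extT c k t = c k t :=
  if_pos ht

lemma hasDerivAt_extT (h : ∀ k t, HasDerivAt (c k) (d k t) t) (k : ℕ) (t : ℝ) :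
    HasDerivAt (extT c k) (d k |t|) t := by
  have h1 : ∀ t, HasDerivAt (fun s => 2 * c k 0 - c k (-s)) (d k (-t)) t := fun t =>
    (((h k (-t)).comp t (hasDerivAt_neg t)).const_sub (2 * c k 0)).congr_deriv (by ring)
  rcases lt_trichotomy t 0 with ht | rfl | ht
  · rw [abs_of_neg ht]
    refine (h1 t).congr_of_eventuallyEq ?_
    filter_upwards [gt_mem_nhds ht] with s hs
    exact if_neg (not_le.2 hs)
  · rw [abs_zero]
    have h2 : HasDerivWithinAt (extT c k) (d k 0) (Iic 0) 0 := by
      have := (h1 0).hasDerivWithinAt (s := Iic 0)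
      rw [neg_zero] at this
      refine this.congr (fun s hs => ?_) (by rw [extT_of_nonneg c k le_rfl, neg_zero]; ring)
      rcases eq_or_lt_of_le (mem_Iic.1 hs) with rfl | hs
      · rw [extT_of_nonneg c k le_rfl, neg_zero]; ring
      · exact if_neg (not_le.2 hs)
    have h3 : HasDerivWithinAt (extT c k) (d k 0) (Ici 0) 0 :=
      (h k 0).hasDerivWithinAt.congr (fun s hs => extT_of_nonneg c k hs)
        (extT_of_nonneg c k le_rfl)
    have := h2.union h3
    rwa [Iic_union_Ici, hasDerivWithinAt_univ] at this
  · rw [abs_of_pos ht]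
    refine (h k t).congr_of_eventuallyEq ?_
    filter_upwards [lt_mem_nhds ht] with s hs
    exact extT_of_nonneg c k hs.le

lemma summable_extT (h : ∀ T, US c (Icc 0 T)) (t : ℝ) : Summable fun k => |extT c k t| := by
  have h1 := (h |t|).summable (t := |t|) ⟨abs_nonneg t, le_rfl⟩
  have h2 := (h |t|).summable (t := 0) ⟨le_rfl, abs_nonneg t⟩
  refine Summable.of_nonneg_of_le (fun _ => abs_nonneg _) (fun k => ?_) ((h2.mul_left 2).add h1)
  unfold extT
  split_ifs with ht
  · rw [abs_of_nonneg ht]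
    linarith [abs_nonneg (c k 0)]
  · rw [abs_of_neg (not_le.1 ht)]
    exact (abs_sub _ _).trans (by rw [abs_mul, abs_two])

lemma hasDerivAt_ser_extT (he : Sys e) (h : ∀ k t, HasDerivAt (c k) (d k t) t)
    (hc : ∀ T, US c (Icc 0 T)) (hd : ∀ T, US d (Icc 0 T)) (x t : ℝ) :
    HasDerivAt (fun s => ser e (extT c) x s) (ser e d x |t|) t := by
  have hd' : US (fun k s => d k |s|) (Ioo (-(|t| + 1)) (|t| + 1)) := by
    intro η hη
    obtain ⟨N, hN, hb⟩ := hd (|t| + 1) η hη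
    exact ⟨N, hN, fun M s hs => hb M |s| ⟨abs_nonneg s, (abs_lt.2 hs).le⟩⟩
  exact hd'.hasDerivAt_time isOpen_Ioo he.bdd (fun s _ => summable_extT hc s)
    (fun k s _ => hasDerivAt_extT h k s) x (abs_lt.1 (by linarith))

lemma ser_extT {t : ℝ} (ht : 0 ≤ t) (x : ℝ) : ser e (extT c) x t = ser e c x t :=
  ser_congr (fun k => extT_of_nonneg c k ht) x

lemma ser_bc_periodic (hL : 0 < L) (c : ℕ → ℝ → ℝ) (t : ℝ) :
    Periodic (fun x => ser (bc L) c x t) (2 * L) := fun x => by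
  simp only [ser, bc_periodic hL _ x]

lemma ser_bs_periodic (hL : 0 < L) (c : ℕ → ℝ → ℝ) (t : ℝ) :
    Periodic (fun x => ser (bs L) c x t) (2 * L) := fun x => by
  simp only [ser, bs_periodic hL _ x]

lemma exists_mem_Icc_of_periodic {L : ℝ} (hL : 0 < L) {g : ℝ → ℝ} (hg : Periodic g (2 * L))
    (x : ℝ) : ∃ y ∈ Icc (-L) L, g x = g y := by
  obtain ⟨y, hy, h⟩ := hg.exists_mem_Ico (by linarith) x (-L)
  exact ⟨y, ⟨hy.1, by linarith [hy.2]⟩, h⟩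

lemma us_exp_mul {ε τ C : ℝ} (hL : 0 < L) (hε : 0 < ε) (hτ : 0 < τ) {c : ℕ → ℝ}
    (hc : ∀ k, 1 ≤ k → |c k| ≤ C) :
    US (fun k t => Real.exp (-(ε * lam L k ^ 4 * t)) * c k) (Ici τ) := by
  refine US.of_bound ((summable_lam_inv_sq L).mul_left (C / (ε * τ * lam L 1 ^ 2)))
    fun k hk t ht => ?_
  have h1 := lam_pos hL hk
  have h2 := lam_pos hL le_rfl
  have hC := (abs_nonneg _).trans (hc k hk)
  rw [abs_mul, Real.abs_exp]
  have h3 : ε * τ * lam L 1 ^ 2 * lam L k ^ 2 ≤ ε * lam L k ^ 4 * t := by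
    have := pow_le_pow_left₀ h2.le (lam_one_le hL hk) 2
    have htτ : τ ≤ t := ht
    have htp : 0 < t := hτ.trans_le htτ
    calc ε * τ * lam L 1 ^ 2 * lam L k ^ 2 ≤ ε * t * lam L k ^ 2 * lam L k ^ 2 := by
          gcongr
      _ = _ := by ring
  have h4 : Real.exp (-(ε * lam L k ^ 4 * t)) ≤ (ε * τ * lam L 1 ^ 2 * lam L k ^ 2)⁻¹ := by
    rw [Real.exp_neg]
    gcongr
    linarith [Real.add_one_le_exp (ε * lam L k ^ 4 * t)]
  calc _ ≤ (ε * τ * lam L 1 ^ 2 * lam L k ^ 2)⁻¹ * C := by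
        gcongr; exact hc k hk
    _ = _ := by rw [mul_inv]; ring

end Extension

/-- Time derivatives of the velocity modes. -/
def dotV (ε L : ℝ) (F : ℝ → ℝ) (v u θ : ℕ → ℝ → ℝ) (k : ℕ) (t : ℝ) : ℝ :=
  -(ε * lam L k ^ 4) * v k t + (lam L k * stress L F θ k t - lam L k ^ 2 * u k t)

/-- Time derivatives of the temperature modes. -/
def dotT (L : ℝ) (F : ℝ → ℝ) (v θ : ℕ → ℝ → ℝ) (k : ℕ) (t : ℝ) : ℝ :=
  -(1 * lam L k ^ 2) * θ k t + -work L F v θ k t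

namespace Setup

variable {ε L : ℝ} {A U H : ℕ → ℝ} {F F' F'' : ℝ → ℝ} {v u θ : ℕ → ℝ → ℝ}

lemma us_dotT (h : Setup ε L A U H F F' F'' v u θ) (T : ℝ) : US (dotT L F v θ) (Icc 0 T) :=
  (((h.us_lam_sq_theta T).const_mul (-1)).sub ((h.bes_lam_work T).us (j := 0) h.hL)).congr
    fun k _ t _ => by simp only [dotT]; ring

lemma cont_dotT (h : Setup ε L A U H F F' F'' v u θ) (k : ℕ) : Continuous (dotT L F v θ k) :=
  (continuous_const.mul (h.drv.cont_θ k)).add (h.cont_work k).neg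

lemma exists_stress_lipschitz (h : Setup ε L A U H F F' F'' v u θ) (T : ℝ) :
    ∃ C, 0 ≤ C ∧ ∀ k, ∀ t ∈ Icc 0 T, ∀ s ∈ Icc 0 T,
      |stress L F θ k t - stress L F θ k s| ≤ C * |t - s| := by
  have hcont : Continuous (uncurry fun x t => F' (ser (bc L) θ x (max t 0))
      * ser (bc L) (dotT L F v θ) x (max t 0)) :=
    (h.cont_F'.comp h.cont_theta).mul (continuous_ser_max (sys_bc L) h.cont_dotT h.us_dotT)
  obtain ⟨C, hC, hb⟩ := exists_bound_of_continuous hcont L T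
  refine ⟨2 * C, by positivity, fun k t ht s hs => ?_⟩
  unfold stress
  rw [← cc_sub L (continuous_slice h.drv.contG t) (continuous_slice h.drv.contG s), mul_assoc]
  refine abs_cc_le h.hL (fun x hx => ?_) k
  have hd : ∀ r ∈ Icc 0 T, HasDerivWithinAt (fun r => F (ser (bc L) θ x (max r 0)))
      (F' (ser (bc L) θ x (max r 0)) * ser (bc L) (dotT L F v θ) x (max r 0)) (Icc 0 T) r := by
    intro r hr
    have h1 := hasDerivAt_ser_extT (sys_bc L) h.dθ h.us_theta h.us_dotT x r
    rw [abs_of_nonneg hr.1] at h1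
    have h2 := (h.dF _).comp r h1
    rw [ser_extT hr.1] at h2
    rw [max_eq_left hr.1]
    refine h2.hasDerivWithinAt.congr (fun q hq => ?_) ?_
    · simp only [comp_apply]; rw [ser_extT hq.1, max_eq_left hq.1]
    · simp only [comp_apply]; rw [ser_extT hr.1, max_eq_left hr.1]
  have := Convex.norm_image_sub_le_of_norm_hasDerivWithin_le hd (fun r hr => hb x hx r hr)
    (convex_Icc 0 T) hs ht
  simpa only [Real.norm_eq_abs] using this

lemma exists_dotV_sub_le (h : Setup ε L A U H F F' F'' v u θ) (T : ℝ) :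
    ∃ C, 0 ≤ C ∧ ∀ k, 1 ≤ k → ∀ t ∈ Icc 0 T,
      |lam L k * (dotV ε L F v u θ k t
        - Real.exp (-(ε * lam L k ^ 4 * t)) * dotV ε L F v u θ k 0)| ≤ C * (lam L k ^ 2)⁻¹ := by
  obtain ⟨C₁, hC₁, hs⟩ := h.exists_stress_lipschitz (T + 1)
  have hdu : Dec L 1 (fun k t => -(ε * lam L k ^ 2) * u k t + v k t) (T + 1) :=
    ((((h.dec_u (T + 1)).mono h.hL (by norm_num)).lam_pow_mul (p := 1) (j := 2) h.hL).const_mul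
      (-ε) |>.add h.hL ((h.dec_v (T + 1)).mono h.hL (by norm_num))).congr
      fun k _ t _ => by ring
  obtain ⟨C₂, hC₂, hu⟩ := hdu
  refine ⟨(C₁ + C₂) / ε, by have := h.hε; positivity, fun k hk t ht => ?_⟩
  have hl := lam_pos h.hL hk
  have hκ : 0 < ε * lam L k ^ 4 := by have := h.hε; positivity
  set φ : ℝ → ℝ := fun t => lam L k * stress L F θ k t - lam L k ^ 2 * u k t with hφ
  have hφL : ∀ t ∈ Icc 0 (T + 1), ∀ s ∈ Icc 0 (T + 1),
      |φ t - φ s| ≤ (C₁ + C₂) * lam L k * |t - s| := by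
    intro t ht s hs'
    have h1 := Convex.norm_image_sub_le_of_norm_hasDerivWithin_le (C := C₂ * (lam L k)⁻¹)
      (fun r _ => (h.du k r).hasDerivWithinAt) (fun r hr => by
        rw [← div_eq_mul_inv, le_div_iff₀ hl, mul_comm, Real.norm_eq_abs]
        simpa using hu k hk r hr) (convex_Icc 0 (T + 1)) hs' ht
    simp only [Real.norm_eq_abs] at h1
    have h2 := hs k t ht s hs'
    calc |φ t - φ s| = |lam L k * (stress L F θ k t - stress L F θ k s)
          - lam L k ^ 2 * (u k t - u k s)| := by simp only [hφ]; ring_nf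
      _ ≤ lam L k * |stress L F θ k t - stress L F θ k s| + lam L k ^ 2 * |u k t - u k s| := by
          refine (abs_sub _ _).trans (le_of_eq ?_)
          rw [abs_mul, abs_mul, abs_of_pos hl, abs_of_pos (pow_pos hl 2)]
      _ ≤ lam L k * (C₁ * |t - s|) + lam L k ^ 2 * (C₂ * (lam L k)⁻¹ * |t - s|) :=
          add_le_add (mul_le_mul_of_nonneg_left h2 hl.le)
            (mul_le_mul_of_nonneg_left h1 (by positivity))
      _ = _ := by field_simp
  have hq : ∀ δ ∈ Ioo (0 : ℝ) 1, |(v k (t + δ) - v k t) / δ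
      - Real.exp (-(ε * lam L k ^ 4 * t)) * ((v k (0 + δ) - v k 0) / δ)|
      ≤ (C₁ + C₂) * lam L k / (ε * lam L k ^ 4) := by
    intro δ hδ
    have hy : ∀ s, HasDerivAt (fun s => (v k (s + δ) - v k s) / δ)
        (-(ε * lam L k ^ 4) * ((v k (s + δ) - v k s) / δ) + (φ (s + δ) - φ s) / δ) s := by
      intro s
      refine ((((h.dv k (s + δ)).comp_add_const s δ).sub (h.dv k s)).div_const δ).congr_deriv ?_
      simp only [hφ]
      ring
    have := scalar_sub_le hy (γ := 0) (C := (C₁ + C₂) * lam L k) (T := T) (by linarith)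
      (by positivity) (fun s hs => ?_) ht
    · simpa using this
    · have h1 := hφL (s + δ) ⟨by linarith [hs.1, hδ.1], by linarith [hs.2, hδ.2]⟩ s
        ⟨hs.1, by linarith [hs.2]⟩
      rw [abs_div, abs_of_pos hδ.1, div_le_iff₀ hδ.1]
      simpa [abs_of_pos hδ.1] using h1
  have hlim : ∀ t, Tendsto (fun δ => (v k (t + δ) - v k t) / δ) (nhdsWithin 0 (Ioi 0))
      (nhds (dotV ε L F v u θ k t)) := by
    intro t
    have := (h.dv k t).tendsto_slope_zero_right
    refine this.congr fun δ => ?_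
    rw [smul_eq_mul]
    ring
  have hmain := le_of_tendsto ((hlim t).sub ((hlim 0).const_mul _)).abs
    (by filter_upwards [Ioo_mem_nhdsGT (zero_lt_one : (0 : ℝ) < 1)] with δ hδ using hq δ hδ)
  rw [abs_mul, abs_of_pos hl]
  calc _ ≤ lam L k * ((C₁ + C₂) * lam L k / (ε * lam L k ^ 4)) :=
        mul_le_mul_of_nonneg_left hmain hl.le
    _ = _ := by have := h.hε; field_simp

lemma us_lam_dotV (h : Setup ε L A U H F F' F'' v u θ) {τ : ℝ} (hτ : 0 < τ) (T : ℝ) :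
    US (fun k t => lam L k * dotV ε L F v u θ k t) (Icc τ T) := by
  obtain ⟨C, hC, hb⟩ := h.exists_dotV_sub_le T
  have h1 : US (fun k t => lam L k * (dotV ε L F v u θ k t
      - Real.exp (-(ε * lam L k ^ 4 * t)) * dotV ε L F v u θ k 0)) (Icc τ T) :=
    US.of_bound ((summable_lam_inv_sq L).mul_left C) fun k hk t ht =>
      hb k hk t ⟨hτ.le.trans ht.1, ht.2⟩
  have h2 : Dec L 1 (dotV ε L F v u θ) 0 :=
    ((((((h.dec_stress 0).lam_pow_mul (p := 1) (j := 1) h.hL)).sub h.hL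
      (Dec.lam_pow_mul (p := 1) (j := 2) h.hL ((h.dec_u 0).mono h.hL (by norm_num)))).add h.hL
      (((h.dec_v 0).lam_pow_mul (p := 1) (j := 4) h.hL).const_mul (-ε)))).congr
      fun k _ t _ => by simp only [dotV]; ring
  obtain ⟨C', hC', hb'⟩ := h2
  have h3 : US (fun k t => Real.exp (-(ε * lam L k ^ 4 * t))
      * (lam L k * dotV ε L F v u θ k 0)) (Ici τ) :=
    us_exp_mul h.hL h.hε hτ (C := C') fun k hk => by
      rw [abs_mul, abs_of_pos (lam_pos h.hL hk)]
      simpa using hb' k hk 0 ⟨le_rfl, le_rfl⟩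
  exact (h1.add (h3.mono Icc_subset_Ici_self)).congr fun k _ t _ => by ring

end Setup

namespace Setup

variable {ε L : ℝ} {A U H : ℕ → ℝ} {F F' F'' : ℝ → ℝ} {v u θ : ℕ → ℝ → ℝ}

lemma stress_expansion_global (h : Setup ε L A U H F F' F'' v u θ) (x : ℝ) {t : ℝ} (ht : 0 ≤ t) :
    F (ser (bc L) θ x t) = ser (bc L) (stress L F θ) x t := by
  have hper : Periodic (fun x => F (ser (bc L) θ x t) - ser (bc L) (stress L F θ) x t) (2 * L) :=
    fun y => by
      have h1 := ser_bc_periodic h.hL θ t y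
      have h2 := ser_bc_periodic h.hL (stress L F θ) t y
      beta_reduce at h1 h2 ⊢
      rw [h1, h2]
  obtain ⟨y, hy, hxy⟩ := exists_mem_Icc_of_periodic h.hL hper x
  rwa [h.stress_expansion hy ht, sub_self, sub_eq_zero] at hxy

lemma exists_stress_x_lipschitz (h : Setup ε L A U H F F' F'' v u θ) :
    ∃ M, 0 ≤ M ∧ ∀ x y, |∑' k, lam L k * stress L F θ k 0 * bs L k x
      - ∑' k, lam L k * stress L F θ k 0 * bs L k y| ≤ M * |x - y| := by
  obtain ⟨M, hM, hb⟩ := exists_bound_of_continuous h.cont_G_xx L 0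
  refine ⟨M, hM, fun x y => ?_⟩
  have hg : ∀ x, ∑' k, lam L k * stress L F θ k 0 * bs L k x
      = -(F' (ser (bc L) θ x (max 0 0))
        * ser (bs L) (fun k s => -(lam L k * θ k s)) x (max 0 0)) := by
    intro x
    have h1 := hasDerivAt_ser_bc h.hL (c := stress L F θ) (I := Icc 0 0)
      ((h.us_lam_stress 0).congr fun k _ t _ => by rw [pow_one]) (t := 0) ⟨le_rfl, le_rfl⟩ x
    have h2 := h.deriv_G 0 x
    rw [h2.unique (h1.congr_of_eventuallyEq (.of_forall fun z => by
      simp only [max_self]; exact h.stress_expansion_global z le_rfl))]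
    simp only [ser, neg_mul, tsum_neg, neg_neg]
  have hd : ∀ x, HasDerivAt (fun x => ∑' k, lam L k * stress L F θ k 0 * bs L k x) _ x :=
    fun x => (h.deriv_G_x 0 x).neg.congr_of_eventuallyEq (.of_forall hg)
  have := Convex.norm_image_sub_le_of_norm_hasDerivWithin_le (C := M)
    (fun x _ => (hd x).hasDerivWithinAt) (fun x _ => ?_) convex_univ (mem_univ y) (mem_univ x)
  · simpa only [Real.norm_eq_abs] using this
  · rw [norm_neg, Real.norm_eq_abs]
    have hper : Periodic (fun x => F'' (ser (bc L) θ x (max 0 0))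
        * ser (bs L) (fun k s => -(lam L k * θ k s)) x (max 0 0)
        * ser (bs L) (fun k s => -(lam L k * θ k s)) x (max 0 0)
        + F' (ser (bc L) θ x (max 0 0))
        * ser (bc L) (fun k s => lam L k * -(lam L k * θ k s)) x (max 0 0)) (2 * L) := fun y => by
      have h1 := ser_bc_periodic h.hL θ (max 0 0) y
      have h2 := ser_bs_periodic h.hL (fun k s => -(lam L k * θ k s)) (max 0 0) y
      have h3 := ser_bc_periodic h.hL (fun k s => lam L k * -(lam L k * θ k s)) (max 0 0) y
      beta_reduce at h1 h2 h3 ⊢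
      rw [h1, h2, h3]
    obtain ⟨y, hy, hxy⟩ := exists_mem_Icc_of_periodic h.hL hper x
    rw [hxy]
    exact hb y hy 0 ⟨le_rfl, le_rfl⟩

/-- The mixed derivative of the velocity is bounded up to the initial time. -/
lemma exists_lam_dotV_bound (h : Setup ε L A U H F F' F'' v u θ) (T : ℝ) :
    ∃ C, ∀ x, ∀ t ∈ Ioc 0 T, |ser (bc L) (fun k t => lam L k * dotV ε L F v u θ k t) x t| ≤ C := by
  obtain ⟨C₁, hC₁, hb₁⟩ := h.exists_dotV_sub_le T
  obtain ⟨C₂, hC₂, hb₂⟩ := exists_semigroup_bound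
  obtain ⟨M, hM, hlip⟩ := h.exists_stress_x_lipschitz
  have hA := h.dA.summable h.hL (j := 5) (by norm_num)
  have hU := h.dU.summable h.hL (j := 3) (by norm_num)
  set g : ℕ → ℝ := fun k => C₁ * (lam L k ^ 2)⁻¹ + (ε * |lam L k ^ 5 * A k| + |lam L k ^ 3 * U k|)
    with hgdef
  have hg : Summable g := ((summable_lam_inv_sq L).mul_left _).add ((hA.mul_left _).add hU)
  refine ⟨∑' k, g k + C₂ * M, fun x t ht => ?_⟩
  set E : ℕ → ℝ := fun k => Real.exp (-(ε * lam L k ^ 4 * t)) with hE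
  set p : ℕ → ℝ := fun k => lam L k * (E k * (lam L k * stress L F θ k 0)) with hp
  set q : ℕ → ℝ := fun k => lam L k * dotV ε L F v u θ k t - p k with hq
  have hqg : ∀ k, |q k| ≤ g k := by
    intro k
    have hε := h.hε
    rcases Nat.eq_zero_or_pos k with rfl | hk
    · simp only [hq, hp, hgdef, lam_zero, zero_mul, sub_zero, abs_zero]
      positivity
    have h1 := hb₁ k hk t ⟨ht.1.le, ht.2⟩
    have hE1 : |E k| ≤ 1 := by
      have := lam_nonneg h.hL k
      have := ht.1
      rw [Real.abs_exp, Real.exp_le_one_iff, neg_nonpos]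
      positivity
    have h2 : q k = lam L k * (dotV ε L F v u θ k t - E k * dotV ε L F v u θ k 0)
        - E k * (ε * (lam L k ^ 5 * A k) + lam L k ^ 3 * U k) := by
      simp only [hq, hp, dotV, h.drv.v0, h.drv.u0]
      ring
    have h3 : |E k * (ε * (lam L k ^ 5 * A k) + lam L k ^ 3 * U k)|
        ≤ ε * |lam L k ^ 5 * A k| + |lam L k ^ 3 * U k| := by
      rw [abs_mul]
      refine (mul_le_of_le_one_left (abs_nonneg _) hE1).trans ((abs_add_le _ _).trans ?_)
      rw [abs_mul, abs_of_pos hε]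
    rw [h2]
    exact (abs_sub _ _).trans (add_le_add h1 h3)
  have hqs : Summable fun k => |q k| :=
    Summable.of_nonneg_of_le (fun _ => abs_nonneg _) hqg hg
  have hps : Summable fun k => |p k| := by
    obtain ⟨C, hC, hd⟩ := h.dec_stress 0
    have h1 := us_exp_mul h.hL h.hε ht.1 (c := fun k => lam L k ^ 2 * stress L F θ k 0) (C := C)
      fun k hk => by
        rw [abs_mul, abs_of_pos (pow_pos (lam_pos h.hL hk) 2)]
        exact hd k hk 0 ⟨le_rfl, le_rfl⟩
    exact (h1.summable (t := t) self_mem_Ici).congr fun k => by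
      simp only [hp, hE]; ring_nf
  have hsplit : ser (bc L) (fun k t => lam L k * dotV ε L F v u θ k t) x t
      = ∑' k, q k * bc L k x + ∑' k, p k * bc L k x := by
    rw [← (summable_mul_sys (abs_bc_le L) hqs x).tsum_add
      (summable_mul_sys (abs_bc_le L) hps x)]
    exact tsum_congr fun k => by simp only [hq]; ring
  have h1 : |∑' k, q k * bc L k x| ≤ ∑' k, g k :=
    (abs_tsum_sys_le (abs_bc_le L) hqs x).trans (hqs.tsum_le_tsum hqg hg)
  set r : ℝ := Real.sqrt (Real.sqrt (ε * t)) with hr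
  have hr4 : r ^ 4 = ε * t := by
    rw [show (4 : ℕ) = 2 * 2 by norm_num, pow_mul, hr, Real.sq_sqrt (Real.sqrt_nonneg _),
      Real.sq_sqrt (mul_pos h.hε ht.1).le]
  have hEr : ∀ k, Real.exp (-(lam L k * r) ^ 4) = E k := fun k => by
    simp only [hE, mul_pow, hr4]; ring_nf
  have h2 := hb₂ L h.hL (fun k => lam L k * stress L F θ k 0)
    (((h.us_lam_stress 0).summable (t := 0) ⟨le_rfl, le_rfl⟩).congr fun k => by rw [pow_one])
    M hM hlip r (by simpa only [hEr] using hps) x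
  simp only [hEr] at h2
  rw [hsplit]
  exact (abs_add_le _ _).trans (add_le_add h1 h2)

end Setup

section Comparison

/-- The second derivative is nonnegative at a global minimum. -/
lemma deriv_two_nonneg_of_min {g g' : ℝ → ℝ} {x d : ℝ} (hg : ∀ y, HasDerivAt g (g' y) y)
    (hg' : HasDerivAt g' d x) (hmin : ∀ y, g x ≤ g y) : 0 ≤ d := by
  by_contra! hd
  have h0 : g' x = 0 := IsLocalMin.hasDerivAt_eq_zero (.of_forall hmin) (hg x)
  have h1 := hg'.tendsto_slope_zero_right
  have h2 := h1.eventually (gt_mem_nhds hd)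
  obtain ⟨r, hr, hsub⟩ := mem_nhdsGT_iff_exists_Ioo_subset.1 h2
  have hr : 0 < r := hr
  have hanti : StrictAntiOn g (Icc x (x + r / 2)) := by
    refine strictAntiOn_of_deriv_neg (convex_Icc _ _)
      (fun y _ => (hg y).continuousAt.continuousWithinAt) fun y hy => ?_
    rw [interior_Icc] at hy
    have h3 := hsub (show y - x ∈ Ioo 0 r from ⟨by linarith [hy.1], by linarith [hy.2]⟩)
    simp only [mem_ofPred_eq, add_sub_cancel, h0, sub_zero, smul_eq_mul] at h3
    rw [(hg y).deriv]
    have hp : 0 < (y - x)⁻¹ := inv_pos.2 (by linarith [hy.1])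
    exact (pos_iff_neg_of_mul_neg h3).1 hp
  have := hanti (left_mem_Icc.2 (by linarith)) (right_mem_Icc.2 (by linarith))
    (by linarith : x < x + r / 2)
  linarith [hmin (x + r / 2)]

/-- A spatially periodic function that is initially positive and has positive time derivative at
every first zero stays positive. -/
lemma pos_of_first_zero {L T : ℝ} (hL : 0 < L) {z : ℝ → ℝ → ℝ} (hz : Continuous (uncurry z))
    (hper : ∀ t, Periodic (fun x => z x t) (2 * L)) (h0 : ∀ x, 0 < z x 0)
    (hstep : ∀ x ∈ Icc (-L) L, ∀ t ∈ Ioc 0 T, z x t = 0 → (∀ y, 0 ≤ z y t) →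
      ∃ d, 0 < d ∧ HasDerivAt (fun s => z x s) d t) (x : ℝ) {t : ℝ} (ht : t ∈ Icc 0 T) :
    0 < z x t := by
  by_contra! hneg
  set S : Set (ℝ × ℝ) := {p | p ∈ Icc (-L) L ×ˢ Icc 0 T ∧ z p.1 p.2 ≤ 0} with hS
  have hSc : IsCompact S :=
    (isCompact_Icc.prod isCompact_Icc).inter_right (isClosed_le hz continuous_const)
  have hSn : S.Nonempty := by
    obtain ⟨y, hy, hxy⟩ := exists_mem_Icc_of_periodic hL (hper t) x
    exact ⟨(y, t), ⟨hy, ht⟩, hxy ▸ hneg⟩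
  obtain ⟨⟨x₀, t₀⟩, ⟨⟨hx₀, ht₀⟩, hle⟩, hmin⟩ := hSc.exists_isMinOn hSn continuous_snd.continuousOn
  simp only at hx₀ ht₀ hle
  have hbefore : ∀ s ∈ Ico 0 t₀, ∀ y, 0 < z y s := by
    intro s hs y
    by_contra! hy
    obtain ⟨w, hw, hyw⟩ := exists_mem_Icc_of_periodic hL (hper s) y
    have : (w, s) ∈ S := ⟨⟨hw, hs.1, hs.2.le.trans ht₀.2⟩, hyw ▸ hy⟩
    exact absurd (hmin this) (not_le.2 hs.2)
  have ht₀p : 0 < t₀ := by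
    rcases eq_or_lt_of_le ht₀.1 with h | h
    · rw [← h] at hle
      exact absurd (h0 x₀) (not_lt.2 hle)
    · exact h
  have hnear : ∀ᶠ s in nhdsWithin t₀ (Iio t₀), s ∈ Ico 0 t₀ := by
    filter_upwards [Ioo_mem_nhdsLT ht₀p] with s hs using ⟨hs.1.le, hs.2⟩
  have hnn : ∀ y, 0 ≤ z y t₀ := fun y =>
    ge_of_tendsto
      ((hz.comp (Continuous.prodMk_right y)).continuousAt.continuousWithinAt (s := Iio t₀))
      (by filter_upwards [hnear] with s hs using (hbefore s hs y).le)
  have hz0 : z x₀ t₀ = 0 := le_antisymm hle (hnn x₀)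
  obtain ⟨d, hd, hder⟩ := hstep x₀ hx₀ t₀ ⟨ht₀p, ht₀.2⟩ hz0 hnn
  have h1 := (hasDerivAt_iff_tendsto_slope_left_right.1 hder).1
  obtain ⟨s, hs1, hs2⟩ := ((h1.eventually (lt_mem_nhds hd)).and hnear).exists
  rw [slope_def_field, hz0, sub_zero] at hs1
  exact absurd hs1 (not_lt.2 (div_nonpos_of_nonneg_of_nonpos (hbefore s hs2 x₀).le
    (by linarith [hs2.2])))

end Comparison

lemma bc_at_zero (L : ℝ) (k : ℕ) : bc L k 0 = 1 := by simp [bc]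

lemma ser_bc_at_zero (L : ℝ) (c : ℕ → ℝ → ℝ) (t : ℝ) : ser (bc L) c 0 t = ∑' k, c k t := by
  simp only [ser, bc_at_zero, mul_one]

lemma Dec.mul {L T : ℝ} {p q : ℕ} {c d : ℕ → ℝ → ℝ} (hL : 0 < L) (hc : Dec L p c T)
    (hd : Dec L q d T) : Dec L (p + q) (fun k t => c k t * d k t) T := by
  obtain ⟨C, hC, hc⟩ := hc
  obtain ⟨D, hD, hd⟩ := hd
  refine ⟨C * D, by positivity, fun k hk t ht => ?_⟩
  have := lam_pos hL hk
  calc lam L k ^ (p + q) * |c k t * d k t|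
      = (lam L k ^ p * |c k t|) * (lam L k ^ q * |d k t|) := by rw [abs_mul, pow_add]; ring
    _ ≤ C * D := mul_le_mul (hc k hk t ht) (hd k hk t ht) (by positivity) hC

/-- Total energy of the system of modes. -/
def energy (L : ℝ) (v u θ : ℕ → ℝ → ℝ) (t : ℝ) : ℝ :=
  ser (bc L) (fun k t => 1 / 2 * (v k t * v k t + lam L k ^ 2 * (u k t * u k t))) 0 t + 2 * θ 0 t

/-- Viscous dissipation of the velocity modes. -/
def dissip (L : ℝ) (v : ℕ → ℝ → ℝ) (t : ℝ) : ℝ :=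
  ser (bc L) (fun k t => lam L k ^ 4 * (v k t * v k t)) 0 t

namespace Setup

variable {ε L : ℝ} {A U H : ℕ → ℝ} {F F' F'' : ℝ → ℝ} {v u θ : ℕ → ℝ → ℝ}

lemma hasDerivAt_theta_max (h : Setup ε L A U H F F' F'' v u θ) (x : ℝ) {t : ℝ} (ht : 0 < t) :
    HasDerivAt (fun s => ser (bc L) θ x (max s 0)) (ser (bc L) (dotT L F v θ) x t) t := by
  have h1 := hasDerivAt_ser_extT (sys_bc L) h.dθ h.us_theta h.us_dotT x t
  rw [abs_of_pos ht] at h1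
  refine h1.congr_of_eventuallyEq ?_
  filter_upwards [lt_mem_nhds ht] with s hs
  rw [max_eq_left hs.le, ser_extT hs.le]

/-- Comparison of the temperature with a spatially constant barrier. -/
lemma theta_barrier (h : Setup ε L A U H F F' F'' v u θ) {β β' : ℝ → ℝ} (hβ : Continuous β)
    {T σ : ℝ} (hβ' : ∀ t ∈ Ioc 0 T, HasDerivAt β (β' t) t)
    (h0 : ∀ x, 0 < σ * (ser (bc L) θ x 0 - β 0))
    (hstep : ∀ x ∈ Icc (-L) L, ∀ t ∈ Ioc 0 T, 0 < -σ * (F (β t) * VX L v x t + β' t))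
    (x : ℝ) {t : ℝ} (ht : t ∈ Icc 0 T) : 0 < σ * (ser (bc L) θ x t - β t) := by
  have hσ : σ ≠ 0 := by
    rintro rfl
    simpa using h0 0
  have hpos := pos_of_first_zero h.hL (T := T)
    (z := fun x t => σ * (ser (bc L) θ x (max t 0) - β t))
    (continuous_const.mul (h.cont_theta.sub (hβ.comp continuous_snd)))
    (fun t y => by
      have := ser_bc_periodic h.hL θ (max t 0) y
      simp only at this ⊢
      rw [this]) (by simpa only [max_self] using h0) (fun y hy s hs hz hmin => ?_) x ht
  · simpa only [max_eq_left ht.1] using hpos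
  · have hβs : ser (bc L) θ y s = β s := by
      rw [max_eq_left hs.1.le] at hz
      exact sub_eq_zero.1 ((mul_eq_zero.1 hz).resolve_left hσ)
    refine ⟨σ * (ser (bc L) (dotT L F v θ) y s - β' s), ?_,
      ((h.hasDerivAt_theta_max y hs.1).sub (hβ' s hs)).const_mul σ⟩
    have hxx := deriv_two_nonneg_of_min
      (g := fun y => σ * (ser (bc L) θ y (max s 0) - β s))
      (fun w => ((hasDerivAt_ser_bc h.hL (h.us_lam_theta _) (mem_Icc_max s) w).sub_const
        (β s)).const_mul σ)
      ((h.deriv_theta_x s y).const_mul σ) (fun w => by rw [hz]; exact hmin w)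
    have heq := h.eq_theta hy hs.1.le
    have hst := hstep y hy s hs
    rw [max_eq_left hs.1.le] at hxx
    rw [VX, max_eq_left hs.1.le] at hst
    rw [hβs] at heq
    have h3 : ser (bc L) (fun k s => lam L k * -(lam L k * θ k s)) y s
        = -ser (bc L) (fun k t => lam L k ^ 2 * θ k t) y s := by
      rw [← ser_neg]
      exact ser_congr (fun k => by ring) y
    rw [h3] at hxx
    unfold dotT
    rw [heq]
    linarith

/-- Positivity of the temperature. -/
lemma theta_pos (h : Setup ε L A U H F F' F'' v u θ) {M : ℝ} (hM : ∀ s, 0 ≤ s → |F s| ≤ M * s)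
    {m : ℝ} (hm : 0 < m) (h0 : ∀ x, m < ser (bc L) θ x 0) (x : ℝ) {t : ℝ} (ht : 0 ≤ t) :
    0 < ser (bc L) θ x t := by
  obtain ⟨W, hW, hb⟩ := exists_bound_of_continuous h.cont_VX L t
  have hM0 : 0 ≤ M := by simpa using (abs_nonneg _).trans (hM 1 zero_le_one)
  have hd : ∀ s, HasDerivAt (fun s => m * Real.exp (-((M * W + 1) * s)))
      (-(M * W + 1) * (m * Real.exp (-((M * W + 1) * s)))) s := fun s =>
    ((((hasDerivAt_id s).const_mul (M * W + 1)).neg.exp).const_mul m).congr_deriv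
      (by simp only [id, mul_one, Pi.neg_apply]; ring)
  have := h.theta_barrier (σ := 1) (T := t) (by fun_prop) (fun s _ => hd s)
    (fun x => by simpa using h0 x) (fun y hy s hs => ?_) x (t := t) ⟨ht, le_rfl⟩
  · have hp : 0 < m * Real.exp (-((M * W + 1) * t)) := by positivity
    linarith
  · have hp : 0 < m * Real.exp (-((M * W + 1) * s)) := by positivity
    set β := m * Real.exp (-((M * W + 1) * s))
    have h1 : |F β * VX L v y s| ≤ M * β * W := by
      rw [abs_mul]
      exact mul_le_mul (hM β hp.le) (hb y hy s ⟨hs.1.le, hs.2⟩) (abs_nonneg _) (by positivity)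
    have h2 := (abs_le.1 h1).2
    nlinarith

end Setup

lemma integral_bc {L : ℝ} (hL : 0 < L) {k : ℕ} (hk : 1 ≤ k) : ∫ x in (-L)..L, bc L k x = 0 := by
  have hl := lam_pos hL hk
  have h1 : ∫ x in (-L)..L, lam L k * bc L k x = bs L k L - bs L k (-L) :=
    intervalIntegral.integral_eq_sub_of_hasDerivAt (fun x _ => hasDerivAt_bs L k x)
      ((continuous_const.mul (continuous_bc L k)).intervalIntegrable _ _)
  rw [bs_neg, bs_L hL, intervalIntegral.integral_const_mul] at h1
  simpa [hl.ne'] using h1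

namespace Setup

variable {ε L : ℝ} {A U H : ℕ → ℝ} {F F' F'' : ℝ → ℝ} {v u θ : ℕ → ℝ → ℝ}

lemma theta_zero_nonneg (h : Setup ε L A U H F F' F'' v u θ) {t : ℝ} (ht : 0 ≤ t)
    (hpos : ∀ x, 0 ≤ ser (bc L) θ x t) : 0 ≤ θ 0 t := by
  have h1 := integral_mul_tsum (sys_bc L) (c := fun k => θ k t)
    ((h.us_theta t).summable ⟨ht, le_rfl⟩) (g := fun _ => 1) continuous_const (B := 1) h.hL
    (fun x _ => by simp)
  have h2 := hasSum_single (f := fun k => θ k t * ∫ x in (-L)..L, 1 * bc L k x) 0 fun k hk => by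
    simp [integral_bc h.hL (Nat.one_le_iff_ne_zero.2 hk)]
  have h3 := h2.unique h1
  have h4 : 0 ≤ ∫ x in (-L)..L, 1 * ∑' k, θ k t * bc L k x :=
    intervalIntegral.integral_nonneg (by linarith [h.hL]) fun x _ => by
      rw [one_mul]; exact hpos x
  rw [← h3] at h4
  simp only [bc, lam_zero, zero_mul, Real.cos_zero, mul_one, intervalIntegral.integral_const,
    sub_neg_eq_add, smul_eq_mul] at h4
  have := h.hL
  exact nonneg_of_mul_nonneg_left h4 (by linarith)

lemma us_energy (h : Setup ε L A U H F F' F'' v u θ) (T : ℝ) :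
    US (fun k t => 1 / 2 * (v k t * v k t + lam L k ^ 2 * (u k t * u k t))) (Icc 0 T) :=
  ((((h.dec_v T).mul h.hL (h.dec_v T)).us' h.hL (by norm_num)).add
    (((h.dec_u T).mul h.hL (h.dec_u T)).us h.hL (j := 2) (by norm_num))).const_mul _

lemma us_dissip (h : Setup ε L A U H F F' F'' v u θ) (T : ℝ) :
    US (fun k t => lam L k ^ 4 * (v k t * v k t)) (Icc 0 T) :=
  ((h.dec_v T).mul h.hL (h.dec_v T)).us h.hL (j := 4) (by norm_num)

lemma us_dissip_u (h : Setup ε L A U H F F' F'' v u θ) (T : ℝ) :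
    US (fun k t => lam L k ^ 4 * (u k t * u k t)) (Icc 0 T) :=
  ((h.dec_u T).mul h.hL (h.dec_u T)).us h.hL (j := 4) (by norm_num)

lemma us_power (h : Setup ε L A U H F F' F'' v u θ) (T : ℝ) :
    US (fun k t => lam L k ^ 1 * (v k t * stress L F θ k t)) (Icc 0 T) :=
  ((h.dec_v T).mul h.hL (h.dec_stress T)).us h.hL (j := 1) (by norm_num)

lemma ser_power (h : Setup ε L A U H F F' F'' v u θ) {t : ℝ} (ht : 0 ≤ t) :
    ser (bc L) (fun k t => lam L k ^ 1 * (v k t * stress L F θ k t)) 0 t =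
      2 * work L F v θ 0 t := by
  have htT : t ∈ Icc 0 t := ⟨ht, le_rfl⟩
  obtain ⟨B, -, hB⟩ := exists_bound_of_continuous h.drv.contG L t
  have h1 := (integral_mul_tsum (sys_bc L) (c := fun k => lam L k * v k t)
    ((((h.dec_v t).us h.hL (j := 1) (by norm_num)).summable htT).congr fun k => by rw [pow_one])
    (continuous_slice h.drv.contG t) h.hL (fun x hx => hB x hx t htT)).mul_left (1 / L)
  have h2 : ∀ k, lam L k ^ 1 * (v k t * stress L F θ k t) = 1 / L * (lam L k * v k t
      * ∫ x in (-L)..L, F (ser (bc L) θ x (max t 0)) * bc L k x) := by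
    intro k
    rcases Nat.eq_zero_or_pos k with rfl | hk
    · simp [lam_zero]
    · simp only [stress, cc, wt, if_neg hk.ne']
      ring
  rw [ser_bc_at_zero]
  simp only [h2]
  rw [h1.tsum_eq, work, cc, wt, if_pos rfl]
  simp only [bc, lam_zero, zero_mul, Real.cos_zero, mul_one, VX, ser, max_eq_left ht]
  have := h.hL
  field_simp

/-- Energy inequality. -/
lemma exists_energy_deriv (h : Setup ε L A U H F F' F'' v u θ) {t : ℝ} (ht : 0 < t) :
    ∃ d, HasDerivAt (energy L v u θ) d t ∧ d ≤ -ε * dissip L v t := by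
  have hI : t ∈ Ioo 0 (t + 1) := ⟨ht, by linarith⟩
  have htT : t ∈ Icc 0 (t + 1) := ⟨ht.le, by linarith⟩
  have hε := h.hε
  set D : ℕ → ℝ → ℝ := fun k t => -ε * (lam L k ^ 4 * (v k t * v k t))
    + (-ε * (lam L k ^ 4 * (u k t * u k t)) + lam L k ^ 1 * (v k t * stress L F θ k t)) with hD
  have hus2 := ((h.us_dissip_u (t + 1)).const_mul (-ε)).add (h.us_power (t + 1))
  have hus1 := (h.us_dissip (t + 1)).const_mul (-ε)
  have hser := (hus1.add hus2).mono Ioo_subset_Icc_self |>.hasDerivAt_time isOpen_Ioo (sys_bc L).bdd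
    (c := fun k t => 1 / 2 * (v k t * v k t + lam L k ^ 2 * (u k t * u k t)))
    (fun s hs => (h.us_energy (t + 1)).summable (Ioo_subset_Icc_self hs))
    (fun k s _ => ((((h.dv k s).mul (h.dv k s)).add
      (((h.du k s).mul (h.du k s)).const_mul (lam L k ^ 2))).const_mul (1 / 2)).congr_deriv
      (by ring)) 0 hI
  have hd := hser.add ((h.dθ 0 t).const_mul 2)
  refine ⟨_, hd, ?_⟩
  rw [ser_add (sys_bc L) (c := fun k t => -ε * (lam L k ^ 4 * (v k t * v k t)))
      (d := fun k t => -ε * (lam L k ^ 4 * (u k t * u k t))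
        + lam L k ^ 1 * (v k t * stress L F θ k t)) (hus1.summable htT) (hus2.summable htT),
    ser_add (sys_bc L) (c := fun k t => -ε * (lam L k ^ 4 * (u k t * u k t)))
      (d := fun k t => lam L k ^ 1 * (v k t * stress L F θ k t))
      (((h.us_dissip_u (t + 1)).const_mul (-ε)).summable htT)
      ((h.us_power (t + 1)).summable htT),
      ser_const_mul, ser_const_mul, h.ser_power ht.le, lam_zero]
  have h1 : 0 ≤ ser (bc L) (fun k t => lam L k ^ 4 * (u k t * u k t)) 0 t := by
    rw [ser_bc_at_zero]
    exact tsum_nonneg fun k => mul_nonneg (pow_nonneg (lam_nonneg h.hL k) 4) (mul_self_nonneg _)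
  have h2 := mul_nonneg hε.le h1
  unfold dissip
  linarith

lemma energy_nonneg (h : Setup ε L A U H F F' F'' v u θ) {t : ℝ} (ht : 0 ≤ t)
    (hpos : ∀ x, 0 ≤ ser (bc L) θ x t) : 0 ≤ energy L v u θ t := by
  have h1 := h.theta_zero_nonneg ht hpos
  have h2 : 0 ≤ ser (bc L)
      (fun k t => 1 / 2 * (v k t * v k t + lam L k ^ 2 * (u k t * u k t))) 0 t := by
    rw [ser_bc_at_zero]
    refine tsum_nonneg fun k => ?_
    have := mul_nonneg (pow_nonneg (lam_nonneg h.hL k) 2) (mul_self_nonneg (u k t))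
    have := mul_self_nonneg (v k t)
    positivity
  unfold energy
  linarith

lemma continuous_energy (h : Setup ε L A U H F F' F'' v u θ) :
    Continuous fun t => energy L v u θ (max t 0) := by
  have hc : ∀ k, Continuous fun t => 1 / 2 * (v k t * v k t + lam L k ^ 2 * (u k t * u k t)) :=
    fun k => by
      have := h.cont_v k
      have := h.cont_u k
      fun_prop
  exact ((continuous_ser_max (sys_bc L) hc h.us_energy).comp (Continuous.prodMk_right 0)).add
    (continuous_const.mul ((h.drv.cont_θ 0).comp (by fun_prop)))

lemma abs_VX_le_dissip (h : Setup ε L A U H F F' F'' v u θ) (x : ℝ) {t : ℝ} (ht : 0 ≤ t) :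
    |VX L v x t| ≤ 1 / 2 * ∑' k, (lam L k ^ 2)⁻¹ + 1 / 2 * dissip L v t := by
  have hs := (summable_lam_inv_sq L).mul_left (1 / 2)
  have hq : Summable fun k => lam L k ^ 4 * (v k t * v k t) :=
    ((h.us_dissip t).summable ⟨ht, le_rfl⟩).of_abs
  have hle : ∀ k, |lam L k * v k t| ≤ 1 / 2 * (lam L k ^ 2)⁻¹
      + 1 / 2 * (lam L k ^ 4 * (v k t * v k t)) := by
    intro k
    rcases Nat.eq_zero_or_pos k with rfl | hk
    · simp [lam_zero]
    have hl := lam_pos h.hL hk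
    have h1 : |lam L k * v k t| = (lam L k)⁻¹ * |lam L k ^ 2 * v k t| := by
      rw [abs_mul, abs_mul, abs_of_pos hl, abs_of_pos (pow_pos hl 2)]
      field_simp
    have h2 := two_mul_le_add_sq (lam L k)⁻¹ |lam L k ^ 2 * v k t|
    rw [sq_abs, inv_pow] at h2
    rw [h1]
    linarith [show (lam L k ^ 2 * v k t) ^ 2 = lam L k ^ 4 * (v k t * v k t) by ring]
  have hsum := hs.add (hq.mul_left (1 / 2))
  have habs : Summable fun k => |lam L k * v k t| :=
    Summable.of_nonneg_of_le (fun _ => abs_nonneg _) hle hsum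
  unfold VX ser
  rw [max_eq_left ht]
  refine (abs_tsum_sys_le (abs_bc_le L) habs x).trans ((habs.tsum_le_tsum hle hsum).trans ?_)
  rw [hs.tsum_add (hq.mul_left _), tsum_mul_left, tsum_mul_left, dissip, ser_bc_at_zero]

/-- A bound for the temperature depending on the nonlinearity through its growth only. -/
lemma theta_le (h : Setup ε L A U H F F' F'' v u θ) {M : ℝ} (hM : ∀ s, 0 ≤ s → |F s| ≤ M * s)
    (hpos : ∀ x, ∀ t, 0 ≤ t → 0 ≤ ser (bc L) θ x t)
    {m : ℝ} (hm : 0 < m) (h0 : ∀ x, ser (bc L) θ x 0 < m) (x : ℝ) {t : ℝ} (ht : 0 ≤ t) :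
    ser (bc L) θ x t < m * Real.exp (t + M * (1 / 2 * (∑' k, (lam L k ^ 2)⁻¹) * t
      + 1 / (2 * ε) * energy L v u θ 0)) := by
  have hM0 : 0 ≤ M := by simpa using (abs_nonneg _).trans (hM 1 zero_le_one)
  have hε := h.hε
  set C := ∑' k, (lam L k ^ 2)⁻¹
  set β : ℝ → ℝ := fun s => m * Real.exp (s + M * (1 / 2 * C * s
    + 1 / (2 * ε) * (energy L v u θ 0 - energy L v u θ (max s 0)))) with hβ
  have hder : ∀ s, ∃ d, 0 < s → HasDerivAt (energy L v u θ) d s ∧ d ≤ -ε * dissip L v s := by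
    intro s
    rcases le_or_gt s 0 with hs | hs
    · exact ⟨0, fun h' => absurd h' (not_lt.2 hs)⟩
    · obtain ⟨d, hd⟩ := h.exists_energy_deriv hs
      exact ⟨d, fun _ => hd⟩
  choose d hd using hder
  have hcβ : Continuous β := by
    have := h.continuous_energy
    fun_prop
  have hβ' : ∀ s ∈ Ioc 0 t, HasDerivAt β
      (β s * (1 + M * (1 / 2 * C + 1 / (2 * ε) * (-d s)))) s := by
    intro s hs
    have h1 : HasDerivAt (fun r => energy L v u θ (max r 0)) (d s) s := by
      refine (hd s hs.1).1.congr_of_eventuallyEq ?_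
      filter_upwards [lt_mem_nhds hs.1] with r hr
      rw [max_eq_left hr.le]
    refine ((((hasDerivAt_id s).add ((((hasDerivAt_id s).const_mul (1 / 2 * C)).add
      ((h1.const_sub (energy L v u θ 0)).const_mul (1 / (2 * ε)))).const_mul M)).exp).const_mul
      m).congr_deriv ?_
    simp only [hβ, id, Pi.add_apply, mul_one]
    ring
  have := h.theta_barrier (σ := -1) hcβ hβ' (fun y => by
    simp only [hβ, max_self, sub_self, mul_zero, add_zero, Real.exp_zero, mul_one]
    linarith [h0 y]) (fun y hy s hs => ?_) x (t := t) ⟨ht, le_rfl⟩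
  · have h1 : β t ≤ m * Real.exp (t + M * (1 / 2 * C * t + 1 / (2 * ε) * energy L v u θ 0)) := by
      have h2 := h.energy_nonneg ht fun x => hpos x t ht
      simp only [hβ, max_eq_left ht]
      gcongr
      linarith
    linarith
  · have hp : 0 < β s := by positivity
    have h1 : |F (β s) * VX L v y s| ≤ M * β s * (1 / 2 * C + 1 / 2 * dissip L v s) := by
      rw [abs_mul]
      exact mul_le_mul (hM _ hp.le) (h.abs_VX_le_dissip y hs.1.le) (abs_nonneg _) (by positivity)
    have h2 := (abs_le.1 h1).1
    have h3 : 1 / 2 * dissip L v s ≤ 1 / (2 * ε) * (-d s) := by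
      calc 1 / 2 * dissip L v s = 1 / (2 * ε) * (ε * dissip L v s) := by field_simp
        _ ≤ _ := by
          gcongr
          linarith [(hd s hs.1).2]
    have h4 : M * β s * (1 / 2 * C + 1 / 2 * dissip L v s)
        ≤ M * β s * (1 / 2 * C + 1 / (2 * ε) * (-d s)) := by gcongr
    linarith

end Setup

lemma exists_lipschitz_of_bound {g g' : ℝ → ℝ} (hg : ∀ x, HasDerivAt g (g' x) x) {S : Set ℝ}
    (hS : Convex ℝ S) {K : ℝ} (hK : ∀ x ∈ S, |g' x| ≤ K) {x y : ℝ} (hx : x ∈ S) (hy : y ∈ S) :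
    |g x - g y| ≤ K * |x - y| := by
  have := Convex.norm_image_sub_le_of_norm_hasDerivWithin_le (C := K)
    (fun x _ => (hg x).hasDerivWithinAt) hK hS hy hx
  simpa only [Real.norm_eq_abs] using this

lemma hasDerivAt_smooth {φ : ℝ → ℝ} (hφ : ContDiff ℝ (⊤ : ℕ∞) φ) (x : ℝ) :
    HasDerivAt φ (deriv φ x) x := (hφ.differentiable (by simp) x).hasDerivAt

lemma contDiff_deriv {φ : ℝ → ℝ} (hφ : ContDiff ℝ (⊤ : ℕ∞) φ) : ContDiff ℝ (⊤ : ℕ∞) (deriv φ) :=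
  ((contDiff_infty_iff_deriv (𝕜 := ℝ)).1 hφ).2

/-- Truncation of a nonlinearity outside a ball. -/
lemma exists_truncation {F F' F'' : ℝ → ℝ} (dF : ∀ s, HasDerivAt F (F' s) s)
    (dF' : ∀ s, HasDerivAt F' (F'' s) s) (cF'' : Continuous F'') {R : ℝ} (hR : 0 < R) :
    ∃ G G' G'' : ℝ → ℝ, (∀ s, HasDerivAt G (G' s) s) ∧ (∀ s, HasDerivAt G' (G'' s) s) ∧
      Continuous G'' ∧ (∀ s, |s| ≤ R → G s = F s) ∧ (∀ s, |G s| ≤ |F s|) ∧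
      (∃ B, ∀ s, |G s| ≤ B) ∧ ∃ K, ∀ s r, |G s - G r| ≤ K * |s - r| := by
  let φ : ContDiffBump (0 : ℝ) := ⟨R, R + 1, hR, by linarith⟩
  have hφ : ContDiff ℝ (⊤ : ℕ∞) φ := φ.contDiff
  have hc : HasCompactSupport φ := φ.hasCompactSupport
  have cF : Continuous F := continuous_iff_continuousAt.2 fun s => (dF s).continuousAt
  have cF' : Continuous F' := continuous_iff_continuousAt.2 fun s => (dF' s).continuousAt
  have h1 := contDiff_deriv hφ
  have h2 := contDiff_deriv h1
  have c0 := hφ.continuous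
  have c1 := h1.continuous
  have c2 := h2.continuous
  have hder : ∀ s, HasDerivAt (fun s => F s * φ s) (F' s * φ s + F s * deriv φ s) s :=
    fun s => (dF s).mul (hasDerivAt_smooth hφ s)
  refine ⟨fun s => F s * φ s, fun s => F' s * φ s + F s * deriv φ s,
    fun s => F'' s * φ s + F' s * deriv φ s + (F' s * deriv φ s + F s * deriv (deriv φ) s),
    hder, fun s => ((dF' s).mul (hasDerivAt_smooth hφ s)).add
      ((dF s).mul (hasDerivAt_smooth h1 s)), by fun_prop, fun s hs => ?_, fun s => ?_, ?_, ?_⟩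
  · beta_reduce
    rw [φ.one_of_mem_closedBall (by simpa using hs), mul_one]
  · rw [abs_mul, abs_of_nonneg φ.nonneg]
    exact mul_le_of_le_one_right (abs_nonneg _) φ.le_one
  · obtain ⟨B, hB⟩ := (cF.mul c0).bounded_above_of_compact_support hc.mul_left
    exact ⟨B, hB⟩
  · obtain ⟨K, hK⟩ := ((cF'.mul c0).add (cF.mul c1)).bounded_above_of_compact_support
      (hc.mul_left.add hc.deriv.mul_left)
    exact ⟨K, fun s r => exists_lipschitz_of_bound hder convex_univ (fun x _ => hK x)
      (mem_univ s) (mem_univ r)⟩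

/-- Global solvability for a nonlinearity of linear growth, with positive temperature. -/
lemma exists_setup {ε L : ℝ} (hε : 0 < ε) (hL : 0 < L) {A U H : ℕ → ℝ} (dA : DecS L 7 A)
    (dU : DecS L 7 U) (dH : DecS L 6 H) {F F' F'' : ℝ → ℝ} (dF : ∀ s, HasDerivAt F (F' s) s)
    (dF' : ∀ s, HasDerivAt F' (F'' s) s) (cF'' : Continuous F'') {M : ℝ}
    (hM : ∀ s, 0 ≤ s → |F s| ≤ M * s) {m₀ m₁ : ℝ} (hm₀ : 0 < m₀)
    (hlow : ∀ x, m₀ < ∑' k, H k * bc L k x) (hup : ∀ x, ∑' k, H k * bc L k x < m₁) :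
    ∃ v u θ, Setup ε L A U H F F' F'' v u θ ∧ ∀ x, ∀ t, 0 ≤ t → 0 < ser (bc L) θ x t := by
  have hM0 : 0 ≤ M := by simpa using (abs_nonneg _).trans (hM 1 zero_le_one)
  have hm₁ : 0 < m₁ := hm₀.trans ((hlow 0).trans (hup 0))
  have hA : DecS L 3 A := dA.mono hL (by norm_num)
  have hU : DecS L 1 U := dU.mono hL (by norm_num)
  have hH : Summable fun k => |H k| :=
    (dH.summable hL (j := 0) (by norm_num)).congr fun k => by simp
  have cF' : Continuous F' := continuous_iff_continuousAt.2 fun s => (dF' s).continuousAt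
  have cF : Continuous F := continuous_iff_continuousAt.2 fun s => (dF s).continuousAt
  set C := ∑' k, (lam L k ^ 2)⁻¹ with hC
  have hC0 : 0 ≤ C := tsum_nonneg fun k => by positivity
  set E := ser (bc L) (fun k _ => 1 / 2 * (A k * A k + lam L k ^ 2 * (U k * U k))) 0 0 + 2 * H 0
    with hE
  set b : ℝ → ℝ := fun t => m₁ * Real.exp (t + M * (1 / 2 * C * t + 1 / (2 * ε) * E)) with hb
  have hbmono : Monotone b := fun s t hst => by
    simp only [hb]
    gcongr
  have hbpos : ∀ t, 0 < b t := fun t => by positivity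
  have key : ∀ n : ℕ, ∃ (G : ℝ → ℝ) (v u θ : ℕ → ℝ → ℝ), Driven ε L A U H
      (fun x t => G (ser (bc L) θ x (max t 0))) v u θ ∧ (∀ x, ∀ t ∈ Icc (0 : ℝ) n,
        0 < ser (bc L) θ x t ∧ ser (bc L) θ x t < b n
        ∧ G (ser (bc L) θ x t) = F (ser (bc L) θ x t)) ∧
      Continuous (uncurry fun x t => ser (bc L) θ x (max t 0)) := by
    intro n
    obtain ⟨G, G', G'', dG, dG', cG'', hGF, hGle, ⟨B, hB⟩, ⟨K, hK⟩⟩ :=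
      exists_truncation dF dF' cF'' (hbpos n)
    obtain ⟨v, u, θ, hdrv⟩ := exists_solution hε hL hA hU hH hB hK
    have h : Setup ε L A U H G G' G'' v u θ := ⟨hε, hL, dA, dU, dH, dG, dG', cG'', hdrv⟩
    have hGM : ∀ s, 0 ≤ s → |G s| ≤ M * s := fun s hs => (hGle s).trans (hM s hs)
    have h0 : ∀ x, ser (bc L) θ x 0 = ∑' k, H k * bc L k x := fun x => by
      simp only [ser, hdrv.θ0]
    have hpos : ∀ x, ∀ t, 0 ≤ t → 0 < ser (bc L) θ x t := fun x t ht =>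
      h.theta_pos hGM hm₀ (fun x => by rw [h0]; exact hlow x) x ht
    have hEn : energy L v u θ 0 = E := by
      simp only [energy, hE, ser, hdrv.v0, hdrv.u0, hdrv.θ0]
    refine ⟨G, v, u, θ, hdrv, fun x t ht => ?_, h.cont_theta⟩
    have hlt := h.theta_le hGM (fun x t ht => (hpos x t ht).le) hm₁
      (fun x => by rw [h0]; exact hup x) x ht.1
    rw [hEn] at hlt
    have hlt' : ser (bc L) θ x t < b n := lt_of_lt_of_le hlt (hbmono ht.2)
    refine ⟨hpos x t ht.1, hlt', hGF _ ?_⟩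
    rw [abs_of_pos (hpos x t ht.1)]
    exact hlt'.le
  choose G v u θ hdrv hprop hcont using key
  have huniq : ∀ n m : ℕ, ∀ x t : ℝ, 0 ≤ t → t ≤ n → t ≤ m →
      ser (bc L) (θ n) x t = ser (bc L) (θ m) x t := by
    intro n m x t ht hn hm
    obtain ⟨K, hK⟩ := (isCompact_Icc (a := (0 : ℝ)) (b := max (b n) (b m)))
        |>.exists_bound_of_continuousOn
      cF'.continuousOn
    have hK0 : 0 ≤ K := (norm_nonneg _).trans (hK 0 ⟨le_rfl, (hbpos n).le.trans (le_max_left _ _)⟩)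
    refine (hdrv n).ser_eq hε hL hA hU hH (hdrv m) hK0 (T := t) (fun y _ s hs => ?_) x ⟨ht, le_rfl⟩
    obtain ⟨h1, h2, h3⟩ := hprop n y s ⟨hs.1, hs.2.trans hn⟩
    obtain ⟨h4, h5, h6⟩ := hprop m y s ⟨hs.1, hs.2.trans hm⟩
    rw [max_eq_left hs.1, h3, h6]
    exact exists_lipschitz_of_bound dF (convex_Icc 0 (max (b n) (b m))) hK
      ⟨h1.le, h2.le.trans (le_max_left _ _)⟩ ⟨h4.le, h5.le.trans (le_max_right _ _)⟩
  set w : ℝ → ℝ → ℝ := fun x t => ser (bc L) (θ (⌈max t 0⌉₊ + 1)) x (max t 0) with hw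
  have hceil : ∀ t : ℝ, max t 0 ≤ ((⌈max t 0⌉₊ + 1 : ℕ) : ℝ) := fun t => by
    push_cast
    linarith [Nat.le_ceil (max t 0)]
  have hwN : ∀ N : ℕ, ∀ x t : ℝ, max t 0 ≤ N → w x t = ser (bc L) (θ N) x (max t 0) :=
    fun N x t hN =>
    huniq _ _ x _ (le_max_right _ _) (hceil t) hN
  have hcw : Continuous (uncurry w) := by
    refine continuous_iff_continuousAt.2 fun p => ?_
    refine (hcont (⌈max p.2 0⌉₊ + 1)).continuousAt.congr_of_eventuallyEq ?_
    have hlt : max p.2 0 < ((⌈max p.2 0⌉₊ + 1 : ℕ) : ℝ) := by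
      push_cast
      linarith [Nat.le_ceil (max p.2 0)]
    have hopen : IsOpen {q : ℝ × ℝ | max q.2 0 < ((⌈max p.2 0⌉₊ + 1 : ℕ) : ℝ)} :=
      isOpen_lt (by fun_prop) continuous_const
    filter_upwards [hopen.mem_nhds hlt] with q hq
    exact hwN _ q.1 q.2 (le_of_lt hq)
  obtain ⟨v', u', θ', hd'⟩ := exists_driven hε hL hA hU H (G := fun x t => F (w x t))
    (cF.comp hcw)
  have hθ' : ∀ x t, 0 ≤ t → ser (bc L) θ' x t = w x t := by
    intro x t ht
    have hN := hceil t
    rw [max_eq_left ht] at hN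
    have := hd'.ser_eq hε hL hA hU hH (hdrv (⌈t⌉₊ + 1)) le_rfl (T := t) (fun y _ s hs => ?_) x
      ⟨ht, le_rfl⟩
    · simp only [this, hw, max_eq_left ht]
    · have hsN := hs.2.trans hN
      rw [hwN _ y s (by rwa [max_eq_left hs.1]), max_eq_left hs.1,
        (hprop (⌈t⌉₊ + 1) y s ⟨hs.1, hsN⟩).2.2]
      simp
  have hfun : (fun x t => F (w x t)) = fun x t => F (ser (bc L) θ' x (max t 0)) := by
    funext x t
    rw [hθ' x _ (le_max_right _ _)]
    simp only [hw, max_eq_left (le_max_right t 0)]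
  rw [hfun] at hd'
  refine ⟨v', u', θ', ⟨hε, hL, dA, dU, dH, dF, dF', cF'', hd'⟩, fun x t ht => ?_⟩
  rw [hθ' x t ht]
  exact (hprop _ x _ ⟨le_max_right _ _, hceil t⟩).1

/-- Gluing two functions with matching one-sided derivatives at `0`. -/
lemma hasDerivAt_glue {g g' p p' : ℝ → ℝ}
    (hg : ∀ x ∈ Ici (0 : ℝ), HasDerivWithinAt g (g' x) (Ici 0) x)
    (hp : ∀ x, HasDerivAt p (p' x) x) (h0 : p 0 = g 0) (h0' : p' 0 = g' 0) (s : ℝ) :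
    HasDerivAt (fun s => if 0 ≤ s then g s else p s) (if 0 ≤ s then g' s else p' s) s := by
  have hr : ∀ s : ℝ, 0 ≤ s →
      HasDerivWithinAt (fun s => if 0 ≤ s then g s else p s) (g' s) (Ici 0) s :=
    fun s hs => (hg s hs).congr (fun x hx => by rw [if_pos (mem_Ici.1 hx)]) (by rw [if_pos hs])
  rcases lt_trichotomy s 0 with h | h | h
  · rw [if_neg (not_le.2 h)]
    refine (hp s).congr_of_eventuallyEq ?_
    filter_upwards [Iio_mem_nhds h] with x hx
    rw [if_neg (not_le.2 hx)]
  · subst h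
    rw [if_pos le_rfl]
    have hl : HasDerivWithinAt (fun s => if 0 ≤ s then g s else p s) (g' 0) (Iic 0) 0 := by
      rw [← h0']
      refine (hp 0).hasDerivWithinAt.congr (fun x hx => ?_) (by rw [if_pos le_rfl, h0])
      rcases (mem_Iic.1 hx).lt_or_eq with h | h
      · rw [if_neg (not_le.2 h)]
      · rw [h, if_pos le_rfl, h0]
    have := (hr 0 le_rfl).union hl
    rwa [Ici_union_Iic, hasDerivWithinAt_univ] at this
  · rw [if_pos h.le]
    exact (hr s h.le).hasDerivAt (Ici_mem_nhds h)

/-- Extension of the nonlinearity to the whole line. -/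
lemma exists_extension {f f' f'' : ℝ → ℝ} (hf : HypF f f' f'') :
    ∃ F F' F'' : ℝ → ℝ, (∀ s, HasDerivAt F (F' s) s) ∧ (∀ s, HasDerivAt F' (F'' s) s) ∧
      Continuous F'' ∧ (∀ s, 0 ≤ s → F s = f s) ∧ ∃ M, ∀ s, 0 ≤ s → |F s| ≤ M * s := by
  have dp1 : ∀ x : ℝ, HasDerivAt (fun s => f' 0 + f'' 0 * s) (f'' 0) x := fun x =>
    (((hasDerivAt_id x).const_mul (f'' 0)).const_add (f' 0)).congr_deriv (by simp)
  have dp0 : ∀ x : ℝ, HasDerivAt (fun s => f' 0 * s + f'' 0 * (s ^ 2 / 2)) (f' 0 + f'' 0 * x) x :=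
    fun x => (((hasDerivAt_id x).const_mul (f' 0)).add
      (((hasDerivAt_pow 2 x).div_const 2).const_mul (f'' 0))).congr_deriv (by simp)
  have hF := hasDerivAt_glue hf.hasDeriv₁ dp0 (by simp [hf.zero]) (by simp)
  obtain ⟨M, hM⟩ := hf.bdd
  refine ⟨_, _, fun s => f'' (max s 0), hF, fun s => ?_, ?_,
    fun s hs => if_pos hs, M, fun s hs => ?_⟩
  · refine (hasDerivAt_glue hf.hasDeriv₂ dp1 (by simp) rfl s).congr_deriv ?_
    split_ifs with h
    · simp only [max_eq_left h]
    · simp only [max_eq_right (not_le.1 h).le]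
  · exact hf.cont₂.comp_continuous (by fun_prop) fun s => mem_Ici.2 (le_max_right s 0)
  · have := exists_lipschitz_of_bound hF (convex_Ici 0) (K := M) (fun x hx => by
      rw [if_pos (mem_Ici.1 hx)]; exact (hM x hx).1) (x := s) (y := 0) hs (mem_Ici.2 le_rfl)
    simpa only [if_pos hs, if_pos le_rfl, hf.zero, sub_zero, abs_of_nonneg hs] using this

lemma decS_coef {L : ℝ} (hL : 0 < L) (p : ℕ) : ∀ {g : ℝ → ℝ}, ContDiff ℝ (⊤ : ℕ∞) g → ∀ c : ℝ,
    (g =ᶠ[nhds L] fun _ => c) → (g =ᶠ[nhds (-L)] fun _ => c) →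
    DecS L p (sc L g) ∧ DecS L p (cc L g) := by
  induction p with
  | zero =>
    intro g hg c _ _
    obtain ⟨B, hB⟩ := (isCompact_Icc (a := -L) (b := L)).exists_bound_of_continuousOn
      hg.continuous.continuousOn
    have hB0 : 0 ≤ B := (norm_nonneg _).trans (hB 0 ⟨by linarith, hL.le⟩)
    exact ⟨⟨2 * B, by linarith, fun k _ => by simpa using abs_sc_le hL hB k⟩,
      ⟨2 * B, by linarith, fun k _ => by simpa using abs_cc_le hL hB k⟩⟩
  | succ p ih =>
    intro g hg c h1 h2
    have hg' := contDiff_deriv hg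
    have e1 := h1.deriv
    have e2 := h2.deriv
    rw [deriv_const'] at e1 e2
    obtain ⟨⟨C, hC, hs⟩, ⟨D, hD, hc⟩⟩ := ih hg' 0 e1 e2
    refine ⟨⟨D, hD, fun k hk => ?_⟩, ⟨C, hC, fun k hk => ?_⟩⟩
    · have := hc k hk
      rwa [← lam_mul_sc (hasDerivAt_smooth hg) hg'.continuous (h2.eq_of_nhds.trans
        h1.eq_of_nhds.symm), abs_mul, abs_of_nonneg (lam_nonneg hL k), ← mul_assoc,
        ← pow_succ] at this
    · have := hs k hk
      rwa [← abs_neg, ← lam_mul_cc hL (hasDerivAt_smooth hg) hg'.continuous, abs_mul,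
        abs_of_nonneg (lam_nonneg hL k), ← mul_assoc, ← pow_succ] at this

lemma exists_margin {a b : ℝ} {K : Set ℝ} (hK : IsCompact K) (hKab : K ⊆ Ioo a b) :
    ∃ δ > 0, ∀ x ∈ K, a + δ ≤ x ∧ x ≤ b - δ := by
  rcases K.eq_empty_or_nonempty with rfl | hne
  · exact ⟨1, one_pos, by simp⟩
  · obtain ⟨y, hy, hmin⟩ := hK.exists_isMinOn hne continuousOn_id
    obtain ⟨z, hz, hmax⟩ := hK.exists_isMaxOn hne continuousOn_id
    refine ⟨min (y - a) (b - z), lt_min (by linarith [(hKab hy).1]) (by linarith [(hKab hz).2]),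
      fun x hx => ?_⟩
    have h1 : y ≤ x := hmin hx
    have h2 : x ≤ z := hmax hx
    exact ⟨by linarith [min_le_left (y - a) (b - z)], by linarith [min_le_right (y - a) (b - z)]⟩

/-- Sine expansion of a smooth function with compact support in the interval. -/
lemma exists_sine_data {a b : ℝ} (hab : a < b) {φ : ℝ → ℝ} (hφ : ContDiff ℝ (⊤ : ℕ∞) φ)
    {K : Set ℝ} (hK : IsCompact K) (hKab : K ⊆ Ioo a b) (h0 : ∀ x, x ∉ K → φ x = 0) :
    ∃ A : ℕ → ℝ, (∀ p, DecS (b - a) p A) ∧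
      ∀ x ∈ Icc a b, φ x = ∑' k, A k * bs (b - a) k (x - a) := by
  set L := b - a with hLdef
  have hL : 0 < L := by linarith
  obtain ⟨δ, hδ, hm⟩ := exists_margin hK hKab
  have hl : ∀ y, y < δ → φ (a + y) = 0 := fun y hy =>
    h0 _ fun hx => by linarith [(hm _ hx).1]
  have hr : ∀ y, L - δ < y → φ (a + y) = 0 := fun y hy =>
    h0 _ fun hx => by linarith [(hm _ hx).2]
  set g : ℝ → ℝ := fun y => φ (a + y) - φ (a + -y) with hg
  have hgs : ContDiff ℝ (⊤ : ℕ∞) g := by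
    refine (hφ.comp (by fun_prop)).sub (hφ.comp (by fun_prop))
  have e1 : g =ᶠ[nhds L] fun _ => 0 := by
    filter_upwards [Ioi_mem_nhds (show L - δ < L by linarith), Ioi_mem_nhds hL] with y h1 h2
    rw [mem_Ioi] at h1 h2
    simp only [hg]
    rw [hr y h1, hl (-y) (by linarith), sub_zero]
  have e2 : g =ᶠ[nhds (-L)] fun _ => 0 := by
    filter_upwards [Iio_mem_nhds (show -L < -L + δ by linarith),
      Iio_mem_nhds (show -L < 0 by linarith)] with y h1 h2
    rw [mem_Iio] at h1 h2
    simp only [hg]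
    rw [hr (-y) (by linarith), hl y (by linarith), sub_zero]
  have hdec := fun p => (decS_coef hL p hgs 0 e1 e2).1
  have hodd : ∀ k, cc L g k = 0 := cc_of_odd L fun x => by simp only [hg, neg_neg]; ring
  refine ⟨sc L g, hdec, fun x hx => ?_⟩
  have hsum : Summable fun k => |sc L g k| := by
    simpa using (hdec 2).summable hL (j := 0) (by norm_num)
  have := fourier_expansion hL hgs.continuous (e2.eq_of_nhds.trans e1.eq_of_nhds.symm)
    (by simp [hodd, summable_zero]) hsum (x := x - a) ⟨by linarith [hx.1], by linarith [hx.2]⟩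
  simp only [hodd, zero_mul, tsum_zero, zero_add] at this
  rw [← this]
  simp only [hg]
  rw [hl (-(x - a)) (by linarith [hx.1]), sub_zero, add_sub_cancel]

lemma eq_of_deriv_eq_zero {φ : ℝ → ℝ} (hφ : ContDiff ℝ (⊤ : ℕ∞) φ) {S : Set ℝ} (hS : Convex ℝ S)
    (h0 : ∀ x ∈ S, deriv φ x = 0) {x y : ℝ} (hx : x ∈ S) (hy : y ∈ S) : φ x = φ y := by
  have := exists_lipschitz_of_bound (hasDerivAt_smooth hφ) hS (K := 0)
    (fun x hx => by rw [h0 x hx, abs_zero]) hx hy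
  rw [zero_mul] at this
  exact sub_eq_zero.1 (abs_nonpos_iff.1 this)

/-- Cosine expansion of a smooth positive function with derivative compactly supported in the
interval. -/
lemma exists_cosine_data {a b : ℝ} (hab : a < b) {φ : ℝ → ℝ} (hφ : ContDiff ℝ (⊤ : ℕ∞) φ)
    (hpos : ∀ x ∈ Icc a b, 0 < φ x) {K : Set ℝ} (hK : IsCompact K) (hKab : K ⊆ Ioo a b)
    (h0 : ∀ x, x ∉ K → deriv φ x = 0) :
    ∃ H : ℕ → ℝ, (∀ p, DecS (b - a) p H) ∧
      (∀ x ∈ Icc a b, φ x = ∑' k, H k * bc (b - a) k (x - a)) ∧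
      ∃ m₀ m₁ : ℝ, 0 < m₀ ∧ ∀ x, m₀ < ∑' k, H k * bc (b - a) k x ∧
        ∑' k, H k * bc (b - a) k x < m₁ := by
  set L := b - a with hLdef
  have hL : 0 < L := by linarith
  obtain ⟨δ, hδ, hm⟩ := exists_margin hK hKab
  have hl : ∀ y, y < δ → φ (a + y) = φ a := fun y hy =>
    eq_of_deriv_eq_zero hφ (convex_Iio (a + δ))
      (fun x hx => h0 x fun hx' => by linarith [(hm x hx').1, mem_Iio.1 hx])
      (mem_Iio.2 (by linarith)) (mem_Iio.2 (by linarith))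
  have hr : ∀ y, L - δ < y → φ (a + y) = φ b := fun y hy =>
    eq_of_deriv_eq_zero hφ (convex_Ioi (b - δ))
      (fun x hx => h0 x fun hx' => by linarith [(hm x hx').2, mem_Ioi.1 hx])
      (mem_Ioi.2 (by linarith)) (mem_Ioi.2 (by linarith))
  set g : ℝ → ℝ := fun y => φ (a + y) + φ (a + -y) - φ a with hg
  have hgs : ContDiff ℝ (⊤ : ℕ∞) g :=
    ((hφ.comp (by fun_prop)).add (hφ.comp (by fun_prop))).sub contDiff_const
  have e1 : g =ᶠ[nhds L] fun _ => φ b := by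
    filter_upwards [Ioi_mem_nhds (show L - δ < L by linarith), Ioi_mem_nhds hL] with y h1 h2
    rw [mem_Ioi] at h1 h2
    simp only [hg]
    rw [hr y h1, hl (-y) (by linarith), add_sub_cancel_right]
  have e2 : g =ᶠ[nhds (-L)] fun _ => φ b := by
    filter_upwards [Iio_mem_nhds (show -L < -L + δ by linarith),
      Iio_mem_nhds (show -L < 0 by linarith)] with y h1 h2
    rw [mem_Iio] at h1 h2
    simp only [hg]
    rw [hr (-y) (by linarith), hl y (by linarith), add_sub_cancel_left]
  have hdec := fun p => (decS_coef hL p hgs (φ b) e1 e2).2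
  have heven : ∀ k, sc L g k = 0 := sc_of_even L fun x => by simp only [hg, neg_neg]; ring
  have hsum : Summable fun k => |cc L g k| := by
    simpa using (hdec 2).summable hL (j := 0) (by norm_num)
  have hexp : ∀ y ∈ Icc 0 L, φ (a + y) = ∑' k, cc L g k * bc L k y := by
    intro y hy
    have := fourier_expansion hL hgs.continuous (e2.eq_of_nhds.trans e1.eq_of_nhds.symm)
      hsum (by simp [heven, summable_zero]) (x := y) ⟨by linarith [hy.1], hy.2⟩
    simp only [heven, zero_mul, tsum_zero, add_zero] at this
    rw [← this]
    simp only [hg]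
    rw [hl (-y) (by linarith [hy.1]), add_sub_cancel_right]
  have hred : ∀ x, ∃ y ∈ Icc a b, ∑' k, cc L g k * bc L k x = φ y := by
    intro x
    obtain ⟨y, hy, hxy⟩ := exists_mem_Icc_of_periodic hL
      (g := fun x => ∑' k, cc L g k * bc L k x) (fun x => by
        simp only [bc_periodic hL _ x]) x
    have habs : ∑' k, cc L g k * bc L k y = ∑' k, cc L g k * bc L k |y| := by
      rcases abs_choice y with h | h <;> simp only [h, bc_neg]
    have hy' : |y| ∈ Icc 0 L := ⟨abs_nonneg y, abs_le.2 hy⟩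
    exact ⟨a + |y|, ⟨by linarith [hy'.1], by linarith [hy'.2]⟩,
      hxy.trans (habs.trans (hexp _ hy').symm)⟩
  obtain ⟨y₀, hy₀, hmin⟩ := isCompact_Icc.exists_isMinOn (nonempty_Icc.2 hab.le)
    hφ.continuous.continuousOn
  obtain ⟨y₁, hy₁, hmax⟩ := isCompact_Icc.exists_isMaxOn (nonempty_Icc.2 hab.le)
    hφ.continuous.continuousOn
  refine ⟨cc L g, hdec, fun x hx => ?_, φ y₀ / 2, φ y₁ + 1, half_pos (hpos y₀ hy₀), fun x => ?_⟩
  · rw [← hexp (x - a) ⟨by linarith [hx.1], by linarith [hx.2]⟩, add_sub_cancel]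
  · obtain ⟨y, hy, hxy⟩ := hred x
    have h1 : φ y₀ ≤ φ y := hmin hy
    have h2 : φ y ≤ φ y₁ := hmax hy
    have h3 := hpos y₀ hy₀
    rw [hxy]
    exact ⟨by linarith, by linarith⟩

/-- The coefficients `lam ^ j * c`. -/
def pw (L : ℝ) (j : ℕ) (c : ℕ → ℝ → ℝ) (k : ℕ) (t : ℝ) : ℝ := lam L k ^ j * c k t

/-- A scaled trigonometric series on the interval with left endpoint `a`. -/
def mode (L σ : ℝ) (e : ℕ → ℝ → ℝ) (a : ℝ) (j : ℕ) (c : ℕ → ℝ → ℝ) (x t : ℝ) : ℝ :=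
  σ * ser e (extT (pw L j c)) (x - a) t

section Mode

variable {L a σ : ℝ} {e c d : ℕ → ℝ → ℝ} {j : ℕ}

lemma mode_of_nonneg {t : ℝ} (ht : 0 ≤ t) (x : ℝ) :
    mode L σ e a j c x t = σ * ser e (pw L j c) (x - a) t := by
  rw [mode, ser_extT ht]

lemma extT_pw_succ (k : ℕ) (t : ℝ) :
    extT (pw L (j + 1) c) k t = lam L k * extT (pw L j c) k t := by
  unfold extT pw
  split_ifs <;> ring

lemma summable_lam_extT (h : ∀ T, US (pw L (j + 1) c) (Icc 0 T)) (t : ℝ) :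
    Summable fun k => |lam L k * extT (pw L j c) k t| :=
  (summable_extT h t).congr fun k => by rw [extT_pw_succ]

lemma hasDerivAt_mode_bs (hL : 0 < L) (h : ∀ T, US (pw L (j + 1) c) (Icc 0 T)) (x t : ℝ) :
    HasDerivAt (fun y => mode L σ (bs L) a j c y t) (mode L σ (bc L) a (j + 1) c x t) x := by
  have := ((hasDerivAt_tsum_bs hL (summable_lam_extT h t) (x - a)).comp_sub_const x a).const_mul σ
  refine this.congr_deriv ?_
  simp only [mode, ser, extT_pw_succ]

lemma hasDerivAt_mode_bc (hL : 0 < L) (h : ∀ T, US (pw L (j + 1) c) (Icc 0 T)) (x t : ℝ) :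
    HasDerivAt (fun y => mode L σ (bc L) a j c y t) (mode L (-σ) (bs L) a (j + 1) c x t) x := by
  have := ((hasDerivAt_tsum_bc hL (summable_lam_extT h t) (x - a)).comp_sub_const x a).const_mul σ
  refine this.congr_deriv ?_
  simp only [mode, ser, extT_pw_succ, neg_mul, tsum_neg, mul_neg]

lemma pdx_mode_bs (hL : 0 < L) (h : ∀ T, US (pw L (j + 1) c) (Icc 0 T)) :
    pdx (mode L σ (bs L) a j c) = mode L σ (bc L) a (j + 1) c :=
  funext fun x => funext fun t => (hasDerivAt_mode_bs hL h x t).deriv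

lemma pdx_mode_bc (hL : 0 < L) (h : ∀ T, US (pw L (j + 1) c) (Icc 0 T)) :
    pdx (mode L σ (bc L) a j c) = mode L (-σ) (bs L) a (j + 1) c :=
  funext fun x => funext fun t => (hasDerivAt_mode_bc hL h x t).deriv

lemma continuousOn_ser_shift (he : Sys e) (hc : ∀ k, Continuous (c k))
    (h : ∀ T, US c (Icc 0 T)) (S : Set ℝ) :
    ContinuousOn (uncurry fun x t => σ * ser e c (x - a) t) (S ×ˢ Ici 0) := by
  have h1 := (continuous_ser_max he hc h).comp
    (show Continuous fun p : ℝ × ℝ => (p.1 - a, p.2) by fun_prop)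
  refine (h1.const_mul σ).continuousOn.congr fun p hp => ?_
  simp only [uncurry, comp, max_eq_left (mem_Ici.1 hp.2)]

lemma continuousOn_mode (he : Sys e) (hc : ∀ k, Continuous (c k))
    (h : ∀ T, US (pw L j c) (Icc 0 T)) (S : Set ℝ) :
    ContinuousOn (uncurry (mode L σ e a j c)) (S ×ˢ Ici 0) :=
  (continuousOn_ser_shift he (fun k => (hc k).const_mul _) h S).congr fun _ hp =>
    mode_of_nonneg hp.2 _

lemma hasDerivAt_mode_time (he : Sys e) (h : ∀ k t, HasDerivAt (c k) (d k t) t)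
    (hc : ∀ T, US (pw L j c) (Icc 0 T)) (hd : ∀ T, US (pw L j d) (Icc 0 T)) (x t : ℝ) :
    HasDerivAt (fun s => mode L σ e a j c x s) (σ * ser e (pw L j d) (x - a) |t|) t :=
  (hasDerivAt_ser_extT he (fun k s => (h k s).const_mul _) hc hd (x - a) t).const_mul σ

lemma pdt_mode (he : Sys e) (h : ∀ k t, HasDerivAt (c k) (d k t) t)
    (hc : ∀ T, US (pw L j c) (Icc 0 T)) (hd : ∀ T, US (pw L j d) (Icc 0 T)) (x : ℝ) {t : ℝ}
    (ht : 0 ≤ t) : pdt (mode L σ e a j c) x t = σ * ser e (pw L j d) (x - a) t := by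
  rw [pdt, (hasDerivAt_mode_time he h hc hd x t).deriv, abs_of_nonneg ht]

lemma continuousOn_pdt_mode (he : Sys e) (h : ∀ k t, HasDerivAt (c k) (d k t) t)
    (hcont : ∀ k, Continuous (d k)) (hc : ∀ T, US (pw L j c) (Icc 0 T))
    (hd : ∀ T, US (pw L j d) (Icc 0 T)) (S : Set ℝ) :
    ContinuousOn (uncurry (pdt (mode L σ e a j c))) (S ×ˢ Ici 0) :=
  (continuousOn_ser_shift he (fun k => (hcont k).const_mul _) hd S).congr fun _ hp =>
    pdt_mode he h hc hd _ hp.2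

lemma US.pw_zero {I : Set ℝ} (h : US c I) : US (pw L 0 c) I :=
  h.congr fun k _ t _ => by rw [pw, pow_zero, one_mul]

lemma ser_pw_zero (x t : ℝ) : ser e (pw L 0 c) x t = ser e c x t :=
  ser_congr (fun k => by rw [pw, pow_zero, one_mul]) x

lemma ser_pw_one (x t : ℝ) : ser e (pw L 1 c) x t = ser e (fun k t => lam L k * c k t) x t :=
  ser_congr (fun k => by rw [pw, pow_one]) x

end Mode

section DerivV

variable {ε L a : ℝ} {A U H : ℕ → ℝ} {F F' F'' : ℝ → ℝ} {v u θ : ℕ → ℝ → ℝ}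

namespace Setup

lemma pdt_mode_v_one (h : Setup ε L A U H F F' F'' v u θ) (x : ℝ) {t : ℝ} (ht : 0 < t) :
    pdt (mode L 1 (bc L) a 1 v) x t
      = ser (bc L) (fun k t => lam L k * dotV ε L F v u θ k t) (x - a) t := by
  have h1 : US (fun k t => lam L k * dotV ε L F v u θ k t) (Ioo (t / 2) (t + 1)) :=
    (h.us_lam_dotV (half_pos ht) (t + 1)).mono Ioo_subset_Icc_self
  have h2 := h1.hasDerivAt_time isOpen_Ioo (sys_bc L).bdd (c := pw L 1 v) (fun s hs =>
    ((h.dec_v s).us h.hL (j := 1) (by norm_num)).summable (t := s)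
      ⟨by linarith [hs.1], le_rfl⟩) (fun k s _ =>
        ((h.dv k s).const_mul (lam L k ^ 1)).congr_deriv (by rw [pow_one, dotV])) (x - a)
    (t := t) ⟨by linarith, by linarith⟩
  refine (h2.congr_of_eventuallyEq ?_).deriv
  filter_upwards [lt_mem_nhds ht] with s hs
  rw [mode_of_nonneg (le_of_lt hs), one_mul]

lemma cont_dotV (h : Setup ε L A U H F F' F'' v u θ) (k : ℕ) :
    Continuous (dotV ε L F v u θ k) :=
  ((h.cont_v k).const_mul _).add (((h.cont_stress k).const_mul _).sub ((h.cont_u k).const_mul _))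

lemma continuousOn_ser_lam_dotV (h : Setup ε L A U H F F' F'' v u θ) :
    ContinuousOn (uncurry (ser (bc L) fun k t => lam L k * dotV ε L F v u θ k t))
      (univ ×ˢ Ioi 0) := by
  intro p hp
  have hp2 : 0 < p.2 := hp.2
  have h1 := (h.us_lam_dotV (half_pos hp2) (p.2 + 1)).continuousOn_ser (sys_bc L)
    fun k => ((h.cont_dotV k).const_mul (lam L k)).continuousOn
  exact (h1.continuousAt (prod_mem_nhds univ_mem
    (Icc_mem_nhds (by linarith) (by linarith)))).continuousWithinAt

lemma integrableOn_pdt_mode_v (h : Setup ε L A U H F F' F'' v u θ) (b : ℝ) {p : ℝ} (hp : 0 ≤ p)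
    (T : ℝ) : IntegrableOn (fun q : ℝ × ℝ => |pdt (mode L 1 (bc L) a 1 v) q.1 q.2| ^ p)
      (Icc a b ×ˢ Icc 0 T) := by
  have hae : (Icc a b ×ˢ Icc 0 T : Set (ℝ × ℝ)) =ᵐ[volume] (Icc a b ×ˢ Ioc 0 T : Set (ℝ × ℝ)) :=
    Measure.set_prod_ae_eq (ae_eq_refl _) Ioc_ae_eq_Icc.symm
  rw [integrableOn_congr_set_ae hae]
  obtain ⟨C, hC⟩ := h.exists_lam_dotV_bound T
  have hms : MeasurableSet (Icc a b ×ˢ Ioc 0 T : Set (ℝ × ℝ)) :=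
    measurableSet_Icc.prod measurableSet_Ioc
  have hcont : ContinuousOn (fun q : ℝ × ℝ => |pdt (mode L 1 (bc L) a 1 v) q.1 q.2| ^ p)
      (Icc a b ×ˢ Ioc 0 T) := by
    have h1 : ContinuousOn (fun q : ℝ × ℝ =>
        |uncurry (ser (bc L) fun k t => lam L k * dotV ε L F v u θ k t) (q.1 - a, q.2)| ^ p)
        (Icc a b ×ˢ Ioc 0 T) :=
      (h.continuousOn_ser_lam_dotV.comp (by fun_prop)
        fun q hq => ⟨mem_univ _, hq.2.1⟩).abs.rpow_const fun _ _ => Or.inr hp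
    refine h1.congr fun q hq => ?_
    simp only [h.pdt_mode_v_one q.1 hq.2.1, uncurry]
  refine IntegrableOn.of_bound ?_ (hcont.aestronglyMeasurable hms) (|C| ^ p) ?_
  · refine lt_of_le_of_lt (measure_mono (prod_mono_right Ioc_subset_Icc_self))
      (isCompact_Icc.prod isCompact_Icc).measure_lt_top
  · filter_upwards [ae_restrict_mem hms] with q hq
    rw [Real.norm_of_nonneg (by positivity), h.pdt_mode_v_one q.1 hq.2.1]
    exact Real.rpow_le_rpow (abs_nonneg _) ((hC _ _ hq.2).trans (le_abs_self C)) hp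

end Setup

end DerivV

namespace Setup

variable {ε a b : ℝ} {A U H : ℕ → ℝ} {F F' F'' : ℝ → ℝ} {v u θ : ℕ → ℝ → ℝ}

lemma isClassicalSolEps (hab : a < b) (h : Setup ε (b - a) A U H F F' F'' v u θ)
    (hpos : ∀ x, ∀ t, 0 ≤ t → 0 < ser (bc (b - a)) θ x t) {f v0 u0 Θ0 : ℝ → ℝ}
    (hf : ∀ s, 0 ≤ s → F s = f s)
    (hv0 : ∀ x ∈ Icc a b, v0 x = ∑' k, A k * bs (b - a) k (x - a))
    (hu0 : ∀ x ∈ Icc a b, u0 x = ∑' k, U k * bs (b - a) k (x - a))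
    (hΘ0 : ∀ x ∈ Icc a b, Θ0 x = ∑' k, H k * bc (b - a) k (x - a)) :
    IsClassicalSolEps a b f ε v0 u0 Θ0 (mode (b - a) 1 (bs (b - a)) a 0 v)
        (mode (b - a) 1 (bs (b - a)) a 0 u) (mode (b - a) 1 (bc (b - a)) a 0 θ) ∧
      ContinuousOn (uncurry (pdt (pdx^[2] (mode (b - a) 1 (bs (b - a)) a 0 u))))
        (Icc a b ×ˢ Ici 0) ∧
      ContinuousOn (uncurry (pdx^[3] (mode (b - a) 1 (bs (b - a)) a 0 u))) (Icc a b ×ˢ Ici 0) ∧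
      ContinuousOn (uncurry (pdx^[4] (mode (b - a) 1 (bs (b - a)) a 0 u))) (Icc a b ×ˢ Ici 0) ∧
      ContinuousOn (uncurry (pdt (pdx (mode (b - a) 1 (bc (b - a)) a 0 θ))))
        (Icc a b ×ˢ Ici 0) ∧
      ∀ p : ℝ, 1 < p → ∀ T > (0 : ℝ), IntegrableOn (fun q : ℝ × ℝ =>
        |pdt (pdx (mode (b - a) 1 (bs (b - a)) a 0 v)) q.1 q.2| ^ p) (Icc a b ×ˢ Icc 0 T) := by
  have hL := h.hL
  set L := b - a with hLdef
  set V := mode L 1 (bs L) a 0 v with hV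
  set W := mode L 1 (bs L) a 0 u with hW
  set Θ := mode L 1 (bc L) a 0 θ with hΘ
  have usv : ∀ j, j + 1 ≤ 4 → ∀ T, US (pw L j v) (Icc 0 T) := fun j hj T =>
    (h.dec_v T).us h.hL (by omega)
  have usv4 : ∀ T, US (pw L 4 v) (Icc 0 T) := h.us_lam_four_v
  have usu : ∀ j, j + 1 ≤ 5 → ∀ T, US (pw L j u) (Icc 0 T) := fun j hj T =>
    (h.dec_u T).us h.hL (by omega)
  have usθ0 : ∀ T, US (pw L 0 θ) (Icc 0 T) := fun T => (h.us_theta T).pw_zero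
  have usθ1 : ∀ T, US (pw L 1 θ) (Icc 0 T) := fun T =>
    (h.us_lam_theta T).congr fun k _ t _ => by rw [pw, pow_one]
  have usθ2 : ∀ T, US (pw L 2 θ) (Icc 0 T) := h.us_lam_sq_theta
  have usdv := fun T => (h.us_dot_v T).pw_zero (L := L)
  have usdu2 : ∀ T, US (pw L 2 fun k t => -(ε * lam L k ^ 2) * u k t + v k t) (Icc 0 T) :=
    h.us_lam_sq_dot_u
  have usdu : ∀ T, US (pw L 0 fun k t => -(ε * lam L k ^ 2) * u k t + v k t) (Icc 0 T) :=
    fun T => (((usu 2 (by norm_num) T).const_mul (-ε)).add (usv 0 (by norm_num) T)).congr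
      fun k _ t _ => by simp only [pw]; ring
  have usdθ := fun T => (h.us_dotT T).pw_zero (L := L)
  have usdθ1 : ∀ T, US (pw L 1 (dotT L F v θ)) (Icc 0 T) := fun T =>
    (h.us_lam_dot_theta T).congr fun k _ t _ => by rw [pw, pow_one, dotT]
  have cu : ∀ k, Continuous fun t => -(ε * lam L k ^ 2) * u k t + v k t := fun k =>
    ((h.cont_u k).const_mul _).add (h.cont_v k)
  have v1 : pdx V = mode L 1 (bc L) a 1 v := pdx_mode_bs hL (usv 1 (by norm_num))
  have v2 : pdx (mode L 1 (bc L) a 1 v) = mode L (-1) (bs L) a 2 v :=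
    pdx_mode_bc hL (usv 2 (by norm_num))
  have v3 : pdx (mode L (-1) (bs L) a 2 v) = mode L (-1) (bc L) a 3 v :=
    pdx_mode_bs hL (usv 3 (by norm_num))
  have v4 : pdx (mode L (-1) (bc L) a 3 v) = mode L 1 (bs L) a 4 v := by
    simpa only [neg_neg] using pdx_mode_bc (a := a) (σ := -1) hL usv4
  have u1 : pdx W = mode L 1 (bc L) a 1 u := pdx_mode_bs hL (usu 1 (by norm_num))
  have u2 : pdx (mode L 1 (bc L) a 1 u) = mode L (-1) (bs L) a 2 u :=
    pdx_mode_bc hL (usu 2 (by norm_num))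
  have u3 : pdx (mode L (-1) (bs L) a 2 u) = mode L (-1) (bc L) a 3 u :=
    pdx_mode_bs hL (usu 3 (by norm_num))
  have u4 : pdx (mode L (-1) (bc L) a 3 u) = mode L 1 (bs L) a 4 u := by
    simpa only [neg_neg] using pdx_mode_bc (a := a) (σ := -1) hL (usu 4 (by norm_num))
  have θ1 : pdx Θ = mode L (-1) (bs L) a 1 θ := pdx_mode_bc hL usθ1
  have θ2 : pdx (mode L (-1) (bs L) a 1 θ) = mode L (-1) (bc L) a 2 θ := pdx_mode_bs hL usθ2
  have eV : ∀ x, ∀ t, 0 ≤ t → V x t = ser (bs L) v (x - a) t := fun x t ht => by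
    rw [hV, mode_of_nonneg ht, one_mul, ser_pw_zero]
  have eW : ∀ x, ∀ t, 0 ≤ t → W x t = ser (bs L) u (x - a) t := fun x t ht => by
    rw [hW, mode_of_nonneg ht, one_mul, ser_pw_zero]
  have eΘ : ∀ x, ∀ t, 0 ≤ t → Θ x t = ser (bc L) θ (x - a) t := fun x t ht => by
    rw [hΘ, mode_of_nonneg ht, one_mul, ser_pw_zero]
  have zl : ∀ (σ : ℝ) (j : ℕ) (c : ℕ → ℝ → ℝ) (t : ℝ), mode L σ (bs L) a j c a t = 0 :=
    fun σ j c t => by rw [mode, sub_self, ser_bs_zero, mul_zero]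
  have zr : ∀ (σ : ℝ) (j : ℕ) (c : ℕ → ℝ → ℝ) (t : ℝ), mode L σ (bs L) a j c b t = 0 :=
    fun σ j c t => by rw [mode, ← hLdef, ser_bs_L hL, mul_zero]
  have e2v : pdx^[2] V = mode L (-1) (bs L) a 2 v := by
    rw [iterate_succ_apply, iterate_one, v1, v2]
  have e3v : pdx^[3] V = mode L (-1) (bc L) a 3 v := by
    rw [iterate_succ_apply', e2v, v3]
  have e4v : pdx^[4] V = mode L 1 (bs L) a 4 v := by
    rw [iterate_succ_apply', e3v, v4]
  have e2u : pdx^[2] W = mode L (-1) (bs L) a 2 u := by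
    rw [iterate_succ_apply, iterate_one, u1, u2]
  have e3u : pdx^[3] W = mode L (-1) (bc L) a 3 u := by
    rw [iterate_succ_apply', e2u, u3]
  have e4u : pdx^[4] W = mode L 1 (bs L) a 4 u := by
    rw [iterate_succ_apply', e3u, u4]
  have e2θ : pdx^[2] Θ = mode L (-1) (bc L) a 2 θ := by
    rw [iterate_succ_apply, iterate_one, θ1, θ2]
  refine ⟨⟨?_, ?_, ?_, ?_, ?_, ?_, ?_, ?_, ?_, ?_, ?_, ?_, ?_, ?_, ?_, ?_, ?_, ?_, ?_, ?_⟩,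
    ?_, ?_, ?_, ?_, ?_⟩
  · intro k hk x _ t _
    interval_cases k
    · exact (hasDerivAt_mode_bs hL (usv 1 (by norm_num)) x t).differentiableAt
    · rw [iterate_one, v1]
      exact (hasDerivAt_mode_bc hL (usv 2 (by norm_num)) x t).differentiableAt
    · rw [e2v]
      exact (hasDerivAt_mode_bs hL (usv 3 (by norm_num)) x t).differentiableAt
    · rw [e3v]
      exact (hasDerivAt_mode_bc hL usv4 x t).differentiableAt
  · exact fun x _ t _ => (hasDerivAt_mode_time (sys_bs L) h.dv (usv 0 (by norm_num)) usdv
      x t).differentiableAt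
  · intro k hk
    interval_cases k
    · exact continuousOn_mode (sys_bs L) h.cont_v (usv 0 (by norm_num)) _
    · rw [iterate_one, v1]
      exact continuousOn_mode (sys_bc L) h.cont_v (usv 1 (by norm_num)) _
    · rw [e2v]
      exact continuousOn_mode (sys_bs L) h.cont_v (usv 2 (by norm_num)) _
    · rw [e3v]
      exact continuousOn_mode (sys_bc L) h.cont_v (usv 3 (by norm_num)) _
    · rw [e4v]
      exact continuousOn_mode (sys_bs L) h.cont_v usv4 _
  · exact continuousOn_pdt_mode (sys_bs L) h.dv h.cont_dotV (usv 0 (by norm_num)) usdv _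
  · intro k hk x _ t _
    interval_cases k
    · exact (hasDerivAt_mode_bs hL (usu 1 (by norm_num)) x t).differentiableAt
    · rw [iterate_one, u1]
      exact (hasDerivAt_mode_bc hL (usu 2 (by norm_num)) x t).differentiableAt
  · exact fun x _ t _ => (hasDerivAt_mode_time (sys_bs L) h.du (usu 0 (by norm_num)) usdu
      x t).differentiableAt
  · intro k hk
    interval_cases k
    · exact continuousOn_mode (sys_bs L) h.cont_u (usu 0 (by norm_num)) _
    · rw [iterate_one, u1]
      exact continuousOn_mode (sys_bc L) h.cont_u (usu 1 (by norm_num)) _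
    · rw [e2u]
      exact continuousOn_mode (sys_bs L) h.cont_u (usu 2 (by norm_num)) _
  · exact continuousOn_pdt_mode (sys_bs L) h.du cu (usu 0 (by norm_num)) usdu _
  · intro k hk x _ t _
    interval_cases k
    · exact (hasDerivAt_mode_bc hL usθ1 x t).differentiableAt
    · rw [iterate_one, θ1]
      exact (hasDerivAt_mode_bs hL usθ2 x t).differentiableAt
  · exact fun x _ t _ => (hasDerivAt_mode_time (sys_bc L) h.dθ usθ0 usdθ x t).differentiableAt
  · intro k hk
    interval_cases k
    · exact continuousOn_mode (sys_bc L) h.drv.cont_θ usθ0 _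
    · rw [iterate_one, θ1]
      exact continuousOn_mode (sys_bs L) h.drv.cont_θ usθ1 _
    · rw [e2θ]
      exact continuousOn_mode (sys_bc L) h.drv.cont_θ usθ2 _
  · exact continuousOn_pdt_mode (sys_bc L) h.dθ h.cont_dotT usθ0 usdθ _
  · intro x _ t ht
    rw [eΘ x t ht]
    exact hpos _ t ht
  · intro x hx t ht
    have ht' : 0 ≤ t := (mem_Ioi.1 ht).le
    have hx' : x - a ∈ Ioo (-L) L := ⟨by linarith [hx.1], by linarith [hx.2]⟩
    have h1 := h.eq_v hx' ht'
    have h2 : pdx (fun y s => f (Θ y s)) x t = deriv (fun y => F (ser (bc L) θ y t)) (x - a) := by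
      rw [← deriv_comp_sub_const (fun y => F (ser (bc L) θ y t))]
      simp only [pdx, eΘ _ t ht', hf _ (hpos _ t ht').le]
    rw [h2, e4v, e2u, hV, pdt_mode (sys_bs L) h.dv (usv 0 (by norm_num)) usdv x ht',
      mode_of_nonneg ht', mode_of_nonneg ht', ser_pw_zero, one_mul, one_mul, h1]
    unfold pw
    ring
  · intro x _ t ht
    have ht' : 0 ≤ t := (mem_Ioi.1 ht).le
    rw [e2u, hW, pdt_mode (sys_bs L) h.du (usu 0 (by norm_num)) usdu x ht', mode_of_nonneg ht',
      eV x t ht', ser_pw_zero, one_mul, h.eq_u _ ht']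
    unfold pw
    ring
  · intro x hx t ht
    have ht' : 0 ≤ t := (mem_Ioi.1 ht).le
    have hx' : x - a ∈ Icc (-L) L := ⟨by linarith [hx.1], by linarith [hx.2]⟩
    rw [e2θ, v1, eΘ x t ht', ← hf _ (hpos _ t ht').le, hΘ,
      pdt_mode (sys_bc L) h.dθ usθ0 usdθ x ht', mode_of_nonneg ht', mode_of_nonneg ht',
      ser_pw_zero, ser_pw_one, one_mul, one_mul]
    exact (h.eq_theta hx' ht').trans (by unfold pw; ring)
  · intro t _
    rw [e2v]
    exact ⟨zl _ _ _ t, zr _ _ _ t, zl _ _ _ t, zr _ _ _ t⟩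
  · exact fun t _ => ⟨zl _ _ _ t, zr _ _ _ t⟩
  · intro t _
    rw [θ1]
    exact ⟨zl _ _ _ t, zr _ _ _ t⟩
  · intro x hx
    rw [eV x 0 le_rfl, eW x 0 le_rfl, eΘ x 0 le_rfl, hv0 x hx, hu0 x hx, hΘ0 x hx]
    simp only [ser, h.drv.v0, h.drv.u0, h.drv.θ0, and_self]
  · rw [e2u]
    exact continuousOn_pdt_mode (sys_bs L) h.du cu (usu 2 (by norm_num)) usdu2 _
  · rw [e3u]
    exact continuousOn_mode (sys_bc L) h.cont_u (usu 3 (by norm_num)) _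
  · rw [e4u]
    exact continuousOn_mode (sys_bs L) h.cont_u (usu 4 (by norm_num)) _
  · rw [θ1]
    exact continuousOn_pdt_mode (sys_bs L) h.dθ h.cont_dotT usθ1 usdθ1 _
  · intro p hp T _
    rw [v1]
    exact h.integrableOn_pdt_mode_v b (by linarith) T

end Setup

end EpsReg

/-- Lemma 4.1: global classical solvability of the regularized
problems (P_ε). -/
theorem statement10
    (a b : ℝ) (hab : a < b)
    (f f' f'' : ℝ → ℝ) (hf : HypF f f' f'')
    (v0 u0 Θ0 : ℝ → ℝ) (hdata : SmoothData a b v0 u0 Θ0) :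
    ∀ ε ∈ Ioo (0 : ℝ) 1, ∃ v u Θ : ℝ → ℝ → ℝ,
      IsClassicalSolEps a b f ε v0 u0 Θ0 v u Θ ∧
      ContinuousOn (uncurry (pdt (pdx^[2] u))) ((Icc a b) ×ˢ (Ici 0)) ∧
      ContinuousOn (uncurry (pdx^[3] u)) ((Icc a b) ×ˢ (Ici 0)) ∧
      ContinuousOn (uncurry (pdx^[4] u)) ((Icc a b) ×ˢ (Ici 0)) ∧
      ContinuousOn (uncurry (pdt (pdx Θ))) ((Icc a b) ×ˢ (Ici 0)) ∧
      ∀ p : ℝ, 1 < p → ∀ T > (0 : ℝ),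
        IntegrableOn (fun q : ℝ × ℝ => |pdt (pdx v) q.1 q.2| ^ p)
          ((Icc a b) ×ˢ (Icc 0 T)) := by
  intro ε hε
  obtain ⟨F, F', F'', dF, dF', cF'', hf', M, hM⟩ := EpsReg.exists_extension hf
  obtain ⟨Kv, hKv, hKv', hv⟩ := hdata.v0_supp
  obtain ⟨Ku, hKu, hKu', hu⟩ := hdata.u0_supp
  obtain ⟨Kθ, hKθ, hKθ', hθ⟩ := hdata.Θ0x_supp
  obtain ⟨A, dA, hA⟩ := EpsReg.exists_sine_data hab hdata.v0_smooth hKv hKv' hv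
  obtain ⟨U, dU, hU⟩ := EpsReg.exists_sine_data hab hdata.u0_smooth hKu hKu' hu
  obtain ⟨H, dH, hH, m₀, m₁, hm₀, hm⟩ :=
    EpsReg.exists_cosine_data hab hdata.Θ0_smooth hdata.Θ0_pos hKθ hKθ' hθ
  obtain ⟨v, u, θ, h, hpos⟩ := EpsReg.exists_setup hε.1 (sub_pos.2 hab) (dA 7) (dU 7) (dH 6)
    dF dF' cF'' hM hm₀ (fun x => (hm x).1) (fun x => (hm x).2)
  exact ⟨_, _, _, h.isClassicalSolEps hab hpos hf' hA hU hH⟩
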